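/- Let q = p^f ≥ 13 with p an odd prime, and let G be a finite group satisfying the two-prime hypothesis with normal subgroups N ≤ M such that M/N ≅ PSL_2(q) and the centralizer of M/N in G/N is trivial. Let B_2 be the union, over all irreducible characters θ of N that are not M-invariant, of cd(G|θ) \ cd(G/N). Then |B_2| ≤ 9. -/

import Mathlib

open CategoryTheory

/-- The set of degrees of the complex irreducible characters of `G`. -/
def charDegrees (G : Type) [Group G] : Set ℕ :=
  {n | ∃ V : FDRep ℂ G, Simple V ∧ Module.finrank ℂ V = n}

/-- `G` satisfies the two-prime hypothesis: for any distinct irreducible character degrees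
`a`, `b`, the gcd `gcd a b` has at most two prime divisors counted with multiplicity. -/
def TwoPrimeHypothesis (G : Type) [Group G] : Prop :=
  ∀ a ∈ charDegrees G, ∀ b ∈ charDegrees G, a ≠ b →
    (Nat.gcd a b).primeFactorsList.length ≤ 2

/-- A character `θ` of a subgroup `N ⊴ G` is `M`-invariant if it is fixed by conjugation by
every element of `M`. -/
def IsMInvariant {G : Type} [Group G] {N : Subgroup G} (M : Subgroup G)
    (θ : FDRep ℂ N) : Prop :=
  ∀ m ∈ M, ∀ x : N, ∀ hx : m * (x : G) * m⁻¹ ∈ N,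
    θ.character ⟨m * (x : G) * m⁻¹, hx⟩ = θ.character x

/-- `cd(G|θ)`: the set of degrees of irreducible characters of `G` whose restriction to `N`
contains `θ` as a constituent (detected by a nonzero inner product of characters). -/
def charDegreesOver (G : Type) [Group G] (N : Subgroup G) (θ : FDRep ℂ N) : Set ℕ :=
  {n | ∃ V : FDRep ℂ G, Simple V ∧ Module.finrank ℂ V = n ∧
    (∑ᶠ x : N, V.character (x : G) * θ.character x⁻¹) ≠ 0}

/-- `PSL₂(F)`: the quotient of `SL₂(F)` by its center. -/
abbrev PSL2 (F : Type) [Field F] : Type :=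
  Matrix.SpecialLinearGroup (Fin 2) F ⧸
    Subgroup.center (Matrix.SpecialLinearGroup (Fin 2) F)

section RepBasics

variable {V V' : Type} [AddCommGroup V] [Module ℂ V] [AddCommGroup V'] [Module ℂ V']
variable {Γ : Type} [Group Γ]

/-- `W` is stable under the subgroup `K`. -/
def InvS (ρ : Representation ℂ Γ V) (K : Subgroup Γ) (W : Submodule ℂ V) : Prop :=
  ∀ k ∈ K, ∀ w ∈ W, ρ k w ∈ W

/-- `W` is an irreducible `K`-submodule. -/
def IrrS (ρ : Representation ℂ Γ V) (K : Subgroup Γ) (W : Submodule ℂ V) : Prop :=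
  InvS ρ K W ∧ W ≠ ⊥ ∧ ∀ Wz ≤ W, InvS ρ K Wz → Wz = ⊥ ∨ Wz = W

/-- `f` is `K`-equivariant on `W`. -/
def HomOn (ρ : Representation ℂ Γ V) (ρ' : Representation ℂ Γ V') (K : Subgroup Γ)
    (W : Submodule ℂ V) (f : V →ₗ[ℂ] V') : Prop :=
  ∀ k ∈ K, ∀ w ∈ W, f (ρ k w) = ρ' k (f w)

/-- `W` and a second submodule are isomorphic `K`-modules. -/
def IsoS (ρ : Representation ℂ Γ V) (ρ' : Representation ℂ Γ V') (K : Subgroup Γ)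
    (W : Submodule ℂ V) (W' : Submodule ℂ V') : Prop :=
  ∃ f : V →ₗ[ℂ] V', HomOn ρ ρ' K W f ∧ W.map f = W' ∧ ∀ w ∈ W, f w = 0 → w = 0

variable {ρ : Representation ℂ Γ V} {ρ' : Representation ℂ Γ V'} {K : Subgroup Γ}
  {W : Submodule ℂ V}

lemma InvS.mono {K' : Subgroup Γ} (h : InvS ρ K W) (hK : K' ≤ K) : InvS ρ K' W :=
  fun k hk w hw => h k (hK hk) w hw

lemma InvS.inf {W' : Submodule ℂ V} (h : InvS ρ K W) (h' : InvS ρ K W') : InvS ρ K (W ⊓ W') :=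
  fun k hk w hw => ⟨h k hk w hw.1, h' k hk w hw.2⟩

lemma InvS.iSup {ι : Sort*} {X : ι → Submodule ℂ V} (h : ∀ j, InvS ρ K (X j)) :
    InvS ρ K (⨆ j, X j) := by
  intro k hk w hw
  have : (⨆ j, X j) ≤ (⨆ j, X j).comap (ρ k) := by
    refine iSup_le fun j => fun x hx => ?_
    exact (le_iSup X j) (h j k hk x hx)
  exact this hw

lemma InvS.bot : InvS ρ K ⊥ := by
  intro k _ w hw
  have : w = 0 := by simpa using hw
  simp [this]

lemma InvS.top : InvS ρ K ⊤ := fun _ _ _ _ => trivial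

lemma rho_inv_apply (g : Γ) (v : V) : ρ g⁻¹ (ρ g v) = v := by
  rw [← Module.End.mul_apply, ← map_mul]; simp

lemma rho_apply_inv (g : Γ) (v : V) : ρ g (ρ g⁻¹ v) = v := by
  rw [← Module.End.mul_apply, ← map_mul]; simp

lemma rho_mul_apply (g h : Γ) (v : V) : ρ (g * h) v = ρ g (ρ h v) := by
  rw [map_mul]; rfl

lemma rho_inj (g : Γ) : Function.Injective (ρ g) := fun a b h => by
  have := congrArg (ρ g⁻¹) h
  simpa [rho_inv_apply] using this

lemma map_rho_mul (g h : Γ) (W : Submodule ℂ V) :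
    W.map (ρ (g * h)) = (W.map (ρ h)).map (ρ g) := by
  rw [map_mul, ← Submodule.map_comp]; rfl

lemma map_rho_one (W : Submodule ℂ V) : W.map (ρ 1) = W := by
  rw [map_one]; exact Submodule.map_id W

lemma InvS.map_eq (h : InvS ρ K W) {k : Γ} (hk : k ∈ K) : W.map (ρ k) = W := by
  apply le_antisymm
  · rintro _ ⟨w, hw, rfl⟩; exact h k hk w hw
  · intro w hw
    exact ⟨ρ k⁻¹ w, h _ (inv_mem hk) w hw, rho_apply_inv k w⟩

lemma finrank_map_rho (g : Γ) (W : Submodule ℂ V) :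
    Module.finrank ℂ (W.map (ρ g)) = Module.finrank ℂ W :=
  LinearEquiv.finrank_eq (Submodule.equivMapOfInjective _ (rho_inj g) W).symm

/-- `g` normalizes `K`. -/
def Nrm (K : Subgroup Γ) (g : Γ) : Prop := ∀ k, k ∈ K ↔ g * k * g⁻¹ ∈ K

lemma Nrm.inv {g : Γ} (h : Nrm K g) : Nrm K g⁻¹ := fun k => by
  rw [h (g⁻¹ * k * g⁻¹⁻¹)]; simp [mul_assoc]

lemma Nrm.mem {g : Γ} (h : Nrm K g) {k : Γ} (hk : k ∈ K) : g⁻¹ * k * g ∈ K := by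
  have := (h.inv k).1 hk
  simpa using this

lemma Nrm.of_normal [hK : K.Normal] (g : Γ) : Nrm K g := fun k =>
  ⟨fun h => hK.conj_mem k h g, fun h => by
    have := hK.conj_mem _ h g⁻¹; simpa [mul_assoc] using this⟩

lemma InvS.conj (h : InvS ρ K W) {g : Γ} (hg : Nrm K g) : InvS ρ K (W.map (ρ g)) := by
  rintro k hk _ ⟨w, hw, rfl⟩
  refine ⟨ρ (g⁻¹ * k * g) w, h _ (hg.mem hk) w hw, ?_⟩
  · rw [← rho_mul_apply, ← rho_mul_apply]; congr 2; group

lemma IrrS.conj (h : IrrS ρ K W) {g : Γ} (hg : Nrm K g) : IrrS ρ K (W.map (ρ g)) := by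
  refine ⟨h.1.conj hg, ?_, ?_⟩
  · intro hb
    apply h.2.1
    rw [eq_bot_iff]
    intro w hw
    have : ρ g w ∈ W.map (ρ g) := ⟨w, hw, rfl⟩
    rw [hb] at this
    exact rho_inj g (by simpa using this)
  · intro W' hW' hI
    have h1 : W'.map (ρ g⁻¹) ≤ W := by
      rintro _ ⟨w, hw, rfl⟩
      obtain ⟨x, hx, rfl⟩ := hW' hw
      rwa [rho_inv_apply]
    have h2 : W' = (W'.map (ρ g⁻¹)).map (ρ g) := by
      rw [← map_rho_mul]; simp [Module.End.one_eq_id]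
    rcases h.2.2 _ h1 (hI.conj hg.inv) with h3 | h3
    · left; rw [h2, h3]; simp
    · right; rw [h2, h3]

/-- existence of irreducible submodules -/
lemma exists_IrrS [FiniteDimensional ℂ V] (h : InvS ρ K W) (h0 : W ≠ ⊥) :
    ∃ X ≤ W, IrrS ρ K X := by
  generalize hn : Module.finrank ℂ W = n
  induction n using Nat.strong_induction_on generalizing W with
  | _ n ih =>
    by_cases hI : ∀ W' ≤ W, InvS ρ K W' → W' = ⊥ ∨ W' = W
    · exact ⟨W, le_rfl, h, h0, hI⟩
    · push Not at hI
      obtain ⟨W', h1, h2, h3, h4⟩ := hI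
      obtain ⟨X, hX, hX'⟩ := ih _ (by
        rw [← hn]; exact Submodule.finrank_lt_finrank_of_lt (lt_of_le_of_ne h1 h4)) h2 h3 rfl
      exact ⟨X, hX.trans h1, hX'⟩

/-- Maschke: an equivariant projection. -/
lemma exists_proj [Finite Γ] (h : InvS ρ K W) :
    ∃ P : V →ₗ[ℂ] V, (∀ k ∈ K, ∀ v, P (ρ k v) = ρ k (P v)) ∧ (∀ v, P v ∈ W) ∧
      ∀ w ∈ W, P w = w := by
  classical
  have := Fintype.ofFinite K
  obtain ⟨W', hW'⟩ := Submodule.exists_isCompl W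
  let p0 : V →ₗ[ℂ] V := W.subtype ∘ₗ W.projectionOnto W' hW'
  have hp0 : ∀ v, p0 v ∈ W := fun v => (W.projectionOnto W' hW' v).2
  have hp1 : ∀ w ∈ W, p0 w = w := fun w hw => by
    have := Submodule.projectionOnto_apply_left hW' ⟨w, hw⟩
    simp [p0]
    simpa using congrArg Subtype.val this
  let c : ℂ := (Fintype.card K : ℂ)⁻¹
  have hc : (Fintype.card K : ℂ) ≠ 0 := by exact_mod_cast Fintype.card_ne_zero
  refine ⟨c • ∑ k : K, ρ k.1 ∘ₗ p0 ∘ₗ ρ k.1⁻¹, ?_, ?_, ?_⟩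
  · intro k hk v
    simp only [LinearMap.smul_apply, LinearMap.sum_apply, LinearMap.comp_apply, map_smul, map_sum]
    congr 1
    refine Fintype.sum_equiv (Equiv.mulLeft (⟨k, hk⟩ : K)⁻¹) _ _ fun x => ?_
    simp only [Equiv.coe_mulLeft, Subgroup.coe_mul, InvMemClass.coe_inv, ← rho_mul_apply]
    congr 1
    · congr 1; group
    · congr 3; group
  · intro v
    simp only [LinearMap.smul_apply, LinearMap.sum_apply, LinearMap.comp_apply]
    exact W.smul_mem _ (W.sum_mem fun k _ => h _ k.2 _ (hp0 _))
  · intro w hw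
    simp only [LinearMap.smul_apply, LinearMap.sum_apply, LinearMap.comp_apply]
    have : ∀ k : K, ρ k.1 (p0 (ρ k.1⁻¹ w)) = w := fun k => by
      rw [hp1 _ (h _ (inv_mem k.2) _ hw), rho_apply_inv]
    simp [this, c, ← Nat.cast_smul_eq_nsmul ℂ, smul_smul, inv_mul_cancel₀ hc]

lemma ker_inv {f : V →ₗ[ℂ] V'} (hW : InvS ρ K W) (hf : HomOn ρ ρ' K W f) :
    InvS ρ K (W ⊓ LinearMap.ker f) := by
  rintro k hk w ⟨hw, hw'⟩
  refine ⟨hW k hk w hw, ?_⟩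
  have h0 : f w = 0 := hw'
  show f (ρ k w) = 0
  rw [hf k hk w hw, h0, map_zero]

lemma map_invS {f : V →ₗ[ℂ] V'} (hW : InvS ρ K W) (hf : HomOn ρ ρ' K W f) :
    InvS ρ' K (W.map f) := by
  rintro k hk _ ⟨w, hw, rfl⟩
  exact ⟨ρ k w, hW k hk w hw, hf k hk w hw⟩

/-- Schur: a nonzero equivariant map on an irreducible is injective. -/
lemma IrrS.inj_of_ne (hW : IrrS ρ K W) {f : V →ₗ[ℂ] V'} (hf : HomOn ρ ρ' K W f)
    (h0 : ∃ w ∈ W, f w ≠ 0) : ∀ w ∈ W, f w = 0 → w = 0 := by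
  intro w hw hw0
  rcases hW.2.2 _ inf_le_left (ker_inv hW.1 hf) with h | h
  · have : w ∈ W ⊓ LinearMap.ker f := ⟨hw, hw0⟩
    rw [h] at this; simpa using this
  · obtain ⟨x, hx, hx0⟩ := h0
    rw [← h] at hx
    exact absurd hx.2 hx0

lemma IrrS.map (hW : IrrS ρ K W) {f : V →ₗ[ℂ] V'} (hf : HomOn ρ ρ' K W f)
    (hinj : ∀ w ∈ W, f w = 0 → w = 0) : IrrS ρ' K (W.map f) := by
  refine ⟨map_invS hW.1 hf, ?_, ?_⟩
  · intro hb
    apply hW.2.1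
    rw [eq_bot_iff]
    intro w hw
    have : f w ∈ W.map f := ⟨w, hw, rfl⟩
    rw [hb] at this
    simpa using hinj w hw (by simpa using this)
  · intro U hU hUi
    have h1 : InvS ρ K (W ⊓ U.comap f) := by
      rintro k hk w ⟨hw, hw'⟩
      refine ⟨hW.1 k hk w hw, ?_⟩
      show f _ ∈ U
      rw [hf k hk w hw]; exact hUi k hk _ hw'
    have h2 : U = (W ⊓ U.comap f).map f := by
      apply le_antisymm
      · intro u hu
        obtain ⟨w, hw, rfl⟩ := hU hu
        exact ⟨w, ⟨hw, hu⟩, rfl⟩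
      · rintro _ ⟨w, ⟨_, hw⟩, rfl⟩; exact hw
    rcases hW.2.2 _ inf_le_left h1 with h | h
    · left; rw [h2, h]; simp
    · right; rw [h2, h]

lemma IrrS.isoS_of_hom (hW : IrrS ρ K W) {f : V →ₗ[ℂ] V'} (hf : HomOn ρ ρ' K W f)
    (h0 : ∃ w ∈ W, f w ≠ 0) : IsoS ρ ρ' K W (W.map f) :=
  ⟨f, hf, rfl, hW.inj_of_ne hf h0⟩

lemma IsoS.finrank_eq {W' : Submodule ℂ V'} (h : IsoS ρ ρ' K W W') :
    Module.finrank ℂ W = Module.finrank ℂ W' := by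
  obtain ⟨f, _, rfl, hi⟩ := h
  have : Function.Injective (f.domRestrict W) := by
    rw [injective_iff_map_eq_zero]
    rintro ⟨w, hw⟩ hz
    simpa using hi w hw hz
  rw [← LinearMap.finrank_range_of_inj this, LinearMap.range_domRestrict]

lemma IsoS.irr {W' : Submodule ℂ V'} (h : IsoS ρ ρ' K W W') (hW : IrrS ρ K W) :
    IrrS ρ' K W' := by
  obtain ⟨f, h1, rfl, hi⟩ := h
  exact hW.map h1 hi

lemma IsoS.refl : IsoS ρ ρ K W W :=
  ⟨LinearMap.id, fun _ _ _ _ => rfl, Submodule.map_id W, fun _ _ h => h⟩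

lemma IsoS.mono {K' : Subgroup Γ} {W' : Submodule ℂ V'} (h : IsoS ρ ρ' K W W') (hK : K' ≤ K) :
    IsoS ρ ρ' K' W W' := by
  obtain ⟨f, h1, h2, hi⟩ := h
  exact ⟨f, fun k hk => h1 k (hK hk), h2, hi⟩

lemma IsoS.trans {V'' : Type} [AddCommGroup V''] [Module ℂ V''] {ρ'' : Representation ℂ Γ V''}
    {W' : Submodule ℂ V'} {W'' : Submodule ℂ V''}
    (h : IsoS ρ ρ' K W W') (h' : IsoS ρ' ρ'' K W' W'') : IsoS ρ ρ'' K W W'' := by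
  obtain ⟨f, h1, rfl, hi⟩ := h
  obtain ⟨g, h2, rfl, hj⟩ := h'
  refine ⟨g ∘ₗ f, ?_, Submodule.map_comp _ _ _, ?_⟩
  · intro k hk w hw
    simp only [LinearMap.comp_apply]
    rw [h1 k hk w hw, h2 k hk _ ⟨w, hw, rfl⟩]
  · intro w hw h0
    exact hi w hw (hj _ ⟨w, hw, rfl⟩ h0)

lemma IsoS.symm {W' : Submodule ℂ V'} (hW : InvS ρ K W) (h : IsoS ρ ρ' K W W') :
    IsoS ρ' ρ K W' W := by
  obtain ⟨f, h1, rfl, hi⟩ := h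
  have hinj : LinearMap.ker (f.domRestrict W) = ⊥ := by
    rw [LinearMap.ker_eq_bot, injective_iff_map_eq_zero]
    rintro ⟨w, hw⟩ hz
    simpa using hi w hw hz
  obtain ⟨g, hg⟩ := LinearMap.exists_leftInverse_of_injective _ hinj
  have hg' : ∀ w ∈ W, (W.subtype ∘ₗ g) (f w) = w := fun w hw => by
    have := LinearMap.congr_fun hg ⟨w, hw⟩
    simpa using congrArg Subtype.val this
  refine ⟨W.subtype ∘ₗ g, ?_, ?_, ?_⟩
  · rintro k hk _ ⟨w, hw, rfl⟩
    rw [hg' w hw, ← h1 k hk w hw, hg' _ (hW k hk w hw)]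
  · apply le_antisymm
    · rintro _ ⟨x, _, rfl⟩; exact (g x).2
    · intro w hw; exact ⟨f w, ⟨w, hw, rfl⟩, hg' w hw⟩
  · rintro _ ⟨w, hw, rfl⟩ h0
    rw [hg' w hw] at h0; simp [h0]

/-- conjugating isomorphisms -/
lemma IsoS.conj {W : Submodule ℂ V} {W' : Submodule ℂ V'} (h : IsoS ρ ρ' K W W') {g : Γ}
    (hg : Nrm K g) : IsoS ρ ρ' K (W.map (ρ g)) (W'.map (ρ' g)) := by
  obtain ⟨f, h1, rfl, hi⟩ := h
  refine ⟨ρ' g ∘ₗ f ∘ₗ ρ g⁻¹, ?_, ?_, ?_⟩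
  · rintro k hk _ ⟨w, hw, rfl⟩
    simp only [LinearMap.comp_apply]
    have e : ρ g⁻¹ (ρ k (ρ g w)) = ρ (g⁻¹ * k * g) w := by simp only [rho_mul_apply]
    rw [e, h1 _ (hg.mem hk) w hw, rho_inv_apply]
    simp only [← rho_mul_apply]; congr 2; group
  · ext v; constructor
    · rintro ⟨_, ⟨w, hw, rfl⟩, rfl⟩
      exact ⟨f w, ⟨w, hw, rfl⟩, by simp⟩
    · rintro ⟨_, ⟨w, hw, rfl⟩, rfl⟩
      exact ⟨ρ g w, ⟨w, hw, rfl⟩, by simp⟩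
  · rintro _ ⟨w, hw, rfl⟩ h0
    simp only [LinearMap.comp_apply, rho_inv_apply] at h0
    have := hi w hw (rho_inj g (by simpa using h0))
    simp [this]

/-- an irreducible submodule of a sum of irreducibles is isomorphic to one of them -/
lemma irr_le_iSup [Finite Γ] {ι : Sort*} {X : ι → Submodule ℂ V} (hX : ∀ j, IrrS ρ K (X j))
    (hW : IrrS ρ K W) (hle : W ≤ ⨆ j, X j) : ∃ j, IsoS ρ ρ K (X j) W := by
  obtain ⟨P, hP1, hP2, hP3⟩ := exists_proj hW.1
  by_contra hcon
  push Not at hcon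
  have key : ∀ j, X j ≤ LinearMap.ker P := by
    intro j x hx
    by_contra hx0
    have hh : HomOn ρ ρ K (X j) P := fun k hk w _ => hP1 k hk w
    have hiso := (hX j).isoS_of_hom hh ⟨x, hx, hx0⟩
    have hir := hiso.irr (hX j)
    have hle : (X j).map P ≤ W := by rintro _ ⟨w, _, rfl⟩; exact hP2 w
    rcases hW.2.2 _ hle hir.1 with h | h
    · exact hir.2.1 h
    · rw [h] at hiso; exact hcon j hiso
  apply hW.2.1
  rw [eq_bot_iff]
  intro w hw
  have h1 := (iSup_le key) (hle hw)
  rw [LinearMap.mem_ker, hP3 w hw] at h1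
  simpa using h1

/-- Maschke complement -/
lemma exists_compl [Finite Γ] {U : Submodule ℂ V} (hW : InvS ρ K W) (hU : InvS ρ K U)
    (hle : U ≤ W) : ∃ U', InvS ρ K U' ∧ U' ≤ W ∧ U ⊓ U' = ⊥ ∧ U ⊔ U' = W := by
  obtain ⟨P, hP1, hP2, hP3⟩ := exists_proj hU
  refine ⟨W ⊓ LinearMap.ker P, ker_inv hW (fun k hk w _ => hP1 k hk w), inf_le_left, ?_, ?_⟩
  · rw [eq_bot_iff]
    rintro w ⟨hw, _, hw'⟩
    have := hP3 w hw
    have h0 : P w = 0 := hw'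
    rw [h0] at this; simp [← this]
  · apply le_antisymm (sup_le hle inf_le_left)
    intro w hw
    rw [Submodule.mem_sup]
    refine ⟨P w, hP2 w, w - P w, ⟨W.sub_mem hw (hle (hP2 w)), ?_⟩, by abel⟩
    show P (w - P w) = 0
    rw [map_sub, hP3 _ (hP2 w), sub_self]

lemma dvd_finrank [Finite Γ] [FiniteDimensional ℂ V] (hW : InvS ρ K W) (m : ℕ)
    (h : ∀ X ≤ W, IrrS ρ K X → m ∣ Module.finrank ℂ X) : m ∣ Module.finrank ℂ W := by
  generalize hn : Module.finrank ℂ W = n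
  induction n using Nat.strong_induction_on generalizing W with
  | _ n ih =>
    by_cases h0 : W = ⊥
    · subst h0; simp at hn; simp [← hn]
    obtain ⟨X, hX, hXi⟩ := exists_IrrS hW h0
    obtain ⟨U, hU1, hU2, hU3, hU4⟩ := exists_compl hW hXi.1 hX
    have hd := Submodule.finrank_sup_add_finrank_inf_eq X U
    rw [hU3, hU4] at hd
    simp at hd
    have hpos : 0 < Module.finrank ℂ X := by
      rw [Module.finrank_pos_iff]; exact Submodule.nontrivial_iff_ne_bot.2 hXi.2.1
    rw [← hn, hd]
    exact dvd_add (h X hX hXi) (ih _ (by omega) hU1 (fun Y hY => h Y (hY.trans hU2)) rfl)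

/-- a linear map not vanishing on `W` does not vanish on some irreducible submodule -/
lemma exists_irr_ne [Finite Γ] [FiniteDimensional ℂ V] (hW : InvS ρ K W) (e : V →ₗ[ℂ] V')
    (he : ∃ w ∈ W, e w ≠ 0) : ∃ X ≤ W, IrrS ρ K X ∧ ∃ w ∈ X, e w ≠ 0 := by
  generalize hn : Module.finrank ℂ W = n
  induction n using Nat.strong_induction_on generalizing W with
  | _ n ih =>
    by_cases h0 : W = ⊥
    · subst h0
      obtain ⟨w, hw, hw0⟩ := he
      have : w = 0 := by simpa using hw
      simp [this] at hw0
    obtain ⟨X, hX, hXi⟩ := exists_IrrS hW h0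
    obtain ⟨U, hU1, hU2, hU3, hU4⟩ := exists_compl hW hXi.1 hX
    have hd := Submodule.finrank_sup_add_finrank_inf_eq X U
    rw [hU3, hU4] at hd
    simp at hd
    have hpos : 0 < Module.finrank ℂ X := by
      rw [Module.finrank_pos_iff]; exact Submodule.nontrivial_iff_ne_bot.2 hXi.2.1
    by_cases hXe : ∃ w ∈ X, e w ≠ 0
    · exact ⟨X, hX, hXi, hXe⟩
    · push Not at hXe
      obtain ⟨Y, hY, hY'⟩ := ih (Module.finrank ℂ U) (by omega) hU1 (by
        obtain ⟨w, hw, hw0⟩ := he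
        rw [← hU4, Submodule.mem_sup] at hw
        obtain ⟨x, hx, u, hu, rfl⟩ := hw
        refine ⟨u, hu, fun h => hw0 ?_⟩
        rw [map_add, hXe x hx, h, add_zero]) rfl
      exact ⟨Y, hY.trans hU2, hY'⟩

/-- Schur lemma, scalar version. -/
lemma IrrS.scalar [FiniteDimensional ℂ V] (hW : IrrS ρ K W) {f : V →ₗ[ℂ] V}
    (hf : HomOn ρ ρ K W f) (hfW : ∀ w ∈ W, f w ∈ W) : ∃ c : ℂ, ∀ w ∈ W, f w = c • w := by
  have : Nontrivial W := Submodule.nontrivial_iff_ne_bot.2 hW.2.1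
  obtain ⟨c, hc⟩ := Module.End.exists_eigenvalue (f.restrict hfW)
  obtain ⟨w, hw⟩ := hc.exists_hasEigenvector
  refine ⟨c, ?_⟩
  have h1 : HomOn ρ ρ K W (f - c • LinearMap.id) := by
    intro k hk w hw
    simp [hf k hk w hw]
  by_contra hcon
  push Not at hcon
  obtain ⟨x, hx, hx'⟩ := hcon
  have := hW.inj_of_ne h1 ⟨x, hx, by simpa [sub_eq_zero] using hx'⟩ w.1 w.2 (by
    have := congrArg Subtype.val hw.apply_eq_smul
    simp at this
    simp [this])
  exact hw.2 (Subtype.ext this)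

end RepBasics

section Clifford
variable {Γ : Type} [Group Γ] [Finite Γ] {V : Type} [AddCommGroup V] [Module ℂ V]
  [FiniteDimensional ℂ V]
  {ρ : Representation ℂ Γ V} {N K T : Subgroup Γ} {W X ψ : Submodule ℂ V}

lemma finrank_iSup_indep {ι : Type*} [Fintype ι] {Y : ι → Submodule ℂ V} (h : iSupIndep Y) :
    Module.finrank ℂ (⨆ c, Y c : Submodule ℂ V) = ∑ c, Module.finrank ℂ (Y c) := by
  classical
  have key : ∀ s : Finset ι, Module.finrank ℂ (⨆ c ∈ s, Y c : Submodule ℂ V) =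
      ∑ c ∈ s, Module.finrank ℂ (Y c) := by
    intro s
    induction s using Finset.induction_on with
    | empty => simp
    | insert a s ha ih =>
      rw [Finset.sum_insert ha, Finset.iSup_insert]
      have hd : Disjoint (Y a) (⨆ c ∈ s, Y c) := by
        refine (h a).mono_right (iSup₂_le fun c hc => ?_)
        exact le_iSup₂_of_le c (by rintro rfl; exact ha hc) le_rfl
      have := Submodule.finrank_sup_add_finrank_inf_eq (Y a) (⨆ c ∈ s, Y c)
      rw [hd.eq_bot] at this
      simp at this
      rw [this, ih]
  have e : (⨆ c ∈ (Finset.univ : Finset ι), Y c) = ⨆ c, Y c := by simp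
  rw [← e]; exact key _

/-- an irreducible is the sum of the translates of any nonzero submodule -/
lemma irr_eq_iSup (hψ : IrrS ρ K ψ) (hX : X ≤ ψ) (h0 : X ≠ ⊥) :
    ψ = ⨆ g : K, X.map (ρ g) := by
  have h1 : (⨆ g : K, X.map (ρ g)) ≤ ψ := by
    refine iSup_le fun g => ?_
    rintro _ ⟨x, hx, rfl⟩
    exact hψ.1 g g.2 x (hX hx)
  have hx1 : X ≤ ⨆ g : K, X.map (ρ g) := by
    refine le_trans ?_ (le_iSup _ (1 : K))
    simp [map_rho_one (ρ := ρ), Module.End.one_eq_id]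
  rcases hψ.2.2 _ h1 (by
    intro k hk w hw
    have : (⨆ g : K, X.map (ρ g)) ≤ (⨆ g : K, X.map (ρ g)).comap (ρ k) := by
      refine iSup_le fun j => ?_
      rintro _ ⟨x, hx, rfl⟩
      refine (le_iSup (fun g : K => X.map (ρ g)) (⟨k, hk⟩ * j)) ?_
      exact ⟨x, hx, by simp [rho_mul_apply]⟩
    exact this hw) with h | h
  · rw [h] at hx1; exact absurd (le_bot_iff.1 hx1) h0
  · exact h.symm

/-- any irreducible `N`-submodule of a `K`-irreducible is a conjugate of a given one. -/
lemma irr_sub_conj (hN : ∀ g ∈ K, Nrm N g) (hψ : IrrS ρ K ψ) (hW : IrrS ρ N W) (hle : W ≤ ψ)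
    {W' : Submodule ℂ V} (hW' : IrrS ρ N W') (hle' : W' ≤ ψ) :
    ∃ g ∈ K, IsoS ρ ρ N (W.map (ρ g)) W' := by
  have h := irr_eq_iSup hψ hle hW.2.1
  rw [h] at hle'
  obtain ⟨g, hg⟩ := irr_le_iSup (fun g : K => hW.conj (hN g g.2)) hW' hle'
  exact ⟨g, g.2, hg⟩

lemma clifford_dvd (hN : ∀ g ∈ K, Nrm N g) (hNK : N ≤ K) (hψ : IrrS ρ K ψ) (hW : IrrS ρ N W)
    (hle : W ≤ ψ) : Module.finrank ℂ W ∣ Module.finrank ℂ ψ := by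
  refine dvd_finrank (K := N) (hψ.1.mono hNK) _ fun X hX hXi => ?_
  obtain ⟨g, hg, hi⟩ := irr_sub_conj hN hψ hW hle hXi hX
  rw [← hi.finrank_eq, finrank_map_rho]

/-- Clifford theorem on degrees -/
theorem clifford (hN : ∀ g ∈ K, Nrm N g) (hTK : T ≤ K)
    (hψ : IrrS ρ K ψ) (hX : IrrS ρ T X) (hXψ : X ≤ ψ) (hW : IrrS ρ N W) (hWX : W ≤ X)
    (hT : ∀ g ∈ K, IsoS ρ ρ N W (W.map (ρ g)) ↔ g ∈ T) :
    Module.finrank ℂ ψ = T.relIndex K * Module.finrank ℂ X := by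
  classical
  let Y : K ⧸ T.subgroupOf K → Submodule ℂ V := fun c => X.map (ρ (c.out : K))
  have hout : ∀ g : K, X.map (ρ g) = Y (QuotientGroup.mk g) := by
    intro g
    obtain ⟨t, ht⟩ := QuotientGroup.mk_out_eq_mul (T.subgroupOf K) g
    simp only [Y]
    have htT : ((t : K) : Γ) ∈ T := t.2
    rw [ht, Subgroup.coe_mul, map_rho_mul, hX.1.map_eq htT]
  have hsup : ψ = ⨆ c, Y c := by
    rw [irr_eq_iSup hψ hXψ hX.2.1]
    apply le_antisymm
    · refine iSup_le fun g => ?_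
      rw [hout]; exact le_iSup Y _
    · refine iSup_le fun c => ?_
      exact le_iSup (fun g : K => X.map (ρ g)) _
  have hXs : X = ⨆ t : T, W.map (ρ t) := irr_eq_iSup hX hWX hW.2.1
  have hYs : ∀ c, Y c = ⨆ t : T, W.map (ρ ((c.out : K) * t)) := by
    intro c
    simp only [Y]
    conv_lhs => rw [hXs]
    rw [Submodule.map_iSup]
    simp only [map_rho_mul]
  have hirr : ∀ c (t : T), IrrS ρ N (W.map (ρ (((c : K ⧸ T.subgroupOf K).out : K) * t : Γ))) :=
    fun c t => hW.conj (hN _ (mul_mem c.out.2 (hTK t.2)))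
  have hInd : iSupIndep Y := by
    intro c
    rw [Submodule.disjoint_def']
    by_contra hcon
    have hne : Y c ⊓ (⨆ j, ⨆ (_ : j ≠ c), Y j) ≠ ⊥ := by
      intro hb
      apply hcon
      intro x hx y hy hxy
      have : x ∈ Y c ⊓ (⨆ j, ⨆ (_ : j ≠ c), Y j) := ⟨hx, hxy ▸ hy⟩
      rw [hb] at this; simpa using this
    have hYinv : ∀ c, InvS ρ N (Y c) := fun c => by
      rw [hYs]; exact InvS.iSup fun t => (hirr c t).1
    obtain ⟨U, hU, hUi⟩ := exists_IrrS ((hYinv c).inf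
      (InvS.iSup fun j => InvS.iSup fun _ => hYinv j)) hne
    have hU1 : U ≤ Y c := hU.trans inf_le_left
    have hU2 := hU.trans inf_le_right
    rw [hYs] at hU1
    obtain ⟨t, ht⟩ := irr_le_iSup (hirr c) hUi hU1
    have hU3 : U ≤ ⨆ j : {j // j ≠ c} × T, W.map (ρ ((j.1.1.out : K) * j.2)) := by
      refine hU2.trans (iSup_le fun j => iSup_le fun hj => ?_)
      rw [hYs]
      refine iSup_le fun s => ?_
      exact le_iSup (fun j : {j // j ≠ c} × T => W.map (ρ ((j.1.1.out : K) * j.2)))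
        (⟨⟨j, hj⟩, s⟩ : {j // j ≠ c} × T)
    obtain ⟨⟨⟨j, hj⟩, s⟩, hs⟩ := irr_le_iSup (fun j : {j // j ≠ c} × T => hirr j.1.1 j.2) hUi hU3
    simp only at hs
    set a : Γ := (c.out : K) * t with ha
    set b : Γ := (j.out : K) * s with hb
    have haK : a ∈ K := mul_mem c.out.2 (hTK t.2)
    have hbK : b ∈ K := mul_mem j.out.2 (hTK s.2)
    have e1 : IsoS ρ ρ N (W.map (ρ a)) (W.map (ρ b)) :=
      ht.trans (hs.symm (hW.1.conj (hN b hbK)))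
    have e2 := e1.conj (hN _ (inv_mem haK))
    rw [← map_rho_mul, ← map_rho_mul, inv_mul_cancel, map_rho_one] at e2
    have e3 := (hT _ (mul_mem (inv_mem haK) hbK)).1 e2
    apply hj
    rw [← Quotient.out_eq j, ← Quotient.out_eq c]
    refine (QuotientGroup.eq.2 ?_).symm
    rw [Subgroup.mem_subgroupOf]
    have : ((c.out : K)⁻¹ * (j.out : K) : K).1 = t * (a⁻¹ * b) * (s : Γ)⁻¹ := by
      simp [ha, hb, mul_assoc]
    rw [this]
    exact mul_mem (mul_mem t.2 e3) (inv_mem s.2)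
  have : Finite (K ⧸ T.subgroupOf K) := inferInstance
  have := Fintype.ofFinite (K ⧸ T.subgroupOf K)
  have hfr : Module.finrank ℂ (⨆ c, Y c : Submodule ℂ V) = ∑ c, Module.finrank ℂ (Y c) := by
    exact finrank_iSup_indep hInd
  have hYd : ∀ c, Module.finrank ℂ (Y c) = Module.finrank ℂ X := fun c => finrank_map_rho _ _
  rw [hsup, hfr, Finset.sum_congr rfl (fun c _ => hYd c), Finset.sum_const, smul_eq_mul,
    Finset.card_univ, Subgroup.relIndex, Subgroup.index, Nat.card_eq_fintype_card]

end Clifford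

section Cliff2
variable {Γ : Type} [Group Γ] [Finite Γ] {V : Type} [AddCommGroup V] [Module ℂ V]
  [FiniteDimensional ℂ V]
  {ρ : Representation ℂ Γ V} {N K T : Subgroup Γ} {W X ψ : Submodule ℂ V}

/-- inertia subgroup -/
def stabS (hN : ∀ g ∈ K, Nrm N g) (hW : InvS ρ N W) : Subgroup Γ where
  carrier := {g | g ∈ K ∧ IsoS ρ ρ N W (W.map (ρ g))}
  one_mem' := ⟨one_mem _, by rw [map_rho_one]; exact IsoS.refl⟩
  mul_mem' := by
    rintro a b ⟨ha, ha'⟩ ⟨hb, hb'⟩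
    refine ⟨mul_mem ha hb, ?_⟩
    rw [map_rho_mul]
    exact ha'.trans (hb'.conj (hN a ha))
  inv_mem' := by
    rintro a ⟨ha, ha'⟩
    refine ⟨inv_mem ha, ?_⟩
    have := ha'.conj (hN _ (inv_mem ha))
    rw [← map_rho_mul, inv_mul_cancel, map_rho_one] at this
    exact this.symm (hW.conj (hN _ (inv_mem ha)))

lemma InvS.of_gen {U : Submodule ℂ V} (hU : InvS ρ N U) {g : Γ} (hg : ∀ u ∈ U, ρ g u ∈ U)
    (hgen : ∀ k ∈ K, ∃ j : ℕ, ∃ n ∈ N, k = g ^ j * n) : InvS ρ K U := by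
  intro k hk u hu
  obtain ⟨j, n, hn, rfl⟩ := hgen k hk
  rw [rho_mul_apply]
  have h1 := hU n hn u hu
  clear hk
  generalize ρ n u = u' at *
  induction j with
  | zero => simpa using h1
  | succ j ih =>
    rw [pow_succ', rho_mul_apply]
    exact hg _ ih

/-- cyclic quotient: an invariant irreducible extends -/
theorem cyclic_ext {g : Γ} (hg : Nrm N g) (hgK : g ∈ K)
    (hgen : ∀ k ∈ K, ∃ j : ℕ, ∃ n ∈ N, k = g ^ j * n)
    (hX : IrrS ρ K X) (hW : IrrS ρ N W) (hWX : W ≤ X)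
    (hinv : IsoS ρ ρ N W (W.map (ρ g))) : Module.finrank ℂ X = Module.finrank ℂ W := by
  obtain ⟨α, hα1, hα2, hα3⟩ := hinv
  have hmem : ∀ w ∈ W, (ρ g⁻¹ ∘ₗ α) w ∈ W := by
    intro w hw
    have : α w ∈ W.map (ρ g) := hα2 ▸ ⟨w, hw, rfl⟩
    obtain ⟨x, hx, hx'⟩ := this
    simp only [LinearMap.comp_apply]
    rw [← hx', rho_inv_apply]; exact hx
  let A : W →ₗ[ℂ] W := (ρ g⁻¹ ∘ₗ α).restrict hmem
  have hA : ∀ w : W, ((A w : W) : V) = ρ g⁻¹ (α w) := fun w => rfl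
  have hAinj : Function.Injective A := by
    rw [injective_iff_map_eq_zero]
    intro w hw
    have h1 : ρ g⁻¹ (α w) = 0 := by rw [← hA, hw]; rfl
    have h2 : α w = 0 := rho_inj g⁻¹ (by rw [h1, map_zero])
    exact Subtype.ext (hα3 w w.2 h2)
  have hAsurj : Function.Surjective A := LinearMap.injective_iff_surjective.1 hAinj
  let E : Submodule ℂ (W →ₗ[ℂ] V) :=
    { carrier := {f | ∀ w : W, f w ∈ X ∧ ∀ n (hn : n ∈ N), f ⟨ρ n w, hW.1 n hn w w.2⟩ = ρ n (f w)}
      add_mem' := by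
        intro a b ha hb w
        refine ⟨X.add_mem (ha w).1 (hb w).1, fun n hn => ?_⟩
        simp [(ha w).2 n hn, (hb w).2 n hn]
      zero_mem' := by intro w; simp
      smul_mem' := by
        intro c a ha w
        refine ⟨X.smul_mem _ (ha w).1, fun n hn => ?_⟩
        simp [(ha w).2 n hn] }
  let Φ : (W →ₗ[ℂ] V) →ₗ[ℂ] (W →ₗ[ℂ] V) :=
    { toFun := fun f => ρ g ∘ₗ f ∘ₗ A
      map_add' := by intro a b; ext w; simp
      map_smul' := by intro a b; ext w; simp }
  have hΦE : ∀ f ∈ E, Φ f ∈ E := by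
    intro f hf w
    refine ⟨hX.1 g hgK _ (hf _).1, fun n hn => ?_⟩
    show ρ g (f (A _)) = ρ n (ρ g (f (A w)))
    have e : A ⟨ρ n w, hW.1 n hn w w.2⟩ =
        ⟨ρ (g⁻¹ * n * g) (A w), hW.1 _ (hg.mem hn) _ (A w).2⟩ := by
      apply Subtype.ext
      rw [hA]
      simp only [hA]
      rw [hα1 n hn w w.2]
      simp only [← rho_mul_apply]; congr 2; group
    rw [e, (hf (A w)).2 _ (hg.mem hn)]
    simp only [← rho_mul_apply]; congr 2; group
  have hsub : W.subtype ∈ E := by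
    intro w
    exact ⟨hWX w.2, fun n hn => rfl⟩
  have hWnt : Nontrivial W := Submodule.nontrivial_iff_ne_bot.2 hW.2.1
  have hEnt : Nontrivial E := by
    refine ⟨⟨⟨W.subtype, hsub⟩, 0, ?_⟩⟩
    intro h
    have h' : W.subtype = 0 := congrArg Subtype.val h
    obtain ⟨w, hw⟩ := exists_ne (0 : W)
    apply hw
    have := LinearMap.congr_fun h' w
    exact Subtype.ext (by simpa using this)
  obtain ⟨c, hc⟩ := Module.End.exists_eigenvalue (Φ.restrict hΦE)
  obtain ⟨⟨f, hfE⟩, hf⟩ := hc.exists_hasEigenvector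
  have hf1 : Φ f = c • f := congrArg Subtype.val hf.apply_eq_smul
  have hf0 : f ≠ 0 := fun h => hf.2 (Subtype.ext h)
  have hfX : LinearMap.range f ≤ X := by rintro _ ⟨w, rfl⟩; exact (hfE w).1
  have hUN : InvS ρ N (LinearMap.range f) := by
    rintro n hn _ ⟨w, rfl⟩
    exact ⟨_, (hfE w).2 n hn⟩
  have hUK : InvS ρ K (LinearMap.range f) := by
    refine hUN.of_gen (g := g) ?_ hgen
    rintro _ ⟨w, rfl⟩
    obtain ⟨x, rfl⟩ := hAsurj w
    have : ρ g (f (A x)) = c • f x := LinearMap.congr_fun hf1 x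
    rw [this]
    exact Submodule.smul_mem _ _ ⟨x, rfl⟩
  rcases hX.2.2 _ hfX hUK with h | h
  · exact absurd (LinearMap.range_eq_bot.1 h) hf0
  · apply le_antisymm
    · rw [← h]; exact LinearMap.finrank_range_le f
    · exact Submodule.finrank_mono hWX

/-- degree bound by index -/
lemma finrank_le_index {Y : Submodule ℂ V} (hX : IrrS ρ T X) (hY : InvS ρ K Y)
    (hYX : Y ≤ X) (h0 : Y ≠ ⊥) :
    Module.finrank ℂ X ≤ K.relIndex T * Module.finrank ℂ Y := by
  classical
  let Z : T ⧸ K.subgroupOf T → Submodule ℂ V := fun c => Y.map (ρ (c.out : T))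
  have hout : ∀ g : T, Y.map (ρ g) = Z (QuotientGroup.mk g) := by
    intro g
    obtain ⟨t, ht⟩ := QuotientGroup.mk_out_eq_mul (K.subgroupOf T) g
    simp only [Z]
    have htT : ((t : T) : Γ) ∈ K := t.2
    rw [ht, Subgroup.coe_mul, map_rho_mul, hY.map_eq htT]
  have := Fintype.ofFinite (T ⧸ K.subgroupOf T)
  have hsup : X ≤ ⨆ c ∈ (Finset.univ : Finset (T ⧸ K.subgroupOf T)), Z c := by
    rw [irr_eq_iSup hX hYX h0]
    refine iSup_le fun g => ?_
    rw [hout]; exact le_iSup₂_of_le _ (Finset.mem_univ _) le_rfl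
  have key : ∀ s : Finset (T ⧸ K.subgroupOf T),
      Module.finrank ℂ (⨆ c ∈ s, Z c : Submodule ℂ V) ≤ s.card * Module.finrank ℂ Y := by
    intro s
    induction s using Finset.induction_on with
    | empty => simp
    | insert a s ha ih =>
      rw [Finset.card_insert_of_notMem ha, Finset.iSup_insert]
      have := Submodule.finrank_add_le_finrank_add_finrank (Z a) (⨆ c ∈ s, Z c)
      have h2 : Module.finrank ℂ (Z a) = Module.finrank ℂ Y := finrank_map_rho _ _
      rw [h2] at this
      calc _ ≤ _ := this
        _ ≤ _ := by rw [add_mul, one_mul, add_comm]; exact Nat.add_le_add_right ih _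
  refine (Submodule.finrank_mono hsup).trans ((key _).trans ?_)
  rw [Finset.card_univ, Subgroup.relIndex, Subgroup.index, Nat.card_eq_fintype_card]

/-- Clifford with the inertia group -/
theorem clifford_stab (hN : ∀ g ∈ K, Nrm N g) (hψ : IrrS ρ K ψ) (hW : IrrS ρ N W)
    (hX : IrrS ρ (stabS hN hW.1) X) (hXψ : X ≤ ψ) (hWX : W ≤ X) :
    Module.finrank ℂ ψ = (stabS hN hW.1).relIndex K * Module.finrank ℂ X := by
  refine clifford hN (fun g hg => hg.1) hψ hX hXψ hW hWX fun g hg => ?_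
  exact ⟨fun h => ⟨hg, h⟩, fun h => h.2⟩

end Cliff2

section PGroup
variable {Γ : Type} [Group Γ] [Finite Γ] {V : Type} [AddCommGroup V] [Module ℂ V]
  [FiniteDimensional ℂ V]
  {ρ : Representation ℂ Γ V} {L : Type} [Group L] [Finite L] {π : Γ →* L}

lemma nrm_comap {A B : Subgroup L} (h : ∀ a ∈ A, Nrm B a) :
    ∀ g ∈ A.comap π, Nrm (B.comap π) g := by
  intro g hg k
  simp only [Subgroup.mem_comap, map_mul, map_inv]
  exact h _ hg _

theorem pgroup_ratio (hπ : Function.Surjective π) {ℓ : ℕ} [hℓ : Fact ℓ.Prime]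
    (A : Subgroup L) (hA : IsPGroup ℓ A) {X W : Submodule ℂ V}
    (hX : IrrS ρ (A.comap π) X) (hW : IrrS ρ π.ker W) (hWX : W ≤ X) :
    ∃ a, Module.finrank ℂ X = ℓ ^ a * Module.finrank ℂ W := by
  obtain ⟨n, hn⟩ := (IsPGroup.iff_card).1 hA
  induction n generalizing A X W with
  | zero =>
    have : A = ⊥ := by
      rw [pow_zero] at hn
      exact Subgroup.card_eq_one.1 hn
    subst this
    have hk : (⊥ : Subgroup L).comap π = π.ker := rfl
    rw [hk] at hX
    refine ⟨0, ?_⟩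
    rcases hX.2.2 W hWX hW.1 with h | h
    · exact absurd h hW.2.1
    · rw [h]; simp
  | succ n ih =>
    obtain ⟨R, hR⟩ := Sylow.exists_subgroup_card_pow_prime (G := A) ℓ (n := n)
      (by rw [hn]; exact pow_dvd_pow _ (Nat.le_succ n))
    have hRi : R.index = ℓ := by
      have := R.card_mul_index
      rw [hR, hn, pow_succ] at this
      exact Nat.eq_of_mul_eq_mul_left (pow_pos hℓ.out.pos n) this
    have hRn : R.Normal := by
      apply Subgroup.normal_of_index_eq_minFac_card
      rw [hRi, hn, Nat.Prime.pow_minFac hℓ.out (by omega)]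
    set A' : Subgroup L := R.map A.subtype with hA'
    have hle : A' ≤ A := Subgroup.map_subtype_le R
    have hrel : A'.relIndex A = ℓ := by
      rw [← hRi, hA', Subgroup.relIndex, Subgroup.subgroupOf, Subgroup.comap_map_eq_self_of_injective
        A.subtype_injective]
    have hcA' : Nat.card A' = ℓ ^ n := by
      rw [← hR]; exact Subgroup.card_map_of_injective A.subtype_injective
    have hnrm : ∀ a ∈ A, Nrm A' a := by
      have : ∀ a ∈ A, ∀ k ∈ A', a * k * a⁻¹ ∈ A' := by
        rintro a ha _ ⟨k, hk, rfl⟩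
        exact ⟨⟨a, ha⟩ * k * ⟨a, ha⟩⁻¹, hRn.conj_mem k hk _, rfl⟩
      intro a ha k
      refine ⟨this a ha k, fun h => ?_⟩
      have := this a⁻¹ (inv_mem ha) _ h
      simpa [mul_assoc] using this
    have hnrm' := nrm_comap (π := π) hnrm
    have hle' : A'.comap π ≤ A.comap π := Subgroup.comap_mono hle
    obtain ⟨Y, hYX, hY⟩ := exists_IrrS (hX.1.mono hle') hX.2.1
    obtain ⟨W', hWY, hW'⟩ := exists_IrrS (hY.1.mono (K' := π.ker)
      (Subgroup.comap_mono bot_le)) hY.2.1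
    obtain ⟨a, ha⟩ := ih A' (IsPGroup.of_card hcA') hY hW' hWY hcA'
    have hWW' : Module.finrank ℂ W' = Module.finrank ℂ W := by
      obtain ⟨g, _, hg⟩ := irr_sub_conj (N := π.ker) (fun g _ => Nrm.of_normal g) hX hW hWX hW'
        (hWY.trans hYX)
      rw [← hg.finrank_eq, finrank_map_rho]
    set S := stabS hnrm' hY.1 with hS
    have hSK : S ≤ A.comap π := fun g hg => hg.1
    have hYS : A'.comap π ≤ S := fun g hg => ⟨hle' hg, by rw [hY.1.map_eq hg]; exact IsoS.refl⟩
    have hrel' : (A'.comap π).relIndex (A.comap π) = ℓ := by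
      rw [Subgroup.relIndex_comap, Subgroup.map_comap_eq_self_of_surjective hπ, hrel]
    have hmul := Subgroup.relIndex_mul_relIndex _ _ _ hYS hSK
    rw [hrel'] at hmul
    by_cases hcase : S.relIndex (A.comap π) = 1
    · have hSA : A.comap π ≤ S := Subgroup.relIndex_eq_one.1 hcase
      -- pick an element outside
      have hne : ¬ A ≤ A' := fun h => by
        have := Subgroup.relIndex_eq_one.2 h
        rw [hrel] at this
        exact hℓ.out.one_lt.ne' this
      obtain ⟨x, hxA, hxA'⟩ := SetLike.not_le_iff_exists.1 hne
      obtain ⟨g, rfl⟩ := hπ x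
      refine ⟨a, ?_⟩
      rw [← hWW', ← ha]
      refine cyclic_ext (g := g) (hnrm' g hxA) hxA ?_ hX hY hYX (hSA hxA).2
      intro k hk
      -- quotient cyclic of prime order
      have hcard : Nat.card (A ⧸ R) = ℓ := by rw [← hRi]; rfl
      have hgne : (QuotientGroup.mk ⟨π g, hxA⟩ : A ⧸ R) ≠ 1 := by
        intro h
        rw [QuotientGroup.eq_one_iff] at h
        exact hxA' ⟨_, h, rfl⟩
      have := mem_powers_of_prime_card (p := ℓ) hcard hgne (g' := QuotientGroup.mk ⟨π k, hk⟩)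
      obtain ⟨j, hj⟩ := this
      have hj' : (QuotientGroup.mk (⟨π g, hxA⟩ ^ j) : A ⧸ R) = QuotientGroup.mk ⟨π k, hk⟩ := hj
      rw [QuotientGroup.eq] at hj'
      refine ⟨j, (g ^ j)⁻¹ * k, ?_, by group⟩
      refine ⟨_, hj', ?_⟩
      simp
    · have h1 : (A'.comap π).relIndex S = 1 ∧ S.relIndex (A.comap π) = ℓ := by
        have hd : S.relIndex (A.comap π) ∣ ℓ := ⟨_, by rw [← hmul, mul_comm]⟩
        rcases (Nat.dvd_prime hℓ.out).1 hd with h | h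
        · exact absurd h hcase
        · refine ⟨?_, h⟩
          rw [h] at hmul
          exact Nat.eq_of_mul_eq_mul_right hℓ.out.pos (by rw [hmul, one_mul])
      have hSeq : S = A'.comap π := le_antisymm (Subgroup.relIndex_eq_one.1 h1.1) hYS
      have hcl := clifford_stab (X := Y) hnrm' hX hY (by
        rw [← hS, hSeq]; exact hY) hYX le_rfl
      refine ⟨a + 1, ?_⟩
      rw [hcl, ← hS, h1.2, ha, hWW']; ring

end PGroup

section FD
variable {Γ : Type} [Group Γ] [Finite Γ]

lemma simple_iff_end (V : FDRep ℂ Γ) :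
    Simple V ↔ Module.finrank ℂ (Representation.IntertwiningMap V.ρ V.ρ) = 1 := by
  have := Fintype.ofFinite Γ
  have : Invertible (Nat.card Γ : ℂ) := invertibleOfNonzero (by
    exact_mod_cast Nat.card_pos.ne')
  have h1 := FDRep.scalar_product_char_eq_finrank_equivariant V V
  have h2 := Representation.card_inv_mul_sum_char_mul_char_eq_finrank V.ρ V.ρ
  have h3 : (Module.finrank ℂ (V ⟶ V) : ℂ) =
      Module.finrank ℂ (Representation.IntertwiningMap V.ρ V.ρ) := by
    rw [← h1, ← h2]; rfl
  rw [FDRep.simple_iff_end_is_rank_one]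
  have h4 : Module.finrank ℂ (V ⟶ V) =
      Module.finrank ℂ (Representation.IntertwiningMap V.ρ V.ρ) := by exact_mod_cast h3
  rw [h4]

lemma irr_of_simple (V : FDRep ℂ Γ) (h : Simple V) : IrrS (V := V) V.ρ ⊤ ⊤ := by
  rw [simple_iff_end] at h
  refine ⟨InvS.top, ?_, ?_⟩
  · intro hb
    have hz : ∀ f : Representation.IntertwiningMap V.ρ V.ρ, f = 0 := by
      intro f
      ext v
      have hv : v = 0 := by
        have : v ∈ (⊥ : Submodule ℂ V) := hb ▸ (trivial : v ∈ (⊤ : Submodule ℂ V))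
        simpa using this
      subst hv; simp
    have : Subsingleton (Representation.IntertwiningMap V.ρ V.ρ) :=
      ⟨fun a b => by rw [hz a, hz b]⟩
    rw [Module.finrank_zero_of_subsingleton] at h
    exact zero_ne_one h
  · intro W _ hW
    obtain ⟨P, hP1, hP2, hP3⟩ := exists_proj (V := V) hW
    let f : Representation.IntertwiningMap V.ρ V.ρ :=
      ⟨P, fun g => LinearMap.ext fun v => hP1 g trivial v⟩
    let one : Representation.IntertwiningMap V.ρ V.ρ := Representation.IntertwiningMap.id V.ρ
    by_cases hone : one = 0
    · left
      rw [eq_bot_iff]; intro w _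
      have h0 : one w = 0 := by rw [hone]; rfl
      have h1 : one w = w := rfl
      rw [h1] at h0
      simpa using h0
    obtain ⟨c, hc⟩ := (finrank_eq_one_iff_of_nonzero' one hone).1 h f
    have hP : ∀ v, P v = c • v := fun v => by
      have : f v = (c • one) v := by rw [hc]
      exact this
    by_cases hc0 : c = 0
    · left
      rw [eq_bot_iff]; intro w hw
      have := hP3 w hw
      rw [hP, hc0, zero_smul] at this
      simp [← this]
    · right
      rw [eq_top_iff]; intro v _
      have h1 := hP2 (c⁻¹ • v)
      rw [hP, smul_smul, mul_inv_cancel₀ hc0, one_smul] at h1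
      exact h1

lemma degree_of_irr {V : Type} [AddCommGroup V] [Module ℂ V] [FiniteDimensional ℂ V]
    {ρ : Representation ℂ Γ V} {X : Submodule ℂ V} (hX : IrrS ρ ⊤ X) :
    Module.finrank ℂ X ∈ charDegrees Γ := by
  let σ : Representation ℂ Γ X :=
    { toFun := fun g => (ρ g).restrict (hX.1 g trivial)
      map_one' := by ext x; simp
      map_mul' := by intro a b; ext x; simp }
  have hσ : ∀ g (x : X), ((σ g x : X) : V) = ρ g x := fun _ _ => rfl
  refine ⟨FDRep.of σ, ?_, rfl⟩
  rw [simple_iff_end]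
  have hirr : Representation.IsIrreducible σ := by
    have : Nontrivial (Subrepresentation σ) := by
      refine ⟨⊥, ⊤, fun h => hX.2.1 ?_⟩
      rw [eq_bot_iff]; intro x hx
      have h1 : (⟨x, hx⟩ : X) ∈ (⊤ : Subrepresentation σ).toSubmodule := trivial
      rw [← h] at h1
      have h2 : (⟨x, hx⟩ : X) = 0 := h1
      simpa using h2
    refine { eq_bot_or_eq_top := fun U => ?_ }
    have hU : InvS ρ ⊤ (U.toSubmodule.map X.subtype) := by
      rintro g _ _ ⟨u, hu, rfl⟩
      exact ⟨σ g u, U.apply_mem_toSubmodule g hu, rfl⟩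
    rcases hX.2.2 _ (Submodule.map_subtype_le _ _) hU with h | h
    · left
      have h3 : U.toSubmodule = ⊥ := by
        rw [eq_bot_iff]; intro u hu
        have : (u : V) ∈ U.toSubmodule.map X.subtype := ⟨u, hu, rfl⟩
        rw [h] at this
        simpa using this
      exact Subrepresentation.toSubmodule_injective h3
    · right
      have h3 : U.toSubmodule = ⊤ := by
        rw [eq_top_iff]; intro u _
        have : (u : V) ∈ U.toSubmodule.map X.subtype := by rw [h]; exact u.2
        obtain ⟨y, hy, hy'⟩ := this
        have : y = u := Subtype.ext hy'
        exact this ▸ hy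
      exact Subrepresentation.toSubmodule_injective h3
  exact Representation.IsIrreducible.finrank_intertwiningMap_self (ρ := σ)

/-- inner product nonzero gives an equivariant map -/
lemma exists_hom_of_inner {N : Subgroup Γ} (θ : FDRep ℂ N) (V : FDRep ℂ Γ)
    (h : (∑ᶠ x : N, V.character (x : Γ) * θ.character x⁻¹) ≠ 0) :
    ∃ f : θ →ₗ[ℂ] V, f ≠ 0 ∧ ∀ (n : N) v, f (θ.ρ n v) = V.ρ n (f v) := by
  have := Fintype.ofFinite N
  have : Invertible (Nat.card N : ℂ) := invertibleOfNonzero (by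
    exact_mod_cast Nat.card_pos.ne')
  rw [finsum_eq_sum_of_fintype] at h
  have h2 := Representation.card_inv_mul_sum_char_mul_char_eq_finrank θ.ρ
    (V.ρ.comp N.subtype : Representation ℂ N V)
  have h3 : Module.finrank ℂ (Representation.IntertwiningMap θ.ρ
      (V.ρ.comp N.subtype : Representation ℂ N V)) ≠ 0 := by
    intro h0
    rw [h0] at h2
    apply h
    have h4 : (Nat.card N : ℂ)⁻¹ ≠ 0 := inv_ne_zero (by exact_mod_cast Nat.card_pos.ne')
    have h5 := (mul_eq_zero.1 (by simpa using h2)).resolve_left h4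
    exact h5
  have : Nontrivial (Representation.IntertwiningMap θ.ρ
      (V.ρ.comp N.subtype : Representation ℂ N V)) := Module.nontrivial_of_finrank_pos (R := ℂ)
        (Nat.pos_of_ne_zero h3)
  obtain ⟨f, hf⟩ := exists_ne (0 : Representation.IntertwiningMap θ.ρ
      (V.ρ.comp N.subtype : Representation ℂ N V))
  refine ⟨f.toLinearMap, ?_, fun n v => ?_⟩
  · intro h0
    apply hf
    ext v
    have := LinearMap.congr_fun h0 v
    exact this
  · exact LinearMap.congr_fun (f.isIntertwining' n) v

end FD

section Gall

lemma invS_comp {G : Type} [Group G] {V : Type} [AddCommGroup V] [Module ℂ V]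
    {R : Representation ℂ G V} {M : Subgroup G} {ψ : Submodule ℂ V} :
    InvS (R.comp M.subtype : Representation ℂ M V) ⊤ ψ ↔ InvS R M ψ :=
  ⟨fun h k hk w hw => h ⟨k, hk⟩ trivial w hw, fun h k _ w hw => h k k.2 w hw⟩

lemma irrS_comp {G : Type} [Group G] {V : Type} [AddCommGroup V] [Module ℂ V]
    {R : Representation ℂ G V} {M : Subgroup G} {ψ : Submodule ℂ V} :
    IrrS (R.comp M.subtype : Representation ℂ M V) ⊤ ψ ↔ IrrS R M ψ := by
  unfold IrrS
  simp only [invS_comp]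

lemma IrrS.finrank_pos {Γ : Type} [Group Γ] {V : Type} [AddCommGroup V] [Module ℂ V]
    [FiniteDimensional ℂ V] {ρ : Representation ℂ Γ V} {K : Subgroup Γ} {W : Submodule ℂ V}
    (h : IrrS ρ K W) : 0 < Module.finrank ℂ W := by
  rw [Module.finrank_pos_iff]; exact Submodule.nontrivial_iff_ne_bot.2 h.2.1

variable {Γ : Type} [Group Γ] [Finite Γ] {L : Type} [Group L] [Finite L]
  {V : Type} [AddCommGroup V] [Module ℂ V] [FiniteDimensional ℂ V]

/-- left translation on functions, via `π` -/
noncomputable def leftReg (π : Γ →* L) : Representation ℂ Γ (L → ℂ) where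
  toFun g :=
    { toFun := fun b x => b (π g⁻¹ * x)
      map_add' := fun _ _ => rfl
      map_smul' := fun _ _ => rfl }
  map_one' := by ext; simp
  map_mul' := by intro a b; ext; simp [mul_assoc]

lemma leftReg_apply (π : Γ →* L) (g : Γ) (b : L → ℂ) (x : L) :
    leftReg π g b x = b (π g⁻¹ * x) := rfl

lemma leftReg_ker (π : Γ →* L) {g : Γ} (hg : g ∈ π.ker) (b : L → ℂ) :
    leftReg π g b = b := by
  funext x
  rw [leftReg_apply, map_inv, (MonoidHom.mem_ker).1 hg]; simp

/-- evaluation -/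
noncomputable def evL (b : L → ℂ) : ((L → ℂ) →ₗ[ℂ] V) →ₗ[ℂ] V where
  toFun f := f b
  map_add' _ _ := rfl
  map_smul' _ _ := rfl

lemma gall_step (π : Γ →* L) (hπ : Function.Surjective π) (ρ : Representation ℂ Γ V)
    {W : Submodule ℂ V} (hW : IrrS ρ π.ker W) (H : Subgroup L)
    (hWT : InvS ρ (H.comap π) W) {a b : L} (ha : a ∈ H) (hb : b ∈ H) (hab : a * b ≠ b * a) :
    ∃ U : Submodule ℂ ((L → ℂ) →ₗ[ℂ] V),
      IrrS (Representation.linHom (leftReg π) ρ) (H.comap π) U ∧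
      Module.finrank ℂ U ≠ Module.finrank ℂ W ∧
      ∀ W1 ≤ U, IrrS (Representation.linHom (leftReg π) ρ) π.ker W1 →
        IsoS (Representation.linHom (leftReg π) ρ) ρ π.ker W1 W := by
  classical
  set σ := Representation.linHom (leftReg π) ρ with hσ
  have hσa : ∀ g f b, σ g f b = ρ g (f (leftReg π g⁻¹ b)) := fun g f b => rfl
  obtain ⟨ta, rfl⟩ := hπ a
  obtain ⟨tb, rfl⟩ := hπ b
  let Z0 : Submodule ℂ ((L → ℂ) →ₗ[ℂ] V) :=
    { carrier := {f | ∀ b, f b ∈ W}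
      add_mem' := fun hf hg b => W.add_mem (hf b) (hg b)
      zero_mem' := fun b => W.zero_mem
      smul_mem' := fun c f hf b => W.smul_mem _ (hf b) }
  have hZ0 : InvS σ (H.comap π) Z0 := by
    intro g hg f hf b
    rw [hσa]
    exact hWT g hg _ (hf _)
  let D : ((L → ℂ) →ₗ[ℂ] V) →ₗ[ℂ] ((L → ℂ) →ₗ[ℂ] V) :=
    { toFun := fun f => f ∘ₗ leftReg π (ta * tb) - f ∘ₗ leftReg π (tb * ta)
      map_add' := by intro f g; ext; simp; abel
      map_smul' := by intro c f; ext; simp [smul_sub] }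
  have hD : ∀ f b, D f b = f (leftReg π (ta * tb) b) - f (leftReg π (tb * ta) b) :=
    fun f b => rfl
  obtain ⟨w0, hw0, hw0n⟩ := (Submodule.ne_bot_iff W).1 hW.2.1
  obtain ⟨U, hUZ, hU, u, hu, huD⟩ := exists_irr_ne hZ0 D (by
    refine ⟨LinearMap.smulRight (LinearMap.proj (1 : L)) w0, ?_, ?_⟩
    · intro b
      exact W.smul_mem _ hw0
    · intro h
      have h1 := LinearMap.congr_fun h (Pi.single ((π (ta * tb))⁻¹) (1 : ℂ))
      rw [hD] at h1
      simp only [LinearMap.smulRight_apply, LinearMap.proj_apply, leftReg_apply] at h1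
      rw [mul_one, mul_one, map_inv, map_inv, Pi.single_eq_same, Pi.single_eq_of_ne] at h1
      · simp at h1; exact hw0n h1
      · intro h2
        apply hab
        have := inv_injective h2
        simpa using this.symm)
  have hev : ∀ b (S : Submodule ℂ ((L → ℂ) →ₗ[ℂ] V)), HomOn σ ρ π.ker S (evL b) := by
    intro b S n hn f _
    show σ n f b = ρ n (f b)
    rw [hσa, leftReg_ker π (inv_mem hn)]
  have hiso : ∀ W1 ≤ U, IrrS σ π.ker W1 → IsoS σ ρ π.ker W1 W := by
    intro W1 hW1 hI
    obtain ⟨f, hf, hf0⟩ := (Submodule.ne_bot_iff W1).1 hI.2.1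
    have : ∃ b, f b ≠ 0 := by
      by_contra hcon
      push Not at hcon
      exact hf0 (LinearMap.ext hcon)
    obtain ⟨b, hb⟩ := this
    have h1 := hI.isoS_of_hom (hev b W1) ⟨f, hf, hb⟩
    have h2 := h1.irr hI
    have h3 : W1.map (evL b) ≤ W := by
      rintro _ ⟨f, hf, rfl⟩
      exact hUZ (hW1 hf) b
    rcases hW.2.2 _ h3 h2.1 with h | h
    · exact absurd h h2.2.1
    · rwa [h] at h1
  refine ⟨U, hU, ?_, hiso⟩
  intro hdim
  obtain ⟨W1, hW1, hI⟩ := exists_IrrS (hU.1.mono (K' := π.ker) (Subgroup.comap_mono bot_le)) hU.2.1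
  have hWU : W1 = U := by
    apply Submodule.eq_of_le_of_finrank_eq hW1
    rw [hdim]; exact (hiso W1 hW1 hI).finrank_eq
  subst hWU
  obtain ⟨g, hg1, hg2, hg3⟩ := (hiso W1 le_rfl hI).symm hI.1
  have hsc : ∀ b, ∃ c : ℂ, ∀ w ∈ W, (g w) b = c • w := by
    intro b
    refine hW.scalar (f := evL b ∘ₗ g) ?_ ?_
    · intro n hn w hw
      simp only [LinearMap.comp_apply]
      rw [hg1 n hn w hw, hev b W1 n hn]
      rw [← hg2]; exact ⟨w, hw, rfl⟩
    · intro w hw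
      exact hUZ (hg2 ▸ ⟨w, hw, rfl⟩ : g w ∈ W1) b
  choose μ hμ using hsc
  obtain ⟨w, hw, rfl⟩ : u ∈ W.map g := hg2 ▸ hu
  obtain ⟨b1, hb1⟩ : ∃ b, D (g w) b ≠ 0 := by
    by_contra hcon
    push Not at hcon
    exact huD (LinearMap.ext hcon)
  have hb0 : ∃ b, μ b ≠ 0 := by
    by_contra hcon
    push Not at hcon
    apply hb1
    rw [hD, hμ _ w hw, hμ _ w hw, hcon, hcon]; simp
  obtain ⟨b0, hb0⟩ := hb0
  have hw0' : w ≠ 0 := by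
    rintro rfl
    apply hb1; simp
  have hkap : ∀ t ∈ H.comap π, ∃ k : ℂ, ∀ b, μ (leftReg π t b) = k * μ b := by
    intro t ht
    have hmem : σ t⁻¹ (g w) ∈ W1 := hU.1 _ (inv_mem ht) _ hu
    rw [← hg2] at hmem
    obtain ⟨w', hw', he⟩ := hmem
    have h1 : ∀ b, μ b • w' = μ (leftReg π t b) • ρ t⁻¹ w := by
      intro b
      have := LinearMap.congr_fun he b
      rw [hσa, inv_inv, hμ b w' hw', hμ _ w hw, map_smul] at this
      exact this
    refine ⟨μ (leftReg π t b0) / μ b0, fun b => ?_⟩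
    have h2 : w' = (μ b0)⁻¹ • μ (leftReg π t b0) • ρ t⁻¹ w := by
      rw [← h1 b0, smul_smul, inv_mul_cancel₀ hb0, one_smul]
    have h3 := h1 b
    rw [h2, smul_smul, smul_smul, ← sub_eq_zero, ← sub_smul, smul_eq_zero] at h3
    rcases h3 with h3 | h3
    · rw [sub_eq_zero] at h3; rw [← h3]; field_simp
    · exfalso
      exact hw0' (rho_inj t⁻¹ (by rw [h3, map_zero]))
  obtain ⟨ka, hka⟩ := hkap ta ha
  obtain ⟨kb, hkb⟩ := hkap tb hb
  apply hb1
  rw [hD, hμ _ w hw, hμ _ w hw, rho_mul_apply, rho_mul_apply, hka, hkb, hkb, hka, ← sub_smul]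
  ring_nf
  simp

theorem gallagher {G : Type} [Group G] [Finite G] (M : Subgroup G) [M.Normal] (π : M →* L)
    (hπ : Function.Surjective π) (ρ : Representation ℂ M V)
    {W : Submodule ℂ V} (hW : IrrS ρ π.ker W) (H : Subgroup L)
    (hst : ∀ g : M, IsoS ρ ρ π.ker W (W.map (ρ g)) ↔ π g ∈ H)
    (hWT : InvS ρ (H.comap π) W) {a b : L} (ha : a ∈ H) (hb : b ∈ H) (hab : a * b ≠ b * a) :
    ∃ n ∈ charDegrees G, H.index * Module.finrank ℂ W ∣ n ∧
      n ≠ H.index * Module.finrank ℂ W := by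
  classical
  obtain ⟨U, hU, hUd, hUi⟩ := gall_step π hπ ρ hW H hWT ha hb hab
  set σ := Representation.linHom (leftReg π) ρ with hσ
  let Z := (L → ℂ) →ₗ[ℂ] V
  let R : Representation ℂ G (G → Z) :=
    { toFun := fun g =>
        { toFun := fun f x => f (x * g)
          map_add' := fun _ _ => rfl
          map_smul' := fun _ _ => rfl }
      map_one' := by
        apply LinearMap.ext; intro f; funext x; simp
      map_mul' := by
        intro a b
        apply LinearMap.ext; intro f; funext x
        simp [mul_assoc] }
  have hR : ∀ g f x, R g f x = f (x * g) := fun _ _ _ => rfl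
  let Ind : Submodule ℂ (G → Z) :=
    { carrier := {f | ∀ x, f x ∈ U ∧ ∀ t : M, π t ∈ H → f (t * x) = σ t (f x)}
      add_mem' := by
        intro f g hf hg x
        refine ⟨U.add_mem (hf x).1 (hg x).1, fun t ht => ?_⟩
        simp only [Pi.add_apply]
        rw [(hf x).2 t ht, (hg x).2 t ht, map_add]
      zero_mem' := by intro x; exact ⟨U.zero_mem, fun t _ => by simp⟩
      smul_mem' := by
        intro c f hf x
        refine ⟨U.smul_mem _ (hf x).1, fun t ht => ?_⟩
        simp only [Pi.smul_apply]
        rw [(hf x).2 t ht, map_smul] }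
  have hInd : InvS R ⊤ Ind := by
    intro g _ f hf x
    refine ⟨(hf (x * g)).1, fun t ht => ?_⟩
    rw [hR, hR, mul_assoc]
    exact (hf (x * g)).2 t ht
  have hInd0 : Ind ≠ ⊥ := by
    obtain ⟨u, hu, hu0⟩ := (Submodule.ne_bot_iff U).1 hU.2.1
    let f0 : G → Z := fun x => if h : x ∈ M then (if π ⟨x, h⟩ ∈ H then σ ⟨x, h⟩ u else 0) else 0
    have hf0 : f0 ∈ Ind := by
      intro x
      refine ⟨?_, fun t ht => ?_⟩
      · simp only [f0]
        split_ifs with h1 h2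
        · exact hU.1 _ h2 u hu
        · exact U.zero_mem
        · exact U.zero_mem
      · simp only [f0]
        by_cases h1 : x ∈ M
        · have h1' : (t : G) * x ∈ M := mul_mem t.2 h1
          have e : (⟨(t : G) * x, h1'⟩ : M) = t * ⟨x, h1⟩ := rfl
          rw [dif_pos h1', dif_pos h1, e, map_mul]
          by_cases h2 : π ⟨x, h1⟩ ∈ H
          · rw [if_pos h2, if_pos (mul_mem ht h2), rho_mul_apply]
          · rw [if_neg h2, if_neg, map_zero]
            rwa [Subgroup.mul_mem_cancel_left _ ht]
        · have h1' : ¬ (t : G) * x ∈ M := by rwa [Subgroup.mul_mem_cancel_left _ t.2]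
          rw [dif_neg h1', dif_neg h1, map_zero]
    intro hb
    rw [hb] at hf0
    have h1 : f0 1 = 0 := by
      have : f0 = 0 := by simpa using hf0
      rw [this]; rfl
    have h2 : f0 1 = u := by
      simp only [f0]
      rw [dif_pos (one_mem M)]
      have e : (⟨1, one_mem M⟩ : M) = 1 := rfl
      rw [e, if_pos (by rw [map_one]; exact one_mem H), map_one]; rfl
    exact hu0 (h2 ▸ h1)
  obtain ⟨Y, hYI, hY⟩ := exists_IrrS hInd hInd0
  let ev1 : (G → Z) →ₗ[ℂ] Z := LinearMap.proj 1
  have hev1 : ∃ f ∈ Y, ev1 f ≠ 0 := by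
    obtain ⟨f, hf, hf0⟩ := (Submodule.ne_bot_iff Y).1 hY.2.1
    obtain ⟨x, hx⟩ : ∃ x, f x ≠ 0 := by
      by_contra hcon
      push Not at hcon
      exact hf0 (funext hcon)
    refine ⟨R x f, hY.1 x trivial f hf, ?_⟩
    show R x f 1 ≠ 0
    rw [hR, one_mul]; exact hx
  let RM : Representation ℂ M (G → Z) := R.comp M.subtype
  have hRM : ∀ (g : M) f x, RM g f x = f (x * g) := fun _ _ _ => rfl
  obtain ⟨ψ, hψY, hψ, hψe⟩ := exists_irr_ne (ρ := RM) (K := ⊤)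
    (invS_comp.2 (hY.1.mono le_top)) ev1 hev1
  obtain ⟨X, hXψ, hX, hXe⟩ := exists_irr_ne (K := H.comap π) (hψ.1.mono le_top) ev1 hψe
  have hXI : X ≤ Ind := hXψ.trans (hψY.trans hYI)
  have hHom : HomOn RM σ (H.comap π) X ev1 := by
    intro t ht f hf
    show RM t f 1 = σ t (f 1)
    rw [hRM, one_mul, ← (hXI hf 1).2 t ht, mul_one]
  have hXU := hX.isoS_of_hom hHom hXe
  have hXU' : X.map ev1 = U := by
    rcases hU.2.2 (X.map ev1) (by rintro _ ⟨f, hf, rfl⟩; exact (hXI hf 1).1)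
      (hXU.irr hX).1 with h | h
    · exact absurd h (hXU.irr hX).2.1
    · exact h
  have hker : π.ker ≤ H.comap π := Subgroup.comap_mono bot_le
  obtain ⟨W2, hW2X, hW2⟩ := exists_IrrS (hX.1.mono hker) hX.2.1
  have hW2W : IsoS RM ρ π.ker W2 W := by
    have h1 : HomOn RM σ π.ker W2 ev1 := fun k hk w hw => hHom k (hker hk) w (hW2X hw)
    obtain ⟨w, hw, hw0⟩ := (Submodule.ne_bot_iff W2).1 hW2.2.1
    have h2 := hW2.isoS_of_hom h1 ⟨w, hw, fun h => hw0 (hX.inj_of_ne hHom hXe w (hW2X hw) h)⟩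
    exact h2.trans (hUi _ (by rw [← hXU']; exact Submodule.map_mono hW2X) (h2.irr hW2))
  have hn : ∀ g : M, Nrm π.ker g := fun g => Nrm.of_normal g
  have hcl := clifford (T := H.comap π) (fun g _ => hn g) le_top hψ hX hXψ hW2 hW2X (by
    intro g _
    rw [Subgroup.mem_comap, ← hst g]
    constructor
    · intro h
      have h1 := hW2W.conj (hn g)
      exact ((hW2W.symm hW2.1).trans h).trans h1
    · intro h
      have h1 := hW2W.conj (hn g)
      exact (hW2W.trans h).trans (h1.symm (hW2.1.conj (hn g))))
  have hψdvd : Module.finrank ℂ ψ ∣ Module.finrank ℂ Y :=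
    clifford_dvd (N := M) (fun g _ => Nrm.of_normal g) le_top hY (irrS_comp.1 hψ) hψY
  have hXdim : Module.finrank ℂ X = Module.finrank ℂ U := by rw [hXU.finrank_eq, hXU']
  have hWX : Module.finrank ℂ W ∣ Module.finrank ℂ X := by
    rw [← hW2W.finrank_eq]
    exact clifford_dvd (fun g _ => hn g) hker hX hW2 hW2X
  rw [Subgroup.relIndex_top_right, Subgroup.index_comap_of_surjective _ hπ] at hcl
  refine ⟨_, degree_of_irr hY, ?_, ?_⟩
  · exact (hcl ▸ Nat.mul_dvd_mul_left _ hWX).trans hψdvd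
  · intro heq
    have hWpos := hW.finrank_pos
    have hH : 0 < H.index := Nat.pos_of_ne_zero Subgroup.FiniteIndex.index_ne_zero
    have h1 : Module.finrank ℂ ψ ∣ H.index * Module.finrank ℂ W := heq ▸ hψdvd
    rw [hcl] at h1
    have h2 := Nat.dvd_of_mul_dvd_mul_left hH h1
    exact hUd (hXdim ▸ Nat.dvd_antisymm h2 hWX)

end Gall

section Burn
variable {Γ : Type} [Group Γ] [Finite Γ] {V : Type} [AddCommGroup V] [Module ℂ V]
  [FiniteDimensional ℂ V]
  {ρ : Representation ℂ Γ V} {N T : Subgroup Γ} {W X : Submodule ℂ V}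

/-- restricted representation on an invariant submodule -/
noncomputable def resS (hX : InvS ρ T X) : Representation ℂ T X where
  toFun g := (ρ g).restrict (hX g g.2)
  map_one' := by ext x; simp
  map_mul' := by intro a b; ext x; simp

lemma resS_apply (hX : InvS ρ T X) (g : T) (x : X) : ((resS hX g x : X) : V) = ρ g x := rfl

lemma resS_irr (hX : IrrS ρ T X) : Representation.IsIrreducible (resS hX.1) := by
  have : Nontrivial (Subrepresentation (resS hX.1)) := by
    refine ⟨⊥, ⊤, fun h => hX.2.1 ?_⟩
    rw [eq_bot_iff]; intro x hx
    have h1 : (⟨x, hx⟩ : X) ∈ (⊤ : Subrepresentation (resS hX.1)).toSubmodule := trivial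
    rw [← h] at h1
    have h2 : (⟨x, hx⟩ : X) = 0 := h1
    simpa using h2
  refine { eq_bot_or_eq_top := fun U => ?_ }
  have hU : InvS ρ T (U.toSubmodule.map X.subtype) := by
    rintro g hg _ ⟨u, hu, rfl⟩
    exact ⟨resS hX.1 ⟨g, hg⟩ u, U.apply_mem_toSubmodule ⟨g, hg⟩ hu, rfl⟩
  rcases hX.2.2 _ (Submodule.map_subtype_le _ _) hU with h | h
  · left
    have h3 : U.toSubmodule = ⊥ := by
      rw [eq_bot_iff]; intro u hu
      have : (u : V) ∈ U.toSubmodule.map X.subtype := ⟨u, hu, rfl⟩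
      rw [h] at this
      simpa using this
    exact Subrepresentation.toSubmodule_injective h3
  · right
    have h3 : U.toSubmodule = ⊤ := by
      rw [eq_top_iff]; intro u _
      have : (u : V) ∈ U.toSubmodule.map X.subtype := by rw [h]; exact u.2
      obtain ⟨y, hy, hy'⟩ := this
      have : y = u := Subtype.ext hy'
      exact this ▸ hy
    exact Subrepresentation.toSubmodule_injective h3

lemma span_rho {Γ : Type} [Group Γ] {V : Type} [AddCommGroup V] [Module ℂ V]
    [FiniteDimensional ℂ V] (σ : Representation ℂ Γ V) [Representation.IsIrreducible σ] :
    Submodule.span ℂ (Set.range σ) = ⊤ := by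
  classical
  rw [eq_top_iff]
  intro A _
  let R := MonoidAlgebra ℂ Γ
  have : FiniteDimensional ℂ σ.asModule := inferInstanceAs (FiniteDimensional ℂ V)
  have hsc := (IsSimpleModule.algebraMap_end_bijective_of_isAlgClosed (A := R)
    (V := σ.asModule) ℂ).2
  let A' : Module.End (Module.End R σ.asModule) σ.asModule :=
    { toFun := fun v => (A v : V)
      map_add' := fun a b => A.map_add a b
      map_smul' := by
        intro c v
        obtain ⟨c, rfl⟩ := hsc c
        exact A.map_smul c v }
  let b := Module.finBasis ℂ V
  obtain ⟨r, hr⟩ := jacobson_density (R := R) (M := σ.asModule) A'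
    (Finset.univ.image (fun i => (b i : V)))
  have hA : A = σ.asAlgebraHom r := by
    apply b.ext
    intro i
    exact hr (b i) (Finset.mem_image_of_mem _ (Finset.mem_univ i))
  rw [hA, Representation.asAlgebraHom_def, MonoidAlgebra.lift_apply]
  refine Submodule.sum_mem _ fun g _ => Submodule.smul_mem _ _ (Submodule.subset_span ⟨g, rfl⟩)

theorem irr_sq_le (hX : IrrS ρ T X) (hW : IrrS ρ N W)
    (hWX : W ≤ X) (hinv : ∀ g ∈ T, IsoS ρ ρ N W (W.map (ρ g))) :
    (Module.finrank ℂ X)^2 ≤ N.relIndex T * (Module.finrank ℂ W)^2 := by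
  classical
  have hirr := resS_irr hX
  set σ := resS hX.1 with hσ
  have hspan := span_rho σ
  let SN : Submodule ℂ (X →ₗ[ℂ] X) := Submodule.span ℂ (σ '' (N.subgroupOf T))
  -- every element of SN kills everything if it kills W
  let WX : Submodule ℂ X := W.comap X.subtype
  let res : (X →ₗ[ℂ] X) →ₗ[ℂ] (WX →ₗ[ℂ] X) :=
    { toFun := fun A => A ∘ₗ WX.subtype
      map_add' := fun _ _ => rfl
      map_smul' := fun _ _ => rfl }
  have hWXdim : Module.finrank ℂ WX = Module.finrank ℂ W :=
    LinearEquiv.finrank_eq (Submodule.comapSubtypeEquivOfLe hWX)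
  have hSNW : ∀ A ∈ SN, ∀ w ∈ WX, A w ∈ WX := by
    intro A hA w hw
    induction hA using Submodule.span_induction with
    | mem A h =>
      obtain ⟨n, hn, rfl⟩ := h
      exact hW.1 n hn _ hw
    | zero => exact WX.zero_mem
    | add a b _ _ ha hb => exact WX.add_mem ha hb
    | smul c a _ ha => exact WX.smul_mem c ha
  have hcomm : ∀ A ∈ SN, ∀ (g : V →ₗ[ℂ] V) (hg : HomOn ρ ρ N W g) (w w' : X), (w : V) ∈ W →
      (w' : V) = g w → ((A w' : X) : V) = g (A w : X) := by
    intro A hA g hg w w' hw hww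
    induction hA using Submodule.span_induction with
    | mem A h =>
      obtain ⟨n, hn, rfl⟩ := h
      rw [hσ, resS_apply, resS_apply, hww, hg n hn w hw]
    | zero => simp
    | add a b _ _ ha hb => simp [ha, hb]
    | smul c a _ ha => simp [ha]
  have hinj : ∀ A ∈ SN, res A = 0 → A = 0 := by
    intro A hA h0
    have hz : ∀ w : X, (w : V) ∈ W → A w = 0 := fun w hw =>
      LinearMap.congr_fun h0 ⟨w, hw⟩
    have hle : X ≤ (LinearMap.ker A).map X.subtype := by
      conv_lhs => rw [irr_eq_iSup hX hWX hW.2.1]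
      refine iSup_le fun t => ?_
      obtain ⟨g, hg1, hg2, hg3⟩ := hinv t t.2
      rw [← hg2]
      rintro _ ⟨w, hw, rfl⟩
      have hgw : g w ∈ X := by
        have : g w ∈ W.map (ρ t) := hg2 ▸ ⟨w, hw, rfl⟩
        obtain ⟨w1, hw1, h1⟩ := this
        rw [← h1]; exact hX.1 t t.2 _ (hWX hw1)
      refine ⟨⟨g w, hgw⟩, ?_, rfl⟩
      have := hcomm A hA g hg1 ⟨w, hWX hw⟩ ⟨g w, hgw⟩ hw rfl
      rw [hz ⟨w, hWX hw⟩ hw] at this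
      simp only [ZeroMemClass.coe_zero, map_zero] at this
      exact Subtype.ext this
    ext x
    obtain ⟨y, hy, hyx⟩ := hle x.2
    have : y = x := Subtype.ext hyx
    rw [← this, hy]; simp
  have hSNdim : Module.finrank ℂ SN ≤ (Module.finrank ℂ W)^2 := by
    let Φ : SN →ₗ[ℂ] (WX →ₗ[ℂ] WX) :=
      { toFun := fun A => A.1.restrict (hSNW A.1 A.2)
        map_add' := fun _ _ => rfl
        map_smul' := fun _ _ => rfl }
    have hΦ : Function.Injective Φ := by
      rw [injective_iff_map_eq_zero]
      intro A hA
      apply Subtype.ext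
      apply hinj A.1 A.2
      ext w
      have := LinearMap.congr_fun hA w
      have h2 : ((Φ A w : WX) : X) = 0 := by rw [this]; rfl
      exact congrArg Subtype.val h2
    have := LinearMap.finrank_le_finrank_of_injective hΦ
    rw [Module.finrank_linearMap, hWXdim] at this
    rw [pow_two]; exact this
  let Z : T ⧸ N.subgroupOf T → Submodule ℂ (X →ₗ[ℂ] X) :=
    fun c => SN.map (LinearMap.mulLeft ℂ (σ c.out))
  have := Fintype.ofFinite (T ⧸ N.subgroupOf T)
  have hZ : ∀ t : T, σ t ∈ Z (QuotientGroup.mk t) := by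
    intro t
    obtain ⟨n, hn⟩ := QuotientGroup.mk_out_eq_mul (N.subgroupOf T) t
    refine ⟨σ (n : T)⁻¹, Submodule.subset_span ⟨_, inv_mem n.2, rfl⟩, ?_⟩
    rw [LinearMap.mulLeft_apply, hn, ← map_mul]
    congr 1; group
  have hsup : (⊤ : Submodule ℂ (X →ₗ[ℂ] X)) ≤
      ⨆ c ∈ (Finset.univ : Finset (T ⧸ N.subgroupOf T)), Z c := by
    rw [← hspan, Submodule.span_le]
    rintro _ ⟨t, rfl⟩
    have h1 : Z (QuotientGroup.mk t) ≤ ⨆ c ∈ (Finset.univ : Finset (T ⧸ N.subgroupOf T)), Z c :=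
      le_iSup₂_of_le _ (Finset.mem_univ _) le_rfl
    exact h1 (hZ t)
  have key : ∀ s : Finset (T ⧸ N.subgroupOf T),
      Module.finrank ℂ (⨆ c ∈ s, Z c : Submodule ℂ (X →ₗ[ℂ] X)) ≤
        s.card * Module.finrank ℂ SN := by
    intro s
    induction s using Finset.induction_on with
    | empty => simp
    | insert a s ha ih =>
      rw [Finset.card_insert_of_notMem ha, Finset.iSup_insert]
      have := Submodule.finrank_add_le_finrank_add_finrank (Z a) (⨆ c ∈ s, Z c)
      have h2 : Module.finrank ℂ (Z a) ≤ Module.finrank ℂ SN := Submodule.finrank_map_le _ _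
      rw [add_mul, one_mul]
      omega
  have h1 := (Submodule.finrank_mono hsup).trans (key _)
  rw [finrank_top, Module.finrank_linearMap, Finset.card_univ, ← Nat.card_eq_fintype_card] at h1
  rw [pow_two]
  exact h1.trans (Nat.mul_le_mul_left _ hSNdim)

end Burn

section More
variable {Γ : Type} [Group Γ] [Finite Γ] {V : Type} [AddCommGroup V] [Module ℂ V]
  [FiniteDimensional ℂ V]
  {ρ : Representation ℂ Γ V} {N K : Subgroup Γ} {W ψ : Submodule ℂ V}

/-- two homs from an irreducible to the same image are proportional -/
lemma IrrS.scalar2 (hW : IrrS ρ N W) {f f2 : V →ₗ[ℂ] V} (hf : HomOn ρ ρ N W f)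
    (hf2 : HomOn ρ ρ N W f2) (hfi : ∀ w ∈ W, f w = 0 → w = 0)
    (h2 : ∀ w ∈ W, f2 w ∈ W.map f) : ∃ c : ℂ, ∀ w ∈ W, f2 w = c • f w := by
  have hI : IsoS ρ ρ N W (W.map f) := ⟨f, hf, rfl, hfi⟩
  obtain ⟨g, hg1, hg2, hg3⟩ := hI.symm hW.1
  have hmem : ∀ w ∈ W, f w ∈ W.map f := fun w hw => ⟨w, hw, rfl⟩
  have hgm : ∀ v ∈ W.map f, g v ∈ W := fun v hv => hg2 ▸ ⟨v, hv, rfl⟩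
  obtain ⟨c1, hc1⟩ := hW.scalar (f := g ∘ₗ f) (by
    intro k hk w hw
    simp only [LinearMap.comp_apply]
    rw [hf k hk w hw, hg1 k hk _ (hmem w hw)]) (fun w hw => hgm _ (hmem w hw))
  obtain ⟨c2, hc2⟩ := hW.scalar (f := g ∘ₗ f2) (by
    intro k hk w hw
    simp only [LinearMap.comp_apply]
    rw [hf2 k hk w hw, hg1 k hk _ (h2 w hw)]) (fun w hw => hgm _ (h2 w hw))
  simp only [LinearMap.comp_apply] at hc1 hc2
  obtain ⟨w0, hw0, hw0n⟩ := (Submodule.ne_bot_iff W).1 hW.2.1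
  have hc10 : c1 ≠ 0 := by
    rintro rfl
    have := hc1 w0 hw0
    rw [zero_smul] at this
    exact hw0n (hfi _ hw0 (hg3 _ (hmem _ hw0) this))
  refine ⟨c2 / c1, fun w hw => ?_⟩
  have : g (f2 w - (c2 / c1) • f w) = 0 := by
    rw [map_sub, map_smul, hc1 w hw, hc2 w hw, smul_smul, div_mul_cancel₀ _ hc10, sub_self]
  exact sub_eq_zero.1 (hg3 _ (Submodule.sub_mem _ (h2 w hw) (Submodule.smul_mem _ _ (hmem w hw))) this)

lemma ratio_char (hN : ∀ g ∈ K, Nrm N g) (hNK : N ≤ K) (hW : IrrS ρ N W) (hWK : InvS ρ K W)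
    {f : V →ₗ[ℂ] V} (hf : HomOn ρ ρ N W f) (hfi : ∀ w ∈ W, f w = 0 → w = 0)
    (hfK : InvS ρ K (W.map f)) :
    ∃ lam : Γ → ℂ, (∀ u ∈ K, ∀ w ∈ W, f (ρ u w) = lam u • ρ u (f w)) ∧
      (∀ u ∈ K, ∀ v ∈ K, lam (u * v) = lam u * lam v) ∧ ∀ n ∈ N, lam n = 1 := by
  obtain ⟨w0, hw0, hw0n⟩ := (Submodule.ne_bot_iff W).1 hW.2.1
  have h : ∀ u : Γ, ∃ c : ℂ, u ∈ K → ∀ w ∈ W, f (ρ u w) = c • ρ u (f w) := by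
    intro u
    by_cases hu : u ∈ K
    · obtain ⟨c, hc⟩ := hW.scalar2 (f := f) (f2 := ρ u⁻¹ ∘ₗ f ∘ₗ ρ u) hf (by
        intro k hk w hw
        simp only [LinearMap.comp_apply]
        rw [← rho_mul_apply, show u * k = (u * k * u⁻¹) * u by group, rho_mul_apply,
          hf _ ((hN u hu k).1 hk) _ (hWK u hu w hw), ← rho_mul_apply, ← rho_mul_apply]
        congr 2; group) hfi (by
        intro w hw
        exact hfK _ (inv_mem hu) _ ⟨_, hWK u hu w hw, rfl⟩)
      refine ⟨c, fun _ w hw => ?_⟩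
      have := hc w hw
      simp only [LinearMap.comp_apply] at this
      rw [← map_smul, ← this, rho_apply_inv]
    · exact ⟨0, fun h => absurd h hu⟩
  choose lam hlam using h
  have huniq : ∀ u ∈ K, ∀ c : ℂ, (∀ w ∈ W, f (ρ u w) = c • ρ u (f w)) → lam u = c := by
    intro u hu c hc
    have h1 := hlam u hu w0 hw0
    rw [hc w0 hw0, ← sub_eq_zero, ← sub_smul, smul_eq_zero, sub_eq_zero] at h1
    rcases h1 with h1 | h1
    · exact h1.symm
    · exact absurd (hfi w0 hw0 (rho_inj u (by rw [h1, map_zero]))) hw0n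
  refine ⟨lam, hlam, ?_, ?_⟩
  · intro u hu v hv
    apply huniq _ (mul_mem hu hv)
    intro w hw
    rw [rho_mul_apply, hlam u hu _ (hWK v hv w hw), hlam v hv w hw, map_smul, smul_smul,
      rho_mul_apply]
  · intro n hn
    apply huniq _ (hNK hn)
    intro w hw
    rw [one_smul]; exact hf n hn w hw

lemma exists_irr_over (hN : ∀ g ∈ K, Nrm N g) (hNK : N ≤ K) (hψ : InvS ρ K ψ) (hW : IrrS ρ N W)
    (hle : W ≤ ψ) : ∃ X ≤ ψ, IrrS ρ K X ∧ ∃ W' ≤ X, IrrS ρ N W' ∧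
      ∃ g ∈ K, IsoS ρ ρ N (W.map (ρ g)) W' := by
  let Z : Submodule ℂ V := ⨆ g : K, W.map (ρ g)
  have hWZ : W ≤ Z := by
    refine le_trans ?_ (le_iSup (fun g : K => W.map (ρ g)) 1)
    rw [Subgroup.coe_one, map_rho_one]
  have hZψ : Z ≤ ψ := by
    refine iSup_le fun g => ?_
    rintro _ ⟨w, hw, rfl⟩
    exact hψ g g.2 w (hle hw)
  have hZ : InvS ρ K Z := by
    intro k hk
    have : Z ≤ Z.comap (ρ k) := by
      refine iSup_le fun g => ?_
      rintro _ ⟨w, hw, rfl⟩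
      show ρ k (ρ g w) ∈ Z
      rw [← rho_mul_apply]
      exact (le_iSup (fun g : K => W.map (ρ g)) (⟨k, hk⟩ * g)) ⟨w, hw, rfl⟩
    exact this
  have hZ0 : Z ≠ ⊥ := fun h => hW.2.1 (le_bot_iff.1 (h ▸ hWZ))
  obtain ⟨X, hXZ, hX⟩ := exists_IrrS hZ hZ0
  obtain ⟨W', hW'X, hW'⟩ := exists_IrrS (hX.1.mono hNK) hX.2.1
  obtain ⟨g, hg⟩ := irr_le_iSup (fun g : K => hW.conj (hN g g.2)) hW' (hW'X.trans hXZ)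
  exact ⟨X, hXZ.trans hZψ, hX, W', hW'X, hW', g, g.2, hg⟩

lemma iso_stab_transport {W' : Submodule ℂ V} (h : IsoS ρ ρ N W W') (hWi : InvS ρ N W)
    {g : Γ} (hg : Nrm N g) :
    IsoS ρ ρ N W (W.map (ρ g)) ↔ IsoS ρ ρ N W' (W'.map (ρ g)) :=
  ⟨fun h1 => ((h.symm hWi).trans h1).trans (h.conj hg),
   fun h1 => (h.trans h1).trans ((h.conj hg).symm (hWi.conj hg))⟩

theorem exists_stab_irr (hN : ∀ g ∈ K, Nrm N g) (hNK : N ≤ K) (hψ : IrrS ρ K ψ) (hW : IrrS ρ N W)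
    (hle : W ≤ ψ) : ∃ X ≤ ψ, IrrS ρ (stabS hN hW.1) X ∧
      Module.finrank ℂ ψ = (stabS hN hW.1).relIndex K * Module.finrank ℂ X ∧
      ∃ W' ≤ X, IrrS ρ N W' ∧ IsoS ρ ρ N W W' := by
  set S := stabS hN hW.1 with hS
  have hSK : S ≤ K := fun g hg => hg.1
  have hNS : N ≤ S := fun g hg => ⟨hNK hg, by rw [hW.1.map_eq hg]; exact IsoS.refl⟩
  obtain ⟨X, hXψ, hX, W', hW'X, hW', g, hg, hiso⟩ :=
    exists_irr_over (fun g hg => hN g (hSK hg)) hNS (hψ.1.mono hSK) hW hle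
  have hi : IsoS ρ ρ N W W' := hg.2.trans hiso
  refine ⟨X, hXψ, hX, ?_, W', hW'X, hW', hi⟩
  refine clifford hN hSK hψ hX hXψ hW' hW'X fun g hg => ?_
  rw [← iso_stab_transport hi hW.1 (hN g hg)]
  exact ⟨fun h => ⟨hg, h⟩, fun h => h.2⟩

end More

section Blem
variable {Γ : Type} [Group Γ] [Finite Γ] {V : Type} [AddCommGroup V] [Module ℂ V]
  [FiniteDimensional ℂ V]
  {ρ : Representation ℂ Γ V} {L : Type} [Group L] [Finite L] {π : Γ →* L}

theorem blem (hπ : Function.Surjective π) {p : ℕ} (hp : Odd p) {P H : Subgroup L} (hPH : P ≤ H)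
    (hPn : ∀ h ∈ H, Nrm P h) (hexp : ∀ u ∈ P, u ^ p = 1)
    (hcomm : ∀ a ∈ H, ∀ b ∈ H, a * b * a⁻¹ * b⁻¹ ∈ P)
    {g : L} (hgH : g ∈ H) (hgen : ∀ h ∈ H, ∃ j : ℕ, ∃ u ∈ P, h = g ^ j * u)
    {z : L} (hzH : z ∈ H) (hz : z * z = 1) (hinv : ∀ u ∈ P, z * u * z⁻¹ = u⁻¹)
    {X W : Submodule ℂ V} (hX : IrrS ρ (H.comap π) X) (hWX : W ≤ X) (hW : IrrS ρ π.ker W)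
    (hWP : InvS ρ (P.comap π) W)
    (hst : ∀ t, π t ∈ H → IsoS ρ ρ π.ker W (W.map (ρ t)))
    {d : ℕ} (hd : Odd d) (hdim : Module.finrank ℂ X = d * Module.finrank ℂ W) :
    Module.finrank ℂ X = Module.finrank ℂ W := by
  have hker : π.ker ≤ P.comap π := Subgroup.comap_mono bot_le
  have hPT : P.comap π ≤ H.comap π := Subgroup.comap_mono hPH
  have hNn : ∀ t : Γ, Nrm π.ker t := fun t => Nrm.of_normal t
  have hTn := nrm_comap (π := π) hPn
  have hWPi : IrrS ρ (P.comap π) W :=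
    ⟨hWP, hW.2.1, fun U hU hUi => hW.2.2 U hU (hUi.mono hker)⟩
  obtain ⟨X', hX'X, hX', hXdim, W', hW'X', hW', hWW'⟩ := exists_stab_irr hTn hPT hX hWPi hWX
  set S := stabS hTn hWPi.1 with hS
  have hPS : P.comap π ≤ S := fun g hg => ⟨hPT hg, by rw [hWP.map_eq hg]; exact IsoS.refl⟩
  have hST : S ≤ H.comap π := fun g hg => hg.1
  have hWpos := hW.finrank_pos
  have hSodd : Odd (S.relIndex (H.comap π)) := by
    obtain ⟨k, hk⟩ := clifford_dvd (fun g hg => hTn g (hST hg)) hPS hX' hW' hW'X'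
    rw [← hWW'.finrank_eq] at hk
    rw [hXdim, hk] at hdim
    have : S.relIndex (H.comap π) * k = d := by
      apply Nat.eq_of_mul_eq_mul_right hWpos
      rw [← hdim]; ring
    exact (Nat.odd_mul.1 (this ▸ hd)).1
  have hSn : ∀ t ∈ H.comap π, ∀ s ∈ S, t * s * t⁻¹ ∈ S := by
    intro t ht s hs
    have h1 : t * s * t⁻¹ * s⁻¹ ∈ S := by
      apply hPS
      show π _ ∈ P
      simpa using hcomm (π t) ht (π s) (hST hs)
    have := mul_mem h1 hs
    simpa using this
  obtain ⟨zt, rfl⟩ := hπ z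
  obtain ⟨gt, rfl⟩ := hπ g
  have hzS : zt ∈ S := by
    have hn : (S.subgroupOf (H.comap π)).Normal := by
      refine ⟨fun s hs t => ?_⟩
      exact hSn t t.2 s hs
    let zq : (H.comap π) ⧸ (S.subgroupOf (H.comap π)) := QuotientGroup.mk ⟨zt, hzH⟩
    have h2 : zq ^ 2 = 1 := by
      rw [← QuotientGroup.mk_pow, QuotientGroup.eq_one_iff]
      apply hPS
      show π (zt ^ 2) ∈ P
      rw [pow_two, map_mul, hz]; exact one_mem _
    have h3 : zq ^ (Nat.card ((H.comap π) ⧸ (S.subgroupOf (H.comap π)))) = 1 := pow_card_eq_one'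
    have h4 : zq = 1 := by
      have hcop : Nat.Coprime 2 (Nat.card ((H.comap π) ⧸ (S.subgroupOf (H.comap π)))) :=
        (Nat.coprime_two_left).2 hSodd
      have := Nat.dvd_gcd (orderOf_dvd_of_pow_eq_one h2) (orderOf_dvd_of_pow_eq_one h3)
      rw [hcop] at this
      exact orderOf_eq_one_iff.1 (Nat.dvd_one.1 this)
    rw [QuotientGroup.eq_one_iff] at h4
    exact h4
  -- the intertwiner
  have hTg := hTn gt hgH
  have hTz := hTn zt hzH
  obtain ⟨f, hf1, hf2, hf3⟩ := hst gt hgH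
  obtain ⟨A, hA1, hA2, hA3⟩ := hzS.2
  have hzS' : IsoS ρ ρ (P.comap π) (W.map (ρ gt)) ((W.map (ρ gt)).map (ρ zt)) := by
    have h1 : gt⁻¹ * zt * gt ∈ S := by simpa using hSn gt⁻¹ (inv_mem hgH) zt hzS
    have h2 := h1.2.conj hTg
    rw [← map_rho_mul] at h2
    rw [← map_rho_mul]
    convert h2 using 3
    group
  obtain ⟨A', hA'1, hA'2, hA'3⟩ := hzS'
  have hfW : InvS ρ (P.comap π) (W.map f) := by rw [hf2]; exact hWP.conj hTg
  obtain ⟨lam, hl1, hl2, hl3⟩ := ratio_char (fun g _ => hNn g) hker hW hWP hf1 hf3 hfW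
  have hfm : ∀ w ∈ W, f w ∈ W.map (ρ gt) := fun w hw => hf2 ▸ ⟨w, hw, rfl⟩
  have hAm : ∀ w ∈ W, ρ zt⁻¹ (A w) ∈ W := by
    intro w hw
    have : A w ∈ W.map (ρ zt) := hA2 ▸ ⟨w, hw, rfl⟩
    obtain ⟨x, hx, hx'⟩ := this
    rw [← hx', rho_inv_apply]; exact hx
  have hsemi : ∀ u ∈ P.comap π, ∀ w ∈ W, ρ zt⁻¹ (A (ρ u w)) = ρ (zt⁻¹ * u * zt) (ρ zt⁻¹ (A w)) := by
    intro u hu w hw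
    rw [hA1 u hu w hw, ← rho_mul_apply, ← rho_mul_apply]
    congr 2; group
  have hconjm : ∀ u ∈ P.comap π, zt⁻¹ * u * zt ∈ P.comap π := fun u hu => hTz.mem hu
  obtain ⟨c, hc⟩ := hW.scalar2 (f := A' ∘ₗ f) (f2 := ρ zt ∘ₗ f ∘ₗ ρ zt⁻¹ ∘ₗ A) (by
      intro k hk w hw
      simp only [LinearMap.comp_apply]
      rw [hf1 k hk w hw, hA'1 k (hker hk) _ (hfm w hw)]) (by
      intro k hk w hw
      simp only [LinearMap.comp_apply]
      rw [hsemi k (hker hk) w hw, hf1 _ ((hNn zt).mem hk) _ (hAm w hw), ← rho_mul_apply,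
        ← rho_mul_apply]
      congr 2; group) (by
      intro w hw h0
      exact hf3 w hw (hA'3 _ (hfm w hw) h0)) (by
      intro w hw
      rw [Submodule.map_comp, hf2, hA'2]
      exact ⟨_, hfm _ (hAm w hw), rfl⟩)
  simp only [LinearMap.comp_apply] at hc
  obtain ⟨w0, hw0, hw0n⟩ := (Submodule.ne_bot_iff W).1 hW.2.1
  have hne : ρ zt (f (ρ zt⁻¹ (A w0))) ≠ 0 := by
    intro h0
    have h1 : f (ρ zt⁻¹ (A w0)) = 0 := rho_inj zt (by rw [h0, map_zero])
    have h2 := hf3 _ (hAm w0 hw0) h1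
    have h3 : A w0 = 0 := rho_inj zt⁻¹ (by rw [h2, map_zero])
    exact hw0n (hA3 w0 hw0 h3)
  have hlz : ∀ u ∈ P.comap π, lam u = lam (zt⁻¹ * u * zt) := by
    intro u hu
    have h1 := hc (ρ u w0) (hWP u hu w0 hw0)
    rw [hsemi u hu w0 hw0, hl1 _ (hconjm u hu) _ (hAm w0 hw0), hl1 u hu w0 hw0, map_smul, map_smul,
      hA'1 u hu _ (hfm w0 hw0), ← rho_mul_apply, show zt * (zt⁻¹ * u * zt) = u * zt by group,
      rho_mul_apply, smul_comm c, ← map_smul (ρ u) c, ← hc w0 hw0, ← sub_eq_zero, ← sub_smul,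
      smul_eq_zero, sub_eq_zero] at h1
    rcases h1 with h1 | h1
    · exact h1.symm
    · exact absurd (rho_inj u (by rw [h1, map_zero])) hne
  have hl : ∀ u ∈ P.comap π, lam u = 1 := by
    intro u hu
    have hsq : lam u * lam u = 1 := by
      nth_rewrite 1 [hlz u hu]
      rw [← hl2 _ (hconjm u hu) _ hu]
      apply hl3
      rw [MonoidHom.mem_ker]
      simp only [map_mul, map_inv]
      have hz' : (π zt)⁻¹ = π zt := inv_eq_of_mul_eq_one_left hz
      have := hinv (π u) hu
      rw [hz'] at this ⊢
      rw [this]; simp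
    have hpow : ∀ k : ℕ, lam (u ^ k) = lam u ^ k := by
      intro k
      induction k with
      | zero => rw [pow_zero, pow_zero]; exact hl3 1 (one_mem _)
      | succ k ih => rw [pow_succ, pow_succ, hl2 _ (pow_mem hu k) _ hu, ih]
    have hp1 : lam u ^ p = 1 := by
      rw [← hpow]
      apply hl3
      rw [MonoidHom.mem_ker, map_pow]
      exact hexp _ hu
    obtain ⟨k, rfl⟩ := hp
    rw [pow_succ, pow_mul, pow_two, hsq, one_pow, one_mul] at hp1
    exact hp1
  refine cyclic_ext (N := P.comap π) hTg hgH ?_ hX hWPi hWX ⟨f, ?_, hf2, hf3⟩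
  · intro k hk
    obtain ⟨j, u, hu, he⟩ := hgen (π k) hk
    refine ⟨j, (gt ^ j)⁻¹ * k, ?_, by group⟩
    show π _ ∈ P
    rw [map_mul, map_inv, map_pow, he]
    simpa using hu
  · intro u hu w hw
    rw [hl1 u hu w hw, hl u hu, one_smul]

end Blem

section PGLc
variable {Γ : Type} [Group Γ] [Finite Γ] {V : Type} [AddCommGroup V] [Module ℂ V]
  [FiniteDimensional ℂ V]
  {ρ : Representation ℂ Γ V} {L : Type} [Group L] [Finite L] {π : Γ →* L}

/-- a nonzero vector is detected by an equivariant projection to an irreducible -/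
lemma exists_proj_ne {K : Subgroup Γ} {X : Submodule ℂ V} (hX : InvS ρ K X) {x : V} (hx : x ∈ X)
    (hx0 : x ≠ 0) : ∃ E ≤ X, IrrS ρ K E ∧ ∃ Q : V →ₗ[ℂ] V, HomOn ρ ρ K X Q ∧
      (∀ v ∈ X, Q v ∈ E) ∧ Q x ≠ 0 := by
  generalize hn : Module.finrank ℂ X = n
  induction n using Nat.strong_induction_on generalizing X x with
  | _ n ih =>
    have hX0 : X ≠ ⊥ := fun h => hx0 (by rw [h] at hx; simpa using hx)
    obtain ⟨E, hEX, hE⟩ := exists_IrrS hX hX0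
    obtain ⟨Q, hQ1, hQ2, hQ3⟩ := exists_proj (ρ := ρ) hE.1
    by_cases h0 : Q x = 0
    · have hY : InvS ρ K (X ⊓ LinearMap.ker Q) := ker_inv hX (fun k hk w _ => hQ1 k hk w)
      have hlt : Module.finrank ℂ (X ⊓ LinearMap.ker Q : Submodule ℂ V) < n := by
        rw [← hn]
        apply Submodule.finrank_lt_finrank_of_lt
        refine lt_of_le_of_ne inf_le_left fun h => hE.2.1 ?_
        rw [eq_bot_iff]
        intro e he
        have h1 : e ∈ X ⊓ LinearMap.ker Q := by rw [h]; exact hEX he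
        have h2 : Q e = 0 := h1.2
        rw [hQ3 e he] at h2
        simpa using h2
      obtain ⟨E', hE'Y, hE', Q', hQ'1, hQ'2, hQ'3⟩ := ih _ hlt hY ⟨hx, h0⟩ hx0 rfl
      have hm : ∀ v ∈ X, v - Q v ∈ X ⊓ LinearMap.ker Q := by
        intro v hv
        refine ⟨X.sub_mem hv (hEX (hQ2 v)), ?_⟩
        show Q (v - Q v) = 0
        rw [map_sub, hQ3 _ (hQ2 v), sub_self]
      refine ⟨E', hE'Y.trans inf_le_left, hE', Q' ∘ₗ (LinearMap.id - Q), ?_, ?_, ?_⟩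
      · intro k hk v hv
        simp only [LinearMap.comp_apply, LinearMap.sub_apply, LinearMap.id_apply]
        rw [hQ1 k hk v, ← map_sub, hQ'1 k hk _ (hm v hv)]
      · intro v hv
        exact hQ'2 _ (hm v hv)
      · simpa [h0] using hQ'3
    · exact ⟨E, hEX, hE, Q, fun k hk w _ => hQ1 k hk w, fun v _ => hQ2 v, h0⟩

theorem pgl_core (hπ : Function.Surjective π) {p : ℕ} (hpp : p.Prime) (hp5 : 5 ≤ p)
    {P B H : Subgroup L}
    (hPB : P ≤ B) (hBH : B ≤ H) (hPn : ∀ h ∈ B, Nrm P h)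
    {u0 : L} (hu0 : u0 ∈ P) (hcyc : ∀ u ∈ P, ∃ j : ℕ, u = u0 ^ j) (hu0p : u0 ^ p = 1)
    (hcomm : ∀ a ∈ B, ∀ b ∈ B, a * b * a⁻¹ * b⁻¹ ∈ P)
    {g : L} (hgH : g ∈ B) (hgen : ∀ h ∈ B, ∃ j : ℕ, ∃ u ∈ P, h = g ^ j * u)
    {z : L} (hzH : z ∈ B) (hz : z * z = 1) (hinv : ∀ u ∈ P, z * u * z⁻¹ = u⁻¹)
    (hcent : ∀ b ∈ B, b * u0 = u0 * b → b ∈ P) (hidx : P.relIndex B = p - 1)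
    (hidx2 : B.relIndex H = p + 1)
    {w : L} (hwH : w ∈ H) (hw : ∀ h ∈ H, h ∈ B ∨ ∃ u ∈ P, ∃ b ∈ B, h = u * w * b)
    {X W : Submodule ℂ V} (hX : IrrS ρ (H.comap π) X) (hWX : W ≤ X) (hW : IrrS ρ π.ker W)
    (hst : ∀ t, π t ∈ H → IsoS ρ ρ π.ker W (W.map (ρ t)))
    {d : ℕ} (hd : Odd d) (hdp : ¬ p ∣ d) (hdim : Module.finrank ℂ X = d * Module.finrank ℂ W) :
    Module.finrank ℂ X = Module.finrank ℂ W := by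
  have hpodd : Odd p := hpp.odd_of_ne_two (by omega)
  have hker : ∀ A : Subgroup L, π.ker ≤ A.comap π := fun A => Subgroup.comap_mono bot_le
  have hPT : P.comap π ≤ B.comap π := Subgroup.comap_mono hPB
  have hBT : B.comap π ≤ H.comap π := Subgroup.comap_mono hBH
  have hNn : ∀ t : Γ, Nrm π.ker t := fun t => Nrm.of_normal t
  have hTn := nrm_comap (π := π) hPn
  have hWpos := hW.finrank_pos
  -- every N-irreducible in X is isomorphic to W
  have hall : ∀ W' ≤ X, IrrS ρ π.ker W' → IsoS ρ ρ π.ker W W' := by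
    intro W' hW' hI
    obtain ⟨t, ht, hi⟩ := irr_sub_conj (fun g _ => hNn g) hX hW hWX hI hW'
    exact (hst t ht).trans hi
  have hst' : ∀ W' ≤ X, IrrS ρ π.ker W' → ∀ t, π t ∈ H → IsoS ρ ρ π.ker W' (W'.map (ρ t)) := by
    intro W' hW' hI t ht
    exact (iso_stab_transport (hall W' hW' hI) hW.1 (hNn t)).1 (hst t ht)
  obtain ⟨ut, hut⟩ := hπ u0
  -- P-irreducibles have dimension dim W
  have hgenP : ∀ k ∈ P.comap π, ∃ j : ℕ, ∃ n ∈ π.ker, k = ut ^ j * n := by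
    intro k hk
    obtain ⟨j, hj⟩ := hcyc (π k) hk
    refine ⟨j, (ut ^ j)⁻¹ * k, ?_, by group⟩
    rw [MonoidHom.mem_ker, map_mul, map_inv, map_pow, hut, hj]; simp
  have hutP : ut ∈ P.comap π := by show π ut ∈ P; rw [hut]; exact hu0
  have hPirr : ∀ E ≤ X, IrrS ρ (P.comap π) E → IrrS ρ π.ker E := by
    intro E hE hI
    obtain ⟨W', hW'E, hW'⟩ := exists_IrrS (hI.1.mono (hker P)) hI.2.1
    have := cyclic_ext (g := ut) (hNn ut) hutP hgenP hI hW' hW'E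
      (hst' W' (hW'E.trans hE) hW' ut (hBH (hPB hutP)))
    rw [← Submodule.eq_of_le_of_finrank_eq hW'E this.symm]; exact hW'
  obtain ⟨X0, hX0X, hX0, hX0d⟩ : ∃ X0 ≤ X, IrrS ρ (B.comap π) X0 ∧
      ¬ (2 * Module.finrank ℂ W) ∣ Module.finrank ℂ X0 := by
    by_contra hcon
    push Not at hcon
    have := dvd_finrank (hX.1.mono hBT) (2 * Module.finrank ℂ W) (fun Y hY hI => hcon Y hY hI)
    rw [hdim] at this
    have h2 := Nat.dvd_of_mul_dvd_mul_right hWpos this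
    exact (Nat.not_even_iff_odd.2 hd) (even_iff_two_dvd.2 h2)
  obtain ⟨E, hEX0, hE⟩ := exists_IrrS (hX0.1.mono hPT) hX0.2.1
  have hEN := hPirr E (hEX0.trans hX0X) hE
  have hEW := (hall E (hEX0.trans hX0X) hEN).finrank_eq
  obtain ⟨d0, hd0⟩ := clifford_dvd (fun g _ => hNn g) (hker B) hX0 hEN hEX0
  have hX0E : Module.finrank ℂ X0 = Module.finrank ℂ E := by
    refine blem hπ hpodd hPB hPn ?_ hcomm hgH hgen hzH hz hinv hX0 hEX0 hEN hE.1
      (fun t ht => hst' E (hEX0.trans hX0X) hEN t (hBH ht)) (d := d0) ?_ (by rw [hd0, mul_comm])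
    · intro u hu
      obtain ⟨j, rfl⟩ := hcyc u hu
      rw [← pow_mul, mul_comm, pow_mul, hu0p, one_pow]
    · rw [← Nat.not_even_iff_odd]
      rintro ⟨k, rfl⟩
      apply hX0d
      rw [hd0, hEW]
      exact ⟨k, by ring⟩
  have hEq : E = X0 := Submodule.eq_of_le_of_finrank_eq hEX0 hX0E.symm
  subst hEq
  have hEX := hX0X
  -- d ≤ p + 1
  have hdle : d ≤ p + 1 := by
    have h1 := finrank_le_index hX hX0.1 hEX hX0.2.1
    rw [hdim, ← hEW, Subgroup.relIndex_comap, Subgroup.map_comap_eq_self_of_surjective hπ, hidx2]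
      at h1
    exact Nat.le_of_mul_le_mul_right h1 hWpos
  have hd2 : ¬ 2 ∣ d := fun h => (Nat.not_even_iff_odd.2 hd) (even_iff_two_dvd.2 h)
  by_cases hcase : ∃ E' ≤ X, IrrS ρ (P.comap π) E' ∧ ¬ IsoS ρ ρ (P.comap π) E E'
  · exfalso
    obtain ⟨E', hE'X, hE', hniso⟩ := hcase
    obtain ⟨X', hX'X, hX', E2, hE2X', hE2, t, ht, hi⟩ :=
      exists_irr_over hTn hPT (hX.1.mono hBT) hE' hE'X
    have hE2n : ¬ IsoS ρ ρ (P.comap π) E E2 := by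
      intro h
      apply hniso
      have h1 : IsoS ρ ρ (P.comap π) E (E'.map (ρ t)) := h.trans (hi.symm (hE'.1.conj (hTn t ht)))
      have h2 := h1.conj (hTn _ (inv_mem ht))
      rw [← map_rho_mul, inv_mul_cancel, map_rho_one, hX0.1.map_eq (inv_mem ht)] at h2
      exact h2
    have hE2X := hE2X'.trans hX'X
    have hE2N := hPirr E2 hE2X hE2
    obtain ⟨f, hf1, hf2, hf3⟩ := ((hall E hEX hEN).symm hW.1).trans (hall E2 hE2X hE2N)
    obtain ⟨lam, hl1, hl2, hl3⟩ := ratio_char (fun g _ => hNn g) (hker P) hEN hE.1 hf1 hf3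
      (by rw [hf2]; exact hE2.1)
    have hlpow : ∀ k : ℕ, lam (ut ^ k) = lam ut ^ k := by
      intro k
      induction k with
      | zero => rw [pow_zero, pow_zero]; exact hl3 1 (one_mem _)
      | succ k ih => rw [pow_succ, pow_succ, hl2 _ (pow_mem hutP k) _ hutP, ih]
    have hlne : lam ut ≠ 1 := by
      intro h1
      apply hE2n
      refine ⟨f, ?_, hf2, hf3⟩
      intro u hu e he
      rw [hl1 u hu e he]
      obtain ⟨j, n, hn, rfl⟩ := hgenP u hu
      rw [hl2 _ (pow_mem hutP j) _ (hker P hn), hlpow, h1, hl3 n hn, one_pow, one_mul, one_smul]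
    have hlp : lam ut ^ p = 1 := by
      rw [← hlpow]; apply hl3; rw [MonoidHom.mem_ker, map_pow, hut, hu0p]
    have hord : orderOf (lam ut) = p := orderOf_eq_prime hlp hlne (hp := ⟨hpp⟩)
    obtain ⟨e0, he0, he0n⟩ := (Submodule.ne_bot_iff E).1 hEN.2.1
    -- the stabilizer of E2 in B is P
    have hstab : stabS hTn hE2.1 = P.comap π := by
      apply le_antisymm
      · rintro t ⟨ht, A, hA1, hA2, hA3⟩
        have hfm : ∀ w ∈ E, f w ∈ E2 := fun w hw => hf2 ▸ ⟨w, hw, rfl⟩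
        have htE : ∀ w ∈ E, ρ t⁻¹ w ∈ E := fun w hw => hX0.1 _ (inv_mem ht) w hw
        obtain ⟨c, hc⟩ := hEN.scalar2 (f := A ∘ₗ f) (f2 := ρ t ∘ₗ f ∘ₗ ρ t⁻¹) (by
          intro k hk w hw
          simp only [LinearMap.comp_apply]
          rw [hf1 k hk w hw, hA1 k (hker P hk) _ (hfm w hw)]) (by
          intro k hk w hw
          simp only [LinearMap.comp_apply]
          rw [← rho_mul_apply, show t⁻¹ * k = (t⁻¹ * k * t) * t⁻¹ by group, rho_mul_apply,
            hf1 _ ((hNn t).mem hk) _ (htE w hw), ← rho_mul_apply, ← rho_mul_apply]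
          congr 2; group) (by
          intro w hw h0
          exact hf3 w hw (hA3 _ (hfm w hw) h0)) (by
          intro w hw
          rw [Submodule.map_comp, hf2, hA2]
          exact ⟨_, hfm _ (htE w hw), rfl⟩)
        simp only [LinearMap.comp_apply] at hc
        have hut' : t⁻¹ * ut * t ∈ P.comap π := (hTn t ht).mem hutP
        have hlt : lam (t⁻¹ * ut * t) = lam ut := by
          have h1 := hc (ρ ut e0) (hE.1 ut hutP e0 he0)
          rw [← rho_mul_apply, show t⁻¹ * ut = (t⁻¹ * ut * t) * t⁻¹ by group, rho_mul_apply,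
            hl1 _ hut' _ (htE e0 he0), hl1 _ hutP _ he0, map_smul, map_smul,
            hA1 ut hutP _ (hfm e0 he0), ← rho_mul_apply,
            show t * (t⁻¹ * ut * t) = ut * t by group, rho_mul_apply,
            smul_comm c, ← map_smul (ρ ut) c, ← hc e0 he0, ← sub_eq_zero, ← sub_smul,
            smul_eq_zero, sub_eq_zero] at h1
          rcases h1 with h1 | h1
          · exact h1
          · exfalso
            have h2 : ρ t (f (ρ t⁻¹ e0)) = 0 := rho_inj ut (by rw [h1, map_zero])
            have h3 : f (ρ t⁻¹ e0) = 0 := rho_inj t (by rw [h2, map_zero])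
            have h4 := hf3 _ (htE e0 he0) h3
            exact he0n (rho_inj t⁻¹ (by rw [h4, map_zero]))
        obtain ⟨j, n, hn, hj⟩ := hgenP _ hut'
        rw [hj, hl2 _ (pow_mem hutP j) _ (hker P hn), hlpow, hl3 n hn, mul_one] at hlt
        have hmod : j ≡ 1 [MOD p] := by
          have hfin : IsOfFinOrder (lam ut) := by
            rw [← orderOf_pos_iff, hord]; exact hpp.pos
          rw [← hord, ← hfin.pow_eq_pow_iff_modEq, hlt, pow_one]
        have hu0j : u0 ^ j = u0 := by
          have h1 : j ≡ 1 [MOD orderOf u0] := hmod.of_dvd (orderOf_dvd_of_pow_eq_one hu0p)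
          have := pow_eq_pow_iff_modEq.2 h1
          rwa [pow_one] at this
        have hπj := congrArg π hj
        simp only [map_mul, map_inv, map_pow, hut, (MonoidHom.mem_ker).1 hn, mul_one, hu0j] at hπj
        apply hcent _ ht
        calc π t * u0 = π t * ((π t)⁻¹ * u0 * π t) := by rw [hπj]
          _ = u0 * π t := by group
      · intro u hu
        exact ⟨hPT hu, by rw [hE2.1.map_eq hu]; exact IsoS.refl⟩
    have hcl := clifford_stab (X := E2) hTn hX' hE2 (by rw [hstab]; exact hE2) hE2X' le_rfl
    rw [hstab, Subgroup.relIndex_comap, Subgroup.map_comap_eq_self_of_surjective hπ, hidx,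
      ← (hall E2 hE2X hE2N).finrank_eq] at hcl
    have hinf : E ⊓ X' = ⊥ := by
      rcases hX0.2.2 (E ⊓ X') inf_le_left (hX0.1.inf hX'.1) with h | h
      · exact h
      · exfalso
        have hle : E ≤ X' := inf_eq_left.1 h
        rcases hX'.2.2 E hle hX0.1 with h | h
        · exact hE.2.1 h
        · rw [← h, ← hEW] at hcl
          have : 1 * Module.finrank ℂ W = (p - 1) * Module.finrank ℂ W := by rw [one_mul]; exact hcl
          have := Nat.eq_of_mul_eq_mul_right hWpos this
          omega
    have hsum := Submodule.finrank_sup_add_finrank_inf_eq E X'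
    rw [hinf, hcl, ← hEW, finrank_bot, add_zero] at hsum
    have hle := Submodule.finrank_mono (sup_le hEX hX'X)
    rw [hsum, hdim] at hle
    have hle2 : p * Module.finrank ℂ W ≤ d * Module.finrank ℂ W := by
      have : p * Module.finrank ℂ W = Module.finrank ℂ W + (p - 1) * Module.finrank ℂ W := by
        nth_rewrite 1 [show p = 1 + (p - 1) by omega]
        ring
      rw [this]; exact hle
    have hpd := Nat.le_of_mul_le_mul_right hle2 hWpos
    obtain ⟨k, hk⟩ := hpodd
    have : d = p ∨ d = p + 1 := by omega
    rcases this with h | h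
    · exact hdp (h ▸ dvd_rfl)
    · exact hd2 ⟨k + 1, by omega⟩
  · push Not at hcase
    -- every N-irreducible is P-stable
    have hstable : ∀ W' ≤ X, IrrS ρ π.ker W' → InvS ρ (P.comap π) W' := by
      intro W' hW'X hW'
      obtain ⟨f, hf1, hf2, hf3⟩ := ((hall E hEX hEN).symm hW.1).trans (hall W' hW'X hW')
      have hfX : ∀ e ∈ E, f e ∈ X := fun e he => hW'X (hf2 ▸ ⟨e, he, rfl⟩)
      have hfP : HomOn ρ ρ (P.comap π) E f := by
        intro u hu e he
        by_contra hne
        have hXP : InvS ρ (P.comap π) X := hX.1.mono (hPT.trans hBT)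
        obtain ⟨E1, hE1X, hE1, Q, hQ1, hQ2, hQ3⟩ := exists_proj_ne hXP
          (x := f (ρ u e) - ρ u (f e))
          (X.sub_mem (hfX _ (hE.1 u hu e he)) (hXP u hu _ (hfX e he))) (sub_ne_zero.2 hne)
        obtain ⟨h, hh1, hh2, hh3⟩ := hcase E1 hE1X hE1
        obtain ⟨c, hc⟩ := hEN.scalar2 (f := h) (f2 := Q ∘ₗ f)
          (fun k hk w hw => hh1 k (hker P hk) w hw) (by
            intro k hk w hw
            simp only [LinearMap.comp_apply]
            rw [hf1 k hk w hw, hQ1 k (hker P hk) _ (hfX w hw)]) hh3 (by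
            intro w hw
            rw [hh2]; exact hQ2 _ (hfX w hw))
        simp only [LinearMap.comp_apply] at hc
        apply hQ3
        rw [map_sub, hc _ (hE.1 u hu e he), hQ1 u hu _ (hfX e he), hc e he, hh1 u hu e he,
          map_smul, sub_self]
      rw [← hf2]
      exact map_invS hE.1 hfP
    obtain ⟨wt, rfl⟩ := hπ w
    have hwE : IrrS ρ π.ker (E.map (ρ wt)) := hEN.conj (hNn wt)
    have hwEX : E.map (ρ wt) ≤ X := by
      rintro _ ⟨e, he, rfl⟩
      exact hX.1 wt hwH e (hEX he)
    have hwP := hstable _ hwEX hwE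
    have hle : X ≤ E ⊔ E.map (ρ wt) := by
      conv_lhs => rw [irr_eq_iSup hX hEX hE.2.1]
      refine iSup_le fun t => ?_
      rcases hw (π t) t.2 with h | ⟨u, hu, b, hb, h⟩
      · rw [hX0.1.map_eq h]; exact le_sup_left
      · obtain ⟨u, rfl⟩ := hπ u
        have hbt : wt⁻¹ * u⁻¹ * t ∈ B.comap π := by
          show π _ ∈ B
          rw [map_mul, map_mul, map_inv, map_inv, h]
          simpa [mul_assoc] using hb
        have : (t : Γ) = u * (wt * (wt⁻¹ * u⁻¹ * t)) := by group
        rw [this, map_rho_mul, map_rho_mul, hX0.1.map_eq hbt, hwP.map_eq hu]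
        exact le_sup_right
    have h1 := Submodule.finrank_mono hle
    have h2 := Submodule.finrank_add_le_finrank_add_finrank E (E.map (ρ wt))
    rw [finrank_map_rho, ← hEW] at h2
    rw [hdim] at h1
    have h3 : d * Module.finrank ℂ W ≤ 2 * Module.finrank ℂ W := by omega
    have h4 := Nat.le_of_mul_le_mul_right h3 hWpos
    have : d = 1 := by
      obtain ⟨k, hk⟩ := hd
      omega
    rw [hdim, this, one_mul]

end PGLc

section DatSec
variable {G : Type} [Group G] [Finite G] {L : Type} [Group L] [Finite L]

/-- Clifford data for a degree `n` of `G`. -/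
def Dat (M : Subgroup G) (π : M →* L) (H : Subgroup L) (n : ℕ) : Prop :=
  ∃ (V : Type) (_ : AddCommGroup V) (_ : Module ℂ V) (_ : FiniteDimensional ℂ V)
    (R : Representation ℂ G V) (ψ X W : Submodule ℂ V),
    Module.finrank ℂ V = n ∧ IrrS R ⊤ ⊤ ∧ IrrS R M ψ ∧
    IrrS (R.comp M.subtype : Representation ℂ M V) (H.comap π) X ∧ X ≤ ψ ∧
    IrrS (R.comp M.subtype : Representation ℂ M V) π.ker W ∧ W ≤ X ∧
    ∀ g : M, IsoS (R.comp M.subtype : Representation ℂ M V)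
      (R.comp M.subtype : Representation ℂ M V) π.ker W
      (W.map ((R.comp M.subtype : Representation ℂ M V) g)) ↔ π g ∈ H

lemma char_inv_of_iso {N M : Subgroup G} (θ : FDRep ℂ N) (V : FDRep ℂ G) (f : θ →ₗ[ℂ] V)
    (hf : ∀ (n : N) v, f (θ.ρ n v) = V.ρ n (f v)) (hinj : Function.Injective f)
    {m : G} (A : V →ₗ[ℂ] V) (hA : ∀ n : N, ∀ v : θ, A (V.ρ n (f v)) = V.ρ n (A (f v)))
    (hA2 : ∀ v : θ, ∃ w : θ, A (f v) = V.ρ m (f w)) (hA3 : ∀ v : θ, A (f v) = 0 → v = 0)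
    (x : N) (hx : m⁻¹ * (x : G) * m ∈ N) :
    θ.character ⟨m⁻¹ * (x : G) * m, hx⟩ = θ.character x := by
  choose T hT using hA2
  have hTl : ∀ (a b : ℂ) v w, T (a • v + b • w) = a • T v + b • T w := by
    intro a b v w
    apply hinj
    apply rho_inj (ρ := V.ρ) m
    rw [← hT]
    simp only [map_add, map_smul, hT]
  let T' : θ →ₗ[ℂ] θ :=
    { toFun := T
      map_add' := fun v w => by simpa using hTl 1 1 v w
      map_smul' := fun a v => by simpa using hTl a 0 v v }
  have hT' : ∀ v, T' v = T v := fun _ => rfl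
  have hTi : Function.Injective T' := by
    rw [injective_iff_map_eq_zero]
    intro v hv
    apply hA3
    rw [hT, ← hT', hv, map_zero, map_zero]
  have hTb : Function.Bijective T' := ⟨hTi, LinearMap.injective_iff_surjective.1 hTi⟩
  let e := LinearEquiv.ofBijective T' hTb
  have hcomm : ∀ v, T' (θ.ρ x v) = θ.ρ ⟨m⁻¹ * (x : G) * m, hx⟩ (T' v) := by
    intro v
    apply hinj
    apply rho_inj (ρ := V.ρ) m
    rw [hT', ← hT, hf, hA, hT, hf, hT', ← rho_mul_apply, ← rho_mul_apply]
    simp only [mul_assoc, mul_inv_cancel_left]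
  have h1 : θ.ρ ⟨m⁻¹ * (x : G) * m, hx⟩ = e.conj (θ.ρ x) := by
    ext v
    rw [LinearEquiv.conj_apply_apply]
    have := hcomm (e.symm v)
    have h2 : T' (e.symm v) = v := e.apply_symm_apply v
    rw [h2] at this
    exact this.symm
  show LinearMap.trace ℂ _ (θ.ρ _) = LinearMap.trace ℂ _ (θ.ρ x)
  rw [h1, LinearMap.trace_conj']

theorem entry {N M : Subgroup G} [N.Normal] (hNM : N ≤ M) (π : M →* L)
    (hker : ∀ m : M, π m = 1 ↔ (m : G) ∈ N)
    (θ : FDRep ℂ N) (hθ : Simple θ) (hinvθ : ¬ IsMInvariant M θ) {n : ℕ}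
    (hn : n ∈ charDegreesOver G N θ) : ∃ H : Subgroup L, H ≠ ⊤ ∧ Dat M π H n := by
  obtain ⟨V, hV, hVn, hsum⟩ := hn
  obtain ⟨f, hf0, hf⟩ := exists_hom_of_inner θ V hsum
  have hθi := irr_of_simple θ hθ
  have hVi := irr_of_simple V hV
  have hinj : Function.Injective f := by
    rw [injective_iff_map_eq_zero]
    rcases hθi.2.2 (LinearMap.ker f) le_top (fun k _ w hw => by
      rw [LinearMap.mem_ker] at hw ⊢
      rw [hf, hw, map_zero]) with h | h
    · intro v hv
      have : v ∈ LinearMap.ker f := hv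
      rw [h] at this; simpa using this
    · exact absurd (LinearMap.ker_eq_top.1 h) hf0
  set ρ : Representation ℂ M V := V.ρ.comp M.subtype with hρ
  have hρa : ∀ m v, ρ m v = V.ρ (m : G) v := fun m v => rfl
  have hW0 : IrrS ρ π.ker (LinearMap.range f) := by
    refine ⟨?_, ?_, ?_⟩
    · rintro k hk _ ⟨v, rfl⟩
      exact ⟨θ.ρ ⟨k, (hker k).1 hk⟩ v, hf _ _⟩
    · intro h; exact hf0 (LinearMap.range_eq_bot.1 h)
    · intro W' hW' hi
      have h1 : InvS θ.ρ ⊤ (W'.comap f) := by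
        intro k _ v hv
        show f (θ.ρ k v) ∈ W'
        rw [hf]
        exact hi ⟨k, hNM k.2⟩ ((hker _).2 k.2) _ hv
      have h2 : W' = (W'.comap f).map f := by
        rw [Submodule.map_comap_eq, inf_eq_right.2 hW']
      rcases hθi.2.2 _ le_top h1 with h | h
      · left; rw [h2, h, Submodule.map_bot]
      · right; rw [h2, h, Submodule.map_top]
  have hN : ∀ g ∈ (⊤ : Subgroup M), Nrm π.ker g := fun g _ => Nrm.of_normal g
  obtain ⟨ψ, -, hψ, W', hW'ψ, hW', g0, -, hiso⟩ := exists_irr_over hN le_top InvS.top hW0 le_top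
  obtain ⟨X, hXψ, hX, -, W'', hW''X, hW'', hiso'⟩ := exists_stab_irr hN le_top hψ hW' hW'ψ
  have hT : ((stabS hN hW'.1).map π).comap π = stabS hN hW'.1 := by
    rw [Subgroup.comap_map_eq_self]
    intro k hk
    exact ⟨trivial, by rw [hW'.1.map_eq hk]; exact IsoS.refl⟩
  have hst : ∀ g : M, IsoS ρ ρ π.ker W'' (W''.map (ρ g)) ↔ π g ∈ (stabS hN hW'.1).map π := by
    intro g
    rw [← iso_stab_transport hiso' hW'.1 (hN g trivial), ← Subgroup.mem_comap, hT]
    exact ⟨fun h => ⟨trivial, h⟩, fun h => h.2⟩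
  refine ⟨(stabS hN hW'.1).map π, ?_, V, inferInstance, inferInstance, inferInstance, V.ρ,
    ψ, X, W'', hVn, hVi, irrS_comp.1 hψ, by rw [hT]; exact hX, hXψ, hW'', hW''X, hst⟩
  intro htop
  apply hinvθ
  -- all conjugates are isomorphic
  have hall1 : ∀ g : M, IsoS ρ ρ π.ker W'' (W''.map (ρ g)) := fun g => by
    rw [hst, htop]; trivial
  have hiso2 : IsoS ρ ρ π.ker ((LinearMap.range f).map (ρ g0)) W'' := hiso.trans hiso'
  have hW1 : IrrS ρ π.ker ((LinearMap.range f).map (ρ g0)) := hW0.conj (hN g0 trivial)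
  have hall2 : ∀ g : M, IsoS ρ ρ π.ker ((LinearMap.range f).map (ρ g0))
      (((LinearMap.range f).map (ρ g0)).map (ρ g)) := fun g =>
    (iso_stab_transport hiso2 hW1.1 (hN g trivial)).2 (hall1 g)
  have hall : ∀ g : M, IsoS ρ ρ π.ker (LinearMap.range f) ((LinearMap.range f).map (ρ g)) := by
    intro g
    have h1 := hall2 (g * g0⁻¹)
    rw [← map_rho_mul, inv_mul_cancel_right] at h1
    have h2 := hall2 g0⁻¹
    rw [← map_rho_mul, inv_mul_cancel, map_rho_one] at h2
    exact (h2.symm hW1.1).trans h1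
  intro m hm x hx
  obtain ⟨A, hA1, hA2, hA3⟩ := hall ⟨m, hm⟩⁻¹
  have hx' : (m⁻¹)⁻¹ * (x : G) * m⁻¹ ∈ N := by rwa [inv_inv]
  have := char_inv_of_iso (M := M) θ V f hf hinj (m := m⁻¹) A
    (fun n v => hA1 ⟨n, hNM n.2⟩ ((hker _).2 n.2) _ ⟨v, rfl⟩)
    (fun v => by
      have h1 : A (f v) ∈ (LinearMap.range f).map A := ⟨f v, ⟨v, rfl⟩, rfl⟩
      rw [hA2] at h1
      obtain ⟨_, ⟨w, rfl⟩, hw⟩ := h1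
      exact ⟨w, hw.symm⟩)
    (fun v hv => hinj (by rw [map_zero]; exact hA3 _ ⟨v, rfl⟩ hv)) x hx'
  rw [← this]
  congr 2
  simp

end DatSec

section DatProps
variable {G : Type} [Group G] [Finite G] {L : Type} [Group L] [Finite L]
  {M : Subgroup G} [M.Normal] {π : M →* L} {H : Subgroup L} {n : ℕ}

section unpacked
variable {V : Type} [AddCommGroup V] [Module ℂ V] [FiniteDimensional ℂ V]
  {R : Representation ℂ G V} {ρ : Representation ℂ M V} {ψ X W : Submodule ℂ V}

lemma dat_nrm (π : M →* L) (H : Subgroup L) : ∀ g ∈ H.comap π, Nrm π.ker g :=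
  fun g _ => Nrm.of_normal g

lemma dat_all (hX : IrrS ρ (H.comap π) X) (hW : IrrS ρ π.ker W) (hWX : W ≤ X)
    (hst : ∀ g : M, IsoS ρ ρ π.ker W (W.map (ρ g)) ↔ π g ∈ H)
    {W' : Submodule ℂ V} (hW' : IrrS ρ π.ker W') (hle : W' ≤ X) : IsoS ρ ρ π.ker W W' := by
  obtain ⟨g, hg, h⟩ := irr_sub_conj (dat_nrm π H) hX hW hWX hW' hle
  exact ((hst g).2 hg).trans h

lemma dat_core (hπ : Function.Surjective π) (hV : Module.finrank ℂ V = n)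
    (hR : IrrS R ⊤ ⊤) (hψ : IrrS R M ψ) (hρ : ρ = R.comp M.subtype)
    (hX : IrrS ρ (H.comap π) X) (hXψ : X ≤ ψ) (hW : IrrS ρ π.ker W) (hWX : W ≤ X)
    (hst : ∀ g : M, IsoS ρ ρ π.ker W (W.map (ρ g)) ↔ π g ∈ H) :
    n ∈ charDegrees G ∧ ∃ d e : ℕ, Module.finrank ℂ X = d * Module.finrank ℂ W ∧
      n = H.index * Module.finrank ℂ W * d * e ∧
      (IsPGroup 2 (G ⧸ M) → ∃ a, e = 2 ^ a) := by
  have h1 : n ∈ charDegrees G := by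
    have := degree_of_irr hR
    rwa [finrank_top, hV] at this
  have hψ' : IrrS ρ ⊤ ψ := by rw [hρ]; exact irrS_comp.2 hψ
  have h2 : Module.finrank ℂ ψ = H.index * Module.finrank ℂ X := by
    have := clifford (K := ⊤) (T := H.comap π) (N := π.ker) (fun g _ => Nrm.of_normal g) le_top
      hψ' hX hXψ hW hWX (fun g _ => hst g)
    rwa [Subgroup.relIndex_top_right, Subgroup.index_comap_of_surjective H hπ] at this
  have hkle : π.ker ≤ H.comap π := fun k hk => by
    rw [Subgroup.mem_comap, (MonoidHom.mem_ker).1 hk]; exact one_mem _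
  obtain ⟨d, hd⟩ := clifford_dvd (dat_nrm π H) hkle hX hW hWX
  obtain ⟨e, he⟩ := clifford_dvd (K := ⊤) (N := M) (fun g _ => Nrm.of_normal g) le_top
      hR hψ le_top
  rw [finrank_top, hV] at he
  refine ⟨h1, d, e, by rw [hd, mul_comm], ?_, ?_⟩
  · rw [he, h2, hd]; ring
  · intro hP
    have : Fact (Nat.Prime 2) := ⟨Nat.prime_two⟩
    have hA : IsPGroup 2 (⊤ : Subgroup (G ⧸ M)) := hP.to_subgroup ⊤
    have hk : (QuotientGroup.mk' M).ker = M := QuotientGroup.ker_mk' M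
    have := pgroup_ratio (ρ := R) (X := ⊤) (W := ψ) (QuotientGroup.mk'_surjective M) ⊤ hA
      (by rw [Subgroup.comap_top]; exact hR) (by rw [hk]; exact hψ) le_top
    obtain ⟨a, ha⟩ := this
    refine ⟨a, ?_⟩
    rw [finrank_top, hV] at ha
    have := hψ.finrank_pos
    rw [he, mul_comm] at ha
    exact Nat.eq_of_mul_eq_mul_right this ha

lemma two_prime_sub (hG : TwoPrimeHypothesis G) {a b : ℕ} (ha : a ∈ charDegrees G)
    (hb : b ∈ charDegrees G) (hab : a ∣ b) (hne : b ≠ a) : a.primeFactorsList.length ≤ 2 := by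
  have := hG a ha b hb (Ne.symm hne)
  rwa [Nat.gcd_eq_left hab] at this

lemma dat_one (hπ : Function.Surjective π) (hG : TwoPrimeHypothesis G)
    (h2 : IsPGroup 2 (G ⧸ M)) (hV : Module.finrank ℂ V = n)
    (hR : IrrS R ⊤ ⊤) (hψ : IrrS R M ψ) (hρ : ρ = R.comp M.subtype)
    (hX : IrrS ρ (H.comap π) X) (hXψ : X ≤ ψ) (hW : IrrS ρ π.ker W) (hWX : W ≤ X)
    (hst : ∀ g : M, IsoS ρ ρ π.ker W (W.map (ρ g)) ↔ π g ∈ H)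
    (hna : ∃ a ∈ H, ∃ b ∈ H, a * b ≠ b * a) :
    ∃ d : ℕ, Module.finrank ℂ X = d * Module.finrank ℂ W ∧ 0 < d ∧
      d * H.index ∣ n ∧ (d = 1 → 2 * H.index ∣ n ∨ n.primeFactorsList.length ≤ 2) := by
  obtain ⟨hn, d, e, hd, hne, he⟩ := dat_core hπ hV hR hψ hρ hX hXψ hW hWX hst
  have hd0 : 0 < d := by
    have := hX.finrank_pos
    rw [hd] at this
    exact Nat.pos_of_mul_pos_right this
  refine ⟨d, hd, hd0, ⟨Module.finrank ℂ W * e, by rw [hne]; ring⟩, ?_⟩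
  intro hd1
  obtain ⟨a, ha⟩ := he h2
  rcases a with _ | a
  · right
    have hn' : n = H.index * Module.finrank ℂ W := by rw [hne, ha, hd1]; simp
    have hWX' : W = X := Submodule.eq_of_le_of_finrank_eq hWX (by rw [hd, hd1, one_mul])
    obtain ⟨a, haH, b, hbH, hab⟩ := hna
    obtain ⟨m, hm, hdvd, hmne⟩ := gallagher M π hπ ρ hW H hst (by rw [hWX']; exact hX.1) haH hbH hab
    rw [← hn'] at hdvd hmne
    exact two_prime_sub hG hn hm hdvd hmne
  · left
    exact ⟨Module.finrank ℂ W * d * 2 ^ a, by rw [hne, ha]; ring⟩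

end unpacked

lemma Dat.basic (h : Dat M π H n) (hπ : Function.Surjective π) :
    n ∈ charDegrees G ∧ H.index ∣ n := by
  obtain ⟨V, _, _, _, R, ψ, X, W, hV, hR, hψ, hX, hXψ, hW, hWX, hst⟩ := h
  obtain ⟨hn, d, e, -, hne, -⟩ := dat_core hπ hV hR hψ rfl hX hXψ hW hWX hst
  exact ⟨hn, ⟨Module.finrank ℂ W * d * e, by rw [hne]; ring⟩⟩

/-- small stabilizers -/
lemma Dat.small (h : Dat M π H n) (hπ : Function.Surjective π) (hG : TwoPrimeHypothesis G)
    (h2 : IsPGroup 2 (G ⧸ M)) (hna : ∃ a ∈ H, ∃ b ∈ H, a * b ≠ b * a) (hc : Nat.card H ≤ 60) :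
    (2 * H.index ∣ n ∨ 3 * H.index ∣ n ∨ 5 * H.index ∣ n ∨ 7 * H.index ∣ n) ∨
      n.primeFactorsList.length ≤ 2 := by
  obtain ⟨V, _, _, _, R, ψ, X, W, hV, hR, hψ, hX, hXψ, hW, hWX, hst⟩ := h
  obtain ⟨d, hd, hd0, hdn, hd1⟩ := dat_one hπ hG h2 hV hR hψ rfl hX hXψ hW hWX hst hna
  have hsq := irr_sq_le hX hW hWX (fun g hg => (hst g).2 hg)
  have hri : π.ker.relIndex (H.comap π) = Nat.card H := by
    rw [← MonoidHom.comap_bot, Subgroup.relIndex_comap, Subgroup.map_comap_eq_self_of_surjective hπ,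
      Subgroup.relIndex_bot_left]
  rw [hri, hd, mul_pow] at hsq
  have hw := hW.finrank_pos
  have hdc : d ^ 2 ≤ 60 := (Nat.le_of_mul_le_mul_right hsq (by positivity)).trans hc
  have hd7 : d ≤ 7 := by nlinarith
  have key : ∀ k, k ∣ d → k * H.index ∣ n := fun k hk =>
    (Nat.mul_dvd_mul_right hk _).trans hdn
  interval_cases d
  · rcases hd1 rfl with h | h
    · exact Or.inl (Or.inl h)
    · exact Or.inr h
  · exact Or.inl (Or.inl (key 2 (by norm_num)))
  · exact Or.inl (Or.inr (Or.inl (key 3 (by norm_num))))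
  · exact Or.inl (Or.inl (key 2 (by norm_num)))
  · exact Or.inl (Or.inr (Or.inr (Or.inl (key 5 (by norm_num)))))
  · exact Or.inl (Or.inl (key 2 (by norm_num)))
  · exact Or.inl (Or.inr (Or.inr (Or.inr (key 7 (by norm_num)))))

/-- stabilizers with a cyclic subgroup of index two -/
lemma Dat.dihedral (h : Dat M π H n) (hπ : Function.Surjective π) (hG : TwoPrimeHypothesis G)
    (h2 : IsPGroup 2 (G ⧸ M)) (hna : ∃ a ∈ H, ∃ b ∈ H, a * b ≠ b * a)
    {g : L} (hg : g ∈ H) (hidx : (Subgroup.zpowers g).relIndex H = 2) :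
    2 * H.index ∣ n ∨ n.primeFactorsList.length ≤ 2 := by
  obtain ⟨V, _, _, _, R, ψ, X, W, hV, hR, hψ, hX, hXψ, hW, hWX, hst⟩ := h
  obtain ⟨d, hd, hd0, hdn, hd1⟩ := dat_one hπ hG h2 hV hR hψ rfl hX hXψ hW hWX hst hna
  set ρ : Representation ℂ M V := R.comp M.subtype with hρ
  set A := Subgroup.zpowers g with hA
  have hAH : A ≤ H := by rw [hA, Subgroup.zpowers_le]; exact hg
  have hcle : A.comap π ≤ H.comap π := Subgroup.comap_mono hAH
  obtain ⟨Y, hYX, hY⟩ := exists_IrrS (hX.1.mono hcle) hX.2.1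
  have hkle : π.ker ≤ A.comap π := fun k hk => by
    rw [Subgroup.mem_comap, (MonoidHom.mem_ker).1 hk]; exact one_mem _
  obtain ⟨W1, hW1Y, hW1⟩ := exists_IrrS (hY.1.mono hkle) hY.2.1
  have hiso := dat_all hX hW hWX hst hW1 (hW1Y.trans hYX)
  obtain ⟨gt, hgt⟩ := hπ g
  have hYd : Module.finrank ℂ Y = Module.finrank ℂ W1 := by
    refine cyclic_ext (g := gt) (Nrm.of_normal gt) ?_ ?_ hY hW1 hW1Y ?_
    · rw [Subgroup.mem_comap, hgt]; exact Subgroup.mem_zpowers g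
    · intro k hk
      rw [Subgroup.mem_comap, hA, ← mem_powers_iff_mem_zpowers] at hk
      obtain ⟨j, hj⟩ := hk
      have hj : g ^ j = π k := hj
      refine ⟨j, (gt ^ j)⁻¹ * k, ?_, by group⟩
      rw [MonoidHom.mem_ker, map_mul, map_inv, map_pow, hgt, hj, inv_mul_cancel]
    · rw [← iso_stab_transport hiso hW.1 (Nrm.of_normal gt), hst, hgt]; exact hg
  have hle := finrank_le_index hX hY.1 hYX hY.2.1
  have hri : (A.comap π).relIndex (H.comap π) = 2 := by
    rw [Subgroup.relIndex_comap, Subgroup.map_comap_eq_self_of_surjective hπ, hidx]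
  rw [hri, hYd, ← hiso.finrank_eq, hd] at hle
  have hd2 : d ≤ 2 := Nat.le_of_mul_le_mul_right hle hW.finrank_pos
  interval_cases d
  · exact hd1 rfl
  · exact Or.inl hdn

/-- Case I -/
lemma Dat.caseI (h : Dat M π H n) (hπ : Function.Surjective π) (hG : TwoPrimeHypothesis G)
    (h2 : IsPGroup 2 (G ⧸ M)) (hna : ∃ a ∈ H, ∃ b ∈ H, a * b ≠ b * a)
    {p : ℕ} (hpp : p.Prime) (hp : Odd p) {P : Subgroup L} (hPH : P ≤ H)
    (hPn : ∀ h ∈ H, Nrm P h) (hexp : ∀ u ∈ P, u ^ p = 1)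
    (hcomm : ∀ a ∈ H, ∀ b ∈ H, a * b * a⁻¹ * b⁻¹ ∈ P)
    {g : L} (hgH : g ∈ H) (hgen : ∀ h ∈ H, ∃ j : ℕ, ∃ u ∈ P, h = g ^ j * u)
    {z : L} (hzH : z ∈ H) (hz : z * z = 1) (hinv : ∀ u ∈ P, z * u * z⁻¹ = u⁻¹) :
    (2 * H.index ∣ n ∨ p * H.index ∣ n) ∨ n.primeFactorsList.length ≤ 2 := by
  obtain ⟨V, _, _, _, R, ψ, X, W, hV, hR, hψ, hX, hXψ, hW, hWX, hst⟩ := h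
  obtain ⟨d, hd, hd0, hdn, hd1⟩ := dat_one hπ hG h2 hV hR hψ rfl hX hXψ hW hWX hst hna
  set ρ : Representation ℂ M V := R.comp M.subtype with hρ
  have key : ∀ k, k ∣ d → k * H.index ∣ n := fun k hk =>
    (Nat.mul_dvd_mul_right hk _).trans hdn
  by_cases h2d : 2 ∣ d
  · exact Or.inl (Or.inl (key _ h2d))
  by_cases hpd : p ∣ d
  · exact Or.inl (Or.inr (key _ hpd))
  have : Fact p.Prime := ⟨hpp⟩
  have hPp : IsPGroup p P := fun u => ⟨1, by
    rw [pow_one]; exact Subtype.ext (hexp u u.2)⟩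
  have hcle : P.comap π ≤ H.comap π := Subgroup.comap_mono hPH
  obtain ⟨Y, hYX, hY⟩ := exists_IrrS (hX.1.mono hcle) hX.2.1
  have hkle : π.ker ≤ P.comap π := fun k hk => by
    rw [Subgroup.mem_comap, (MonoidHom.mem_ker).1 hk]; exact one_mem _
  obtain ⟨W1, hW1Y, hW1⟩ := exists_IrrS (hY.1.mono hkle) hY.2.1
  have hiso := dat_all hX hW hWX hst hW1 (hW1Y.trans hYX)
  obtain ⟨a, ha⟩ := pgroup_ratio hπ P hPp hY hW1 hW1Y
  have hdvd := clifford_dvd (nrm_comap (π := π) hPn) hcle hX hY hYX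
  rw [ha, hd, ← hiso.finrank_eq] at hdvd
  have hpa : p ^ a ∣ d := Nat.dvd_of_mul_dvd_mul_right hW.finrank_pos hdvd
  have ha0 : a = 0 := by
    by_contra h0
    exact hpd ((dvd_pow_self p h0).trans hpa)
  rw [ha0, pow_zero, one_mul] at ha
  have hWY : W1 = Y := Submodule.eq_of_le_of_finrank_eq hW1Y ha.symm
  have := blem (ρ := ρ) hπ hp hPH hPn hexp hcomm hgH hgen hzH hz hinv hX (hW1Y.trans hYX) hW1
    (by rw [hWY]; exact hY.1)
    (fun t ht => (iso_stab_transport hiso hW.1 (Nrm.of_normal t)).1 ((hst t).2 ht))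
    (Nat.odd_iff.2 (by omega)) (d := d) (by rw [hd, hiso.finrank_eq])
  rw [← hiso.finrank_eq, hd] at this
  have hd1' : d = 1 := by
    have h0 := hW.finrank_pos
    exact Nat.eq_of_mul_eq_mul_right h0 (by rw [this, one_mul])
  rcases hd1 hd1' with h | h
  · exact Or.inl (Or.inl h)
  · exact Or.inr h

/-- the `PGL₂(p)` case -/
lemma Dat.pgl (h : Dat M π H n) (hπ : Function.Surjective π) (hG : TwoPrimeHypothesis G)
    (h2 : IsPGroup 2 (G ⧸ M)) (hna : ∃ a ∈ H, ∃ b ∈ H, a * b ≠ b * a)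
    {p : ℕ} (hpp : p.Prime) (hp5 : 5 ≤ p)
    {P B : Subgroup L}
    (hPB : P ≤ B) (hBH : B ≤ H) (hPn : ∀ h ∈ B, Nrm P h)
    {u0 : L} (hu0 : u0 ∈ P) (hcyc : ∀ u ∈ P, ∃ j : ℕ, u = u0 ^ j) (hu0p : u0 ^ p = 1)
    (hcomm : ∀ a ∈ B, ∀ b ∈ B, a * b * a⁻¹ * b⁻¹ ∈ P)
    {g : L} (hgH : g ∈ B) (hgen : ∀ h ∈ B, ∃ j : ℕ, ∃ u ∈ P, h = g ^ j * u)
    {z : L} (hzH : z ∈ B) (hz : z * z = 1) (hinv : ∀ u ∈ P, z * u * z⁻¹ = u⁻¹)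
    (hcent : ∀ b ∈ B, b * u0 = u0 * b → b ∈ P) (hidx : P.relIndex B = p - 1)
    (hidx2 : B.relIndex H = p + 1)
    {w : L} (hwH : w ∈ H) (hw : ∀ h ∈ H, h ∈ B ∨ ∃ u ∈ P, ∃ b ∈ B, h = u * w * b) :
    (2 * H.index ∣ n ∨ p * H.index ∣ n) ∨ n.primeFactorsList.length ≤ 2 := by
  obtain ⟨V, _, _, _, R, ψ, X, W, hV, hR, hψ, hX, hXψ, hW, hWX, hst⟩ := h
  obtain ⟨d, hd, hd0, hdn, hd1⟩ := dat_one hπ hG h2 hV hR hψ rfl hX hXψ hW hWX hst hna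
  have key : ∀ k, k ∣ d → k * H.index ∣ n := fun k hk =>
    (Nat.mul_dvd_mul_right hk _).trans hdn
  by_cases h2d : 2 ∣ d
  · exact Or.inl (Or.inl (key _ h2d))
  by_cases hpd : p ∣ d
  · exact Or.inl (Or.inr (key _ hpd))
  have := pgl_core (ρ := R.comp M.subtype) hπ hpp hp5 hPB hBH hPn hu0 hcyc hu0p hcomm hgH hgen
    hzH hz hinv hcent hidx hidx2 hwH hw hX hWX hW (fun t ht => (hst t).2 ht)
    (Nat.odd_iff.2 (by omega)) hpd hd
  rw [hd] at this
  have hd1' : d = 1 := by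
    have h0 := hW.finrank_pos
    exact Nat.eq_of_mul_eq_mul_right h0 (by rw [this, one_mul])
  rcases hd1 hd1' with h | h
  · exact Or.inl (Or.inl h)
  · exact Or.inr h

end DatProps

section Orb
variable {Γ : Type} [Group Γ] [Finite Γ] {X : Type} [MulAction Γ X]

open Classical in
lemma card_orbit_stab (x : X) :
    (MulAction.orbit Γ x).ncard * Nat.card (MulAction.stabilizer Γ x) = Nat.card Γ := by
  have := Fintype.ofFinite Γ
  rw [← MulAction.index_stabilizer]
  exact Subgroup.index_mul_card _

open Classical in
/-- A transversal of the orbits on a finite invariant set. -/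
lemma exists_transversal (T : Finset X) (hT : ∀ (g : Γ), ∀ x ∈ T, g • x ∈ T) :
    ∃ R ⊆ T, (∀ x ∈ T, ∃ y ∈ R, y ∈ MulAction.orbit Γ x) ∧
      (∀ x ∈ R, ∀ y ∈ R, y ∈ MulAction.orbit Γ x → y = x) ∧
      (∀ (f : X → ℕ), ∑ x ∈ T, f x = ∑ y ∈ R, ∑ x ∈ T with x ∈ MulAction.orbit Γ y, f x) ∧
      T.card = ∑ y ∈ R, (MulAction.orbit Γ y).ncard := by
  let rep : X → X := fun x => Quotient.out (Quotient.mk (MulAction.orbitRel Γ X) x)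
  have hrep : ∀ x, rep x ∈ MulAction.orbit Γ x := fun x => by
    have : (MulAction.orbitRel Γ X).r (rep x) x := Quotient.exact (Quotient.out_eq _)
    exact this
  have hrep2 : ∀ x y, y ∈ MulAction.orbit Γ x → rep y = rep x := fun x y h => by
    have : Quotient.mk (MulAction.orbitRel Γ X) y = Quotient.mk (MulAction.orbitRel Γ X) x :=
      Quotient.sound h
    simp only [rep, this]
  have hrr : ∀ x, rep (rep x) = rep x := fun x => hrep2 _ _ (hrep x)
  have hmem : ∀ x ∈ T, rep x ∈ T := fun x hx => by
    obtain ⟨g, hg⟩ := hrep x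
    rw [← hg]; exact hT g x hx
  have hR : ∀ y ∈ T.image rep, rep y = y := by
    intro y hy
    obtain ⟨x, -, rfl⟩ := Finset.mem_image.1 hy
    exact hrr x
  have hfib : ∀ (f : X → ℕ), ∑ x ∈ T, f x =
      ∑ y ∈ T.image rep, ∑ x ∈ T with x ∈ MulAction.orbit Γ y, f x := by
    intro f
    rw [← Finset.sum_fiberwise_of_maps_to (s := T) (t := T.image rep) (g := rep)
      (fun x hx => Finset.mem_image_of_mem _ hx)]
    refine Finset.sum_congr rfl fun y hy => ?_
    congr 1
    ext x
    simp only [Finset.mem_filter, and_congr_right_iff]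
    intro hx
    constructor
    · intro h
      rw [← h, MulAction.orbit_eq_iff.2 (hrep x)]
      exact MulAction.mem_orbit_self _
    · intro h
      rw [hrep2 _ _ h, hR y hy]
  refine ⟨T.image rep, ?_, ?_, ?_, hfib, ?_⟩
  · intro y hy
    obtain ⟨x, hx, rfl⟩ := Finset.mem_image.1 hy
    exact hmem x hx
  · intro x hx
    exact ⟨rep x, Finset.mem_image_of_mem _ hx, hrep x⟩
  · intro x hx y hy h
    rw [← hR x hx, ← hR y hy, hrep2 _ _ h]
  · rw [Finset.card_eq_sum_ones, hfib]
    refine Finset.sum_congr rfl fun y hy => ?_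
    rw [← Finset.card_eq_sum_ones, ← Set.ncard_coe_finset]
    congr 1
    ext x
    simp only [Finset.coe_filter, Set.mem_ofPred_eq, and_iff_right_iff_imp]
    rintro ⟨g, rfl⟩
    obtain ⟨z, hz, rfl⟩ := Finset.mem_image.1 hy
    exact hT g _ (hmem z hz)

open Classical in
/-- Burnside counting on a finite invariant set, with transversal. -/
lemma burnside (T : Finset X) (hT : ∀ (g : Γ), ∀ x ∈ T, g • x ∈ T) :
    ∃ R ⊆ T, (∀ x ∈ T, ∃ y ∈ R, y ∈ MulAction.orbit Γ x) ∧
      (∀ x ∈ R, ∀ y ∈ R, y ∈ MulAction.orbit Γ x → y = x) ∧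
      T.card = ∑ y ∈ R, (MulAction.orbit Γ y).ncard ∧
      ∑ x ∈ T, Nat.card (MulAction.stabilizer Γ x) = R.card * Nat.card Γ := by
  obtain ⟨R, hRT, h1, h2, h3, h4⟩ := exists_transversal (Γ := Γ) T hT
  refine ⟨R, hRT, h1, h2, h4, ?_⟩
  rw [h3, Finset.card_eq_sum_ones, Finset.sum_mul]
  refine Finset.sum_congr rfl fun y hy => ?_
  rw [one_mul, ← card_orbit_stab y]
  have : ∀ x ∈ T.filter (· ∈ MulAction.orbit Γ y), Nat.card (MulAction.stabilizer Γ x) =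
      Nat.card (MulAction.stabilizer Γ y) := by
    intro x hx
    obtain ⟨g, hg⟩ := (Finset.mem_filter.1 hx).2
    have hg : g • y = x := hg
    rw [← hg]
    exact (Nat.card_congr (MulAction.stabilizerEquivStabilizer (g := g) rfl).toEquiv).symm
  rw [Finset.sum_congr rfl this, Finset.sum_const, smul_eq_mul]
  congr 1
  rw [← Set.ncard_coe_finset]
  congr 1
  ext x
  simp only [Finset.coe_filter, Set.mem_ofPred_eq, and_iff_right_iff_imp]
  rintro ⟨g, rfl⟩
  exact hT g _ (hRT hy)

open Classical in
/-- sum over the points of the orders of stabilizers, counted over the group -/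
lemma sum_stab_eq (T : Finset X) [Fintype Γ] :
    ∑ x ∈ T, Nat.card (MulAction.stabilizer Γ x) = ∑ g : Γ, (T.filter (fun x => g • x = x)).card := by
  have : ∀ x : X, Nat.card (MulAction.stabilizer Γ x) =
      ∑ g : Γ, if g • x = x then 1 else 0 := by
    intro x
    rw [Finset.sum_boole, Nat.cast_id, Nat.card_eq_fintype_card, Fintype.card_subtype]
    rfl
  simp only [this]
  rw [Finset.sum_comm]
  refine Finset.sum_congr rfl fun g _ => ?_
  rw [Finset.sum_boole, Nat.cast_id]

end Orb

/-- abstract properties of the action of (a subgroup of) `PSL₂(q)` on a projective line -/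
structure Act (Γ X K : Type) [Group Γ] [MulAction Γ X] [Field K] (p : ℕ) (χ : X → Γ → K) :
    Prop where
  one : ∀ x, χ x 1 = 1
  mul : ∀ x h k, h • x = x → k • x = x → χ x (h * k) = χ x h * χ x k
  uni : ∀ x h, h • x = x → χ x h = 1 → h ≠ 1 → ∀ y, h • y = y → y = x
  two : ∀ x h, h • x = x → χ x h ≠ 1 → ∃ y, y ≠ x ∧ ∀ z, h • z = z ↔ z = x ∨ z = y
  comm : ∀ x h k, h • x = x → k • x = x → χ x h = 1 → χ x k = 1 → h * k = k * h
  exp : ∀ x h, h • x = x → χ x h = 1 → h ^ p = 1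
  fix : ∀ h : Γ, ∃ x : X, h • x = x

section ActSec
variable {Γ : Type} [Group Γ] [Finite Γ] {X : Type} [MulAction Γ X] {K : Type} [Field K]
  {p : ℕ} {χ : X → Γ → K}

lemma Act.sub (A : Act Γ X K p χ) (H : Subgroup Γ) :
    Act H X K p (fun x h => χ x (h : Γ)) where
  one x := A.one x
  mul x h k := A.mul x h k
  uni x h h1 h2 h3 := A.uni x h h1 h2 (fun h => h3 (Subtype.ext h))
  two x h := A.two x h
  comm x h k h1 h2 h3 h4 := Subtype.ext (A.comm x h k h1 h2 h3 h4)
  exp x h h1 h2 := Subtype.ext (A.exp x h h1 h2)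
  fix h := A.fix h

lemma Act.inv_mul (A : Act Γ X K p χ) {x : X} {h : Γ} (hx : h • x = x) :
    χ x h⁻¹ * χ x h = 1 := by
  rw [← A.mul x _ _ (by rw [inv_smul_eq_iff, hx]) hx, inv_mul_cancel, A.one]

/-- the character of a point stabilizer -/
noncomputable def Act.hom (A : Act Γ X K p χ) (x : X) : MulAction.stabilizer Γ x →* Kˣ where
  toFun h := ⟨χ x h, χ x (h : Γ)⁻¹, by rw [mul_comm, A.inv_mul h.2], A.inv_mul h.2⟩
  map_one' := Units.ext (A.one x)
  map_mul' h k := Units.ext (A.mul x h k h.2 k.2)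

lemma Act.hom_val (A : Act Γ X K p χ) (x : X) (h : MulAction.stabilizer Γ x) :
    ((A.hom x h : Kˣ) : K) = χ x h := rfl

/-- the unipotent part of a point stabilizer -/
noncomputable def Act.P (A : Act Γ X K p χ) (x : X) : Subgroup Γ :=
  (A.hom x).ker.map (MulAction.stabilizer Γ x).subtype

lemma Act.mem_P (A : Act Γ X K p χ) {x : X} {h : Γ} : h ∈ A.P x ↔ h • x = x ∧ χ x h = 1 := by
  constructor
  · rintro ⟨⟨h, hx⟩, h1, rfl⟩
    refine ⟨hx, ?_⟩
    have := congrArg Units.val (MonoidHom.mem_ker.1 h1)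
    exact this
  · rintro ⟨h1, h2⟩
    exact ⟨⟨h, h1⟩, MonoidHom.mem_ker.2 (Units.ext h2), rfl⟩

lemma Act.P_le (A : Act Γ X K p χ) (x : X) : A.P x ≤ MulAction.stabilizer Γ x :=
  fun _ h => (A.mem_P.1 h).1

lemma Act.fix_set (A : Act Γ X K p χ) {h : Γ} (h1 : h ≠ 1) :
    (∃ x, h ∈ A.P x ∧ ∀ z, h • z = z ↔ z = x) ∨
    ((∀ x, h ∉ A.P x) ∧ ∃ x y : X, y ≠ x ∧ ∀ z, h • z = z ↔ z = x ∨ z = y) := by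
  by_cases hu : ∃ x, h ∈ A.P x
  · left
    obtain ⟨x, hx⟩ := hu
    have hx' := A.mem_P.1 hx
    exact ⟨x, hx, fun z => ⟨fun hz => A.uni x h hx'.1 hx'.2 h1 z hz, fun hz => hz ▸ hx'.1⟩⟩
  · right
    push Not at hu
    refine ⟨hu, ?_⟩
    obtain ⟨x, hx⟩ := A.fix h
    obtain ⟨y, hy⟩ := A.two x h hx (fun h => hu x (A.mem_P.2 ⟨hx, h⟩))
    exact ⟨x, y, hy⟩

lemma Act.fix_finite (A : Act Γ X K p χ) {h : Γ} (h1 : h ≠ 1) : {z : X | h • z = z}.Finite := by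
  rcases A.fix_set h1 with ⟨x, -, hx⟩ | ⟨-, x, y, -, hx⟩
  · refine Set.Finite.subset (Set.finite_singleton x) fun z hz => (hx z).1 hz
  · refine Set.Finite.subset (Set.toFinite {x, y}) fun z hz => ?_
    have := (hx z).1 hz
    simpa using this

lemma Act.S_finite (A : Act Γ X K p χ) : {z : X | ∃ h : Γ, h ≠ 1 ∧ h • z = z}.Finite := by
  have : {z : X | ∃ h : Γ, h ≠ 1 ∧ h • z = z} = ⋃ h : {h : Γ // h ≠ 1}, {z : X | h.1 • z = z} := by
    ext z; simp [Set.mem_iUnion]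
  rw [this]
  exact Set.finite_iUnion fun h => A.fix_finite h.2

open Classical in
/-- points with nontrivial stabilizer -/
lemma Act.exists_S (A : Act Γ X K p χ) : ∃ S : Finset X,
    (∀ z, z ∈ S ↔ ∃ h : Γ, h ≠ 1 ∧ h • z = z) ∧ (∀ (g : Γ), ∀ x ∈ S, g • x ∈ S) ∧
    (∀ h : Γ, h ≠ 1 → (∃ x, h ∈ A.P x) → (S.filter (fun x => h • x = x)).card = 1) ∧
    (∀ h : Γ, h ≠ 1 → (¬ ∃ x, h ∈ A.P x) → (S.filter (fun x => h • x = x)).card = 2) ∧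
    ∀ x ∈ S, 2 ≤ Nat.card (MulAction.stabilizer Γ x) := by
  have hS : ∀ z, z ∈ A.S_finite.toFinset ↔ ∃ h : Γ, h ≠ 1 ∧ h • z = z := fun z => by
    rw [Set.Finite.mem_toFinset]; rfl
  refine ⟨A.S_finite.toFinset, hS, ?_, ?_, ?_, ?_⟩
  · intro g x hx
    rw [hS] at hx ⊢
    obtain ⟨h, h1, h2⟩ := hx
    refine ⟨g * h * g⁻¹, fun h3 => h1 ?_, ?_⟩
    · have : h = g⁻¹ * (g * h * g⁻¹) * g := by group
      rw [this, h3]; group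
    · rw [mul_smul, inv_smul_smul, mul_smul, h2]
  · intro h h1 hu
    rcases A.fix_set h1 with ⟨x, -, hx⟩ | ⟨h3, -⟩
    · rw [Finset.card_eq_one]
      refine ⟨x, ?_⟩
      ext z
      rw [Finset.mem_filter, hS, hx, Finset.mem_singleton]
      exact ⟨fun h => h.2, fun hz => ⟨⟨h, h1, (hx z).2 hz⟩, hz⟩⟩
    · obtain ⟨x, hx⟩ := hu
      exact absurd hx (h3 x)
  · intro h h1 hu
    rcases A.fix_set h1 with ⟨x, h3, hx⟩ | ⟨-, x, y, hxy, hx⟩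
    · exact absurd ⟨x, h3⟩ hu
    · rw [Finset.card_eq_two]
      refine ⟨x, y, hxy.symm, ?_⟩
      ext z
      rw [Finset.mem_filter, hS, hx, Finset.mem_insert, Finset.mem_singleton]
      exact ⟨fun h => h.2, fun hz => ⟨⟨h, h1, (hx z).2 hz⟩, hz⟩⟩
  · intro x hx
    rw [hS] at hx
    obtain ⟨h, h1, h2⟩ := hx
    have : Nontrivial (MulAction.stabilizer Γ x) :=
      ⟨⟨h, h2⟩, 1, fun h3 => h1 (congrArg Subtype.val h3)⟩
    exact Finite.one_lt_card

/-- an element commuting with a nontrivial unipotent is unipotent -/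
lemma Act.centralizer (A : Act Γ X K p χ) {x : X} {u h : Γ} (hu : u ∈ A.P x) (hu1 : u ≠ 1)
    (hc : h * u = u * h) : h ∈ A.P x := by
  have hux := A.mem_P.1 hu
  have huniq := A.uni x u hux.1 hux.2 hu1
  have hhx : h • x = x := huniq _ (by rw [← mul_smul, ← hc, mul_smul, hux.1])
  by_contra hP
  obtain ⟨y, hyx, hy⟩ := A.two x h hhx (fun h1 => hP (A.mem_P.2 ⟨hhx, h1⟩))
  have h1 : h • (u • y) = u • y := by
    rw [← mul_smul, hc, mul_smul, (hy y).2 (Or.inr rfl)]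
  rcases (hy _).1 h1 with h2 | h2
  · apply hyx
    have : u • y = u • x := by rw [h2, hux.1]
    exact (MulAction.injective u) this
  · exact hyx (huniq y h2)

/-- abelian groups have small orbits -/
lemma Act.abel (A : Act Γ X K p χ) (hab : ∀ a b : Γ, a * b = b * a) {x : X}
    (hx : ∃ h : Γ, h ≠ 1 ∧ h • x = x) : (MulAction.orbit Γ x).ncard ≤ 2 := by
  obtain ⟨h, h1, h2⟩ := hx
  have hsub : MulAction.orbit Γ x ⊆ {z | h • z = z} := by
    rintro _ ⟨g, rfl⟩
    show h • (g • x) = g • x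
    rw [← mul_smul, hab, mul_smul, h2]
  refine (Set.ncard_le_ncard hsub (A.fix_finite h1)).trans ?_
  rcases A.fix_set h1 with ⟨x, -, hx⟩ | ⟨-, x, y, -, hx⟩
  · have : {z : X | h • z = z} = {x} := by ext z; exact hx z
    rw [this, Set.ncard_singleton]; norm_num
  · have : {z : X | h • z = z} = {x, y} := by ext z; exact hx z
    rw [this]; exact (Set.ncard_insert_le x {y}).trans (by rw [Set.ncard_singleton])

lemma arith3 {g n1 n2 n3 s1 s2 s3 : ℕ} (hg : 0 < g) (h1 : s1 * n1 = g) (h2 : s2 * n2 = g)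
    (h3 : s3 * n3 = g) (hn1 : 2 ≤ n1) (hn2 : 2 ≤ n2) (hn3 : 2 ≤ n3) (hs : s1 + s2 + s3 = g + 2)
    (h12 : s2 ≤ s1) (h23 : s3 ≤ s2) : (2 * n3 = g) ∨ g = 12 ∨ g = 24 ∨ g = 60 := by
  have hn1' : n1 = 2 := by
    by_contra h
    have : 3 ≤ n1 := by omega
    nlinarith
  subst hn1'
  have hn2' : n2 < 4 := by
    by_contra h
    have : 4 ≤ n2 := by omega
    nlinarith
  interval_cases n2
  · left
    have : s3 = 2 := by omega
    rw [this] at h3; omega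
  · right
    obtain ⟨k, hk⟩ : ∃ k, s2 = 2 * k := ⟨s2 / 2, by omega⟩
    have hs1 : s1 = 3 * k := by omega
    have hs3 : s3 = k + 2 := by omega
    have hn6 : n3 < 6 := by
      by_contra h
      have : 6 ≤ n3 := by omega
      subst hs3
      nlinarith
    subst hs3
    interval_cases n3 <;> omega

open Classical in
theorem Act.class_prime_to (A : Act Γ X K p χ) (hpp : p.Prime)
    (hp : ¬ p ∣ Nat.card Γ) :
    (∃ x : X, ∀ h : Γ, h • x = x) ∨
    (∃ x : X, 2 * Nat.card (MulAction.stabilizer Γ x) = Nat.card Γ ∧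
      (4 < Nat.card Γ → ∃ a b : Γ, a * b ≠ b * a)) ∨
    ((Nat.card Γ = 12 ∨ Nat.card Γ = 24 ∨ Nat.card Γ = 60) ∧ ∃ a b : Γ, a * b ≠ b * a) := by
  have := Fintype.ofFinite Γ
  obtain ⟨S, hS, hSi, -, hS2, hSn⟩ := A.exists_S
  have hnu : ∀ h : Γ, h ≠ 1 → ¬ ∃ x, h ∈ A.P x := by
    rintro h h1 ⟨x, hx⟩
    have hx' := A.mem_P.1 hx
    have := orderOf_eq_prime (p := p) (hp := ⟨hpp⟩) (A.exp x h hx'.1 hx'.2) h1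
    exact hp (this ▸ orderOf_dvd_natCard h)
  obtain ⟨R, hRS, hR1, hR2, hRc, hRb⟩ := burnside (Γ := Γ) S hSi
  set g := Nat.card Γ with hg
  have hg0 : 0 < g := Nat.card_pos
  by_cases hg1 : g = 1
  · left
    obtain ⟨x, hx⟩ := A.fix 1
    have := (Nat.card_eq_one_iff_unique.1 hg1).1
    exact ⟨x, fun h => by rw [Subsingleton.elim h 1, one_smul]⟩
  have hsum : S.card + 2 * (g - 1) = R.card * g := by
    rw [← hRb, sum_stab_eq, ← Finset.add_sum_erase _ _ (Finset.mem_univ (1 : Γ))]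
    have e1 : (S.filter (fun x => (1 : Γ) • x = x)).card = S.card := by simp
    have e2 : ∀ h ∈ Finset.univ.erase (1 : Γ), (S.filter (fun x => h • x = x)).card = 2 :=
      fun h hh => hS2 h (Finset.ne_of_mem_erase hh) (hnu h (Finset.ne_of_mem_erase hh))
    rw [e1, Finset.sum_congr rfl e2, Finset.sum_const, Finset.card_erase_of_mem (Finset.mem_univ _),
      Finset.card_univ, ← Nat.card_eq_fintype_card, smul_eq_mul]
    ring
  have hos : ∀ y ∈ R, 2 * (MulAction.orbit Γ y).ncard ≤ g := by
    intro y hy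
    have h1 := card_orbit_stab (Γ := Γ) y
    have h2 := hSn y (hRS hy)
    nlinarith
  have hSle : 2 * S.card ≤ R.card * g := by
    rw [hRc, Finset.mul_sum]
    calc _ ≤ ∑ y ∈ R, g := Finset.sum_le_sum hos
      _ = _ := by rw [Finset.sum_const, smul_eq_mul]
  have hr4 : R.card < 4 := by
    by_contra h
    have : 4 ≤ R.card := by omega
    have h2 : 4 * g ≤ R.card * g := Nat.mul_le_mul_right _ this
    omega
  have hS2' : 2 ≤ S.card := by
    have : Nontrivial Γ := Finite.one_lt_card_iff_nontrivial.1 (by omega)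
    obtain ⟨h, hh⟩ := exists_ne (1 : Γ)
    rw [← hS2 h hh (hnu h hh)]
    exact Finset.card_filter_le _ _
  have hr2 : 2 ≤ R.card := by
    by_contra h
    have : R.card ≤ 1 := by omega
    have h2 : R.card * g ≤ 1 * g := Nat.mul_le_mul_right _ this
    omega
  have hpos : ∀ y : X, 0 < (MulAction.orbit Γ y).ncard := fun y => by
    have h1 := card_orbit_stab (Γ := Γ) y
    rw [← hg] at h1
    by_contra h0
    have : (MulAction.orbit Γ y).ncard = 0 := by omega
    rw [this] at h1; omega
  have hcase : R.card = 2 ∨ R.card = 3 := by omega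
  rcases hcase with hr | hr
  · left
    obtain ⟨x, y, hxy, rfl⟩ := Finset.card_eq_two.1 hr
    rw [Finset.sum_pair hxy] at hRc
    rw [hr] at hsum
    have hx1 : (MulAction.orbit Γ x).ncard = 1 := by
      have := hpos x; have := hpos y; omega
    refine ⟨x, fun h => ?_⟩
    obtain ⟨a, ha⟩ := Set.ncard_eq_one.1 hx1
    have h1 : x ∈ MulAction.orbit Γ x := MulAction.mem_orbit_self x
    have h2 : h • x ∈ MulAction.orbit Γ x := MulAction.mem_orbit x h
    rw [ha] at h1 h2
    rw [Set.mem_singleton_iff] at h1 h2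
    rw [h2, h1]
  · right
    have hSg : S.card = g + 2 := by rw [hr] at hsum; omega
    have hna : 4 < g → ∃ a b : Γ, a * b ≠ b * a := by
      intro h4
      by_contra hab
      push Not at hab
      have : S.card ≤ ∑ y ∈ R, 2 := by
        rw [hRc]
        exact Finset.sum_le_sum fun y hy => A.abel hab ((hS y).1 (hRS hy))
      rw [Finset.sum_const, hr, smul_eq_mul] at this
      omega
    obtain ⟨x1, x2, x3, h12, h13, h23, rfl⟩ := Finset.card_eq_three.1 hr
    have hsum3 : (MulAction.orbit Γ x1).ncard + (MulAction.orbit Γ x2).ncard +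
        (MulAction.orbit Γ x3).ncard = g + 2 := by
      rw [← hSg, hRc, Finset.sum_insert (by simp [h12, h13]), Finset.sum_pair h23, add_assoc]
    have key : ∀ y1 y2 y3, y1 ∈ S → y2 ∈ S → y3 ∈ S → (MulAction.orbit Γ y1).ncard +
        (MulAction.orbit Γ y2).ncard + (MulAction.orbit Γ y3).ncard = g + 2 →
        (MulAction.orbit Γ y2).ncard ≤ (MulAction.orbit Γ y1).ncard →
        (MulAction.orbit Γ y3).ncard ≤ (MulAction.orbit Γ y2).ncard →
        (∃ x : X, 2 * Nat.card (MulAction.stabilizer Γ x) = g ∧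
          (4 < g → ∃ a b : Γ, a * b ≠ b * a)) ∨
        ((g = 12 ∨ g = 24 ∨ g = 60) ∧ ∃ a b : Γ, a * b ≠ b * a) := by
      intro y1 y2 y3 hy1 hy2 hy3 h h12 h23
      rcases arith3 hg0 (card_orbit_stab y1) (card_orbit_stab y2) (card_orbit_stab y3)
        (hSn _ hy1) (hSn _ hy2) (hSn _ hy3) h h12 h23 with h | h
      · exact Or.inl ⟨y3, h, hna⟩
      · exact Or.inr ⟨h, hna (by omega)⟩
    have m1 : x1 ∈ S := hRS (by simp)
    have m2 : x2 ∈ S := hRS (by simp)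
    have m3 : x3 ∈ S := hRS (by simp)
    rcases le_total (MulAction.orbit Γ x1).ncard (MulAction.orbit Γ x2).ncard with a | a <;>
    rcases le_total (MulAction.orbit Γ x2).ncard (MulAction.orbit Γ x3).ncard with b | b <;>
    rcases le_total (MulAction.orbit Γ x1).ncard (MulAction.orbit Γ x3).ncard with c | c
    · exact key x3 x2 x1 m3 m2 m1 (by omega) b a
    · exact key x3 x2 x1 m3 m2 m1 (by omega) b a
    · exact key x2 x3 x1 m2 m3 m1 (by omega) b c
    · exact key x2 x1 x3 m2 m1 m3 (by omega) a c
    · exact key x3 x1 x2 m3 m1 m2 (by omega) c a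
    · exact key x1 x3 x2 m1 m3 m2 (by omega) c b
    · exact key x1 x2 x3 m1 m2 m3 (by omega) a b
    · exact key x1 x2 x3 m1 m2 m3 (by omega) a b

end ActSec

section ActSec
variable {Γ : Type} [Group Γ] [Finite Γ] {X : Type} [MulAction Γ X] {K : Type} [Field K]
  {p : ℕ} {χ : X → Γ → K}

lemma card_stab_const {A Y : Type} [Group A] [Finite A] [MulAction A Y] (T : Finset Y)
    (hT : ∀ (g : A), ∀ x ∈ T, g • x ∈ T) (m : ℕ)
    (hm : ∀ x ∈ T, Nat.card (MulAction.stabilizer A x) = m) : ∃ r, T.card * m = r * Nat.card A := by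
  obtain ⟨R, -, -, -, -, h⟩ := burnside (Γ := A) T hT
  rw [Finset.sum_congr rfl hm, Finset.sum_const, smul_eq_mul] at h
  exact ⟨_, h⟩

lemma Act.mem_P_iff (A : Act Γ X K p χ) {x : X} {h : Γ} (h1 : h ≠ 1) :
    h ∈ A.P x ↔ ∀ z, h • z = z ↔ z = x := by
  constructor
  · intro hP z
    have hx' := A.mem_P.1 hP
    exact ⟨fun hz => A.uni x h hx'.1 hx'.2 h1 z hz, fun hz => hz ▸ hx'.1⟩
  · intro hz
    rcases A.fix_set h1 with ⟨y, hy, hy'⟩ | ⟨-, y, z, hyz, hy'⟩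
    · have : y = x := by rw [← hz, hy']
      exact this ▸ hy
    · exfalso
      apply hyz
      rw [(hz y).1 ((hy' y).2 (Or.inl rfl)), (hz z).1 ((hy' z).2 (Or.inr rfl))]

lemma Act.conj_P (A : Act Γ X K p χ) {x : X} (g u : Γ) :
    g * u * g⁻¹ ∈ A.P (g • x) ↔ u ∈ A.P x := by
  by_cases hu : u = 1
  · subst hu; simp [one_mem]
  · have hu' : g * u * g⁻¹ ≠ 1 := fun h => hu (by
      have : u = g⁻¹ * (g * u * g⁻¹) * g := by group
      rw [this, h]; group)
    rw [A.mem_P_iff hu, A.mem_P_iff hu']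
    constructor
    · intro h z
      have := h (g • z)
      rw [mul_smul, inv_smul_smul, mul_smul, smul_left_cancel_iff, smul_left_cancel_iff] at this
      exact this
    · intro h z
      have := h (g⁻¹ • z)
      rw [← smul_left_cancel_iff g, smul_inv_smul, inv_smul_eq_iff, ← mul_smul, ← mul_smul] at this
      exact this

lemma Act.card_P (A : Act Γ X K p χ) {x : X} (g : Γ) :
    Nat.card (A.P (g • x)) = Nat.card (A.P x) := by
  symm
  refine Nat.card_congr ((MulAut.conj g).toEquiv.subtypeEquiv fun u => ?_)
  rw [← A.conj_P g]
  rfl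

lemma Act.p_dvd_P (A : Act Γ X K p χ) (hpp : p.Prime) {x : X} (h : A.P x ≠ ⊥) :
    p ∣ Nat.card (A.P x) := by
  obtain ⟨u, hu0⟩ := (A.P x).ne_bot_iff_exists_ne_one.1 h
  have hu1 : (u : Γ) ≠ 1 := fun h => hu0 (Subtype.ext h)
  have hu' := A.mem_P.1 u.2
  have := orderOf_eq_prime (p := p) (hp := ⟨hpp⟩) (A.exp x u hu'.1 hu'.2) hu1
  have h2 : orderOf (u : Γ) ∣ Nat.card (A.P x) := Subgroup.orderOf_dvd_natCard _ u.2
  exact (dvd_of_eq this.symm).trans h2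

lemma Act.exists_P (A : Act Γ X K p χ) [CharP K p] (hpp : p.Prime) (hp : p ∣ Nat.card Γ) :
    ∃ x, A.P x ≠ ⊥ := by
  have : Fact p.Prime := ⟨hpp⟩
  obtain ⟨u, hu⟩ := exists_prime_orderOf_dvd_card' p hp
  obtain ⟨x, hx⟩ := A.fix u
  refine ⟨x, fun h => ?_⟩
  have h1 : A.hom x ⟨u, hx⟩ ^ p = 1 := by
    rw [← map_pow]
    have : (⟨u, hx⟩ : MulAction.stabilizer Γ x) ^ p = 1 :=
      Subtype.ext (by rw [← hu]; exact pow_orderOf_eq_one u)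
    rw [this, map_one]
  have h2 : χ x u ^ p = 1 := by
    have := congrArg Units.val h1
    rw [Units.val_pow_eq_pow_val, A.hom_val] at this
    exact this
  have h3 : χ x u = 1 := by
    have h4 : (χ x u - 1) ^ p = 0 := by rw [sub_pow_char, h2, one_pow, sub_self]
    exact sub_eq_zero.1 (pow_eq_zero_iff hpp.ne_zero |>.1 h4)
  have h5 : u ∈ A.P x := A.mem_P.2 ⟨hx, h3⟩
  rw [h, Subgroup.mem_bot] at h5
  rw [h5, orderOf_one] at hu
  exact hpp.one_lt.ne hu

open Classical in
lemma Act.P_count (A : Act Γ X K p χ) {x : X} (T : Finset X)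
    (hT : ∀ (g : Γ), ∀ x ∈ T, g • x ∈ T) :
    (x ∈ T → ∃ r, T.card + (Nat.card (A.P x) - 1) = r * Nat.card (A.P x)) ∧
    (x ∉ T → ∃ r, T.card = r * Nat.card (A.P x)) := by
  have := Fintype.ofFinite Γ
  have := Fintype.ofFinite (A.P x)
  obtain ⟨R, -, -, -, -, h⟩ := burnside (Γ := A.P x) T (fun g y hy => hT g y hy)
  rw [sum_stab_eq, ← Finset.add_sum_erase _ _ (Finset.mem_univ (1 : A.P x))] at h
  have e1 : (T.filter (fun x => (1 : A.P x) • x = x)).card = T.card := by simp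
  have key : ∀ u ∈ Finset.univ.erase (1 : A.P x), (T.filter (fun y => u • y = y)) =
      if x ∈ T then {x} else ∅ := by
    intro u hu
    have hu1 : (u : Γ) ≠ 1 := fun h => Finset.ne_of_mem_erase hu (Subtype.ext h)
    have := (A.mem_P_iff hu1).1 u.2
    ext y
    rw [Finset.mem_filter]
    have h2 : u • y = y ↔ y = x := this y
    rw [h2]
    split_ifs with hx
    · rw [Finset.mem_singleton]
      exact ⟨fun h => h.2, fun h => ⟨h ▸ hx, h⟩⟩
    · constructor
      · rintro ⟨h3, rfl⟩; exact absurd h3 hx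
      · intro h; simp at h
  have hfc : ∑ u ∈ Finset.univ.erase (1 : A.P x), (T.filter (fun y => u • y = y)).card =
      (Nat.card (A.P x) - 1) * (if x ∈ T then 1 else 0) := by
    rw [Finset.sum_congr rfl (fun u hu => by rw [key u hu]), Finset.sum_const,
      Finset.card_erase_of_mem (Finset.mem_univ _), Finset.card_univ, Nat.card_eq_fintype_card,
      smul_eq_mul]
    congr 1
    split_ifs <;> simp
  rw [hfc] at h
  constructor
  · intro hx
    rw [if_pos hx, mul_one] at h
    exact ⟨R.card, by rw [← h]; congr 1; simp⟩
  · intro hx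
    rw [if_neg hx, mul_zero, add_zero] at h
    exact ⟨R.card, by rw [← h]; simp⟩

lemma orbit_finite (x : X) : (MulAction.orbit Γ x).Finite := Set.finite_range _

lemma Act.single_orbit (A : Act Γ X K p χ) (hpp : p.Prime) {x y : X} (hx : A.P x ≠ ⊥)
    (hy : A.P y ≠ ⊥) : y ∈ MulAction.orbit Γ x := by
  by_contra hn
  set T := (orbit_finite (Γ := Γ) x).toFinset with hTd
  have hm : ∀ z, z ∈ T ↔ z ∈ MulAction.orbit Γ x := fun z => Set.Finite.mem_toFinset _
  have hT : ∀ (g : Γ), ∀ z ∈ T, g • z ∈ T := by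
    intro g z hz
    rw [hm] at hz ⊢
    obtain ⟨k, rfl⟩ := hz
    exact ⟨g * k, mul_smul _ _ _⟩
  obtain ⟨r, hr⟩ := (A.P_count (x := x) T hT).1 ((hm x).2 (MulAction.mem_orbit_self x))
  obtain ⟨r', hr'⟩ := (A.P_count (x := y) T hT).2 (fun h => hn ((hm y).1 h))
  have h1 := A.p_dvd_P hpp hx
  have h2 := A.p_dvd_P hpp hy
  have h3 : p ∣ T.card := hr' ▸ dvd_mul_of_dvd_right h2 _
  have h4 : p ∣ T.card + (Nat.card (A.P x) - 1) := hr ▸ dvd_mul_of_dvd_right h1 _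
  have h5 := (Nat.dvd_add_right h3).1 h4
  have h6 : 0 < Nat.card (A.P x) := Nat.card_pos
  have h7 : p ∣ 1 := by
    have := Nat.dvd_sub h1 h5
    rwa [Nat.sub_sub_self h6] at this
  exact hpp.one_lt.ne' (Nat.dvd_one.1 h7)

lemma Act.P_normal (A : Act Γ X K p χ) {x : X} {h : Γ} (hx : h • x = x) : Nrm (A.P x) h := by
  intro k
  have := A.conj_P (x := x) h k
  rw [hx] at this
  exact this.symm

lemma Act.card_stab (A : Act Γ X K p χ) (x : X) :
    Nat.card (A.P x) * (A.P x).relIndex (MulAction.stabilizer Γ x) =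
      Nat.card (MulAction.stabilizer Γ x) := by
  rw [← Subgroup.relIndex_bot_left, Subgroup.relIndex_mul_relIndex _ _ _ bot_le (A.P_le x),
    Subgroup.relIndex_bot_left]

open Classical in
lemma Act.c_dvd (A : Act Γ X K p χ) (x : X) :
    (A.P x).relIndex (MulAction.stabilizer Γ x) ∣ Nat.card (A.P x) - 1 := by
  have := Fintype.ofFinite Γ
  let B : Subgroup (ConjAct Γ) := (MulAction.stabilizer Γ x).map
    (ConjAct.toConjAct (G := Γ)).toMonoidHom
  have hB : ∀ b : ConjAct Γ, b ∈ B ↔ (ConjAct.ofConjAct b) • x = x := by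
    intro b
    constructor
    · rintro ⟨g, hg, rfl⟩; exact hg
    · intro h; exact ⟨ConjAct.ofConjAct b, h, rfl⟩
  have hBc : Nat.card B = Nat.card (MulAction.stabilizer Γ x) :=
    (Nat.card_congr ((MulAction.stabilizer Γ x).equivMapOfInjective _
      (ConjAct.toConjAct (G := Γ)).injective).toEquiv).symm
  let T : Finset Γ := Finset.univ.filter (fun u => u ∈ A.P x ∧ u ≠ 1)
  have hT : ∀ (b : B), ∀ u ∈ T, b • u ∈ T := by
    intro b u hu
    simp only [T, Finset.mem_filter, Finset.mem_univ, true_and] at hu ⊢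
    have e : b • u = ConjAct.ofConjAct (b : ConjAct Γ) * u * (ConjAct.ofConjAct (b : ConjAct Γ))⁻¹ :=
      rfl
    rw [e]
    refine ⟨((A.P_normal ((hB b).1 b.2)) u).1 hu.1, fun h => hu.2 ?_⟩
    rwa [mul_inv_eq_one, mul_eq_left] at h
  have hm : ∀ u ∈ T, Nat.card (MulAction.stabilizer B u) = Nat.card (A.P x) := by
    intro u hu
    simp only [T, Finset.mem_filter, Finset.mem_univ, true_and] at hu
    have e : ∀ b : B, b • u =
        ConjAct.ofConjAct (b : ConjAct Γ) * u * (ConjAct.ofConjAct (b : ConjAct Γ))⁻¹ :=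
      fun _ => rfl
    refine Nat.card_congr ⟨fun b => ⟨ConjAct.ofConjAct (b.1 : ConjAct Γ), ?_⟩,
      fun v => ⟨⟨ConjAct.toConjAct (v : Γ), ?_⟩, ?_⟩, ?_, ?_⟩
    · have h1 : b.1 • u = u := b.2
      rw [e, mul_inv_eq_iff_eq_mul] at h1
      exact A.centralizer hu.1 hu.2 h1
    · rw [hB]; exact (A.mem_P.1 v.2).1
    · rw [MulAction.mem_stabilizer_iff, e]
      show (v : Γ) * u * (v : Γ)⁻¹ = u
      have h1 := A.mem_P.1 v.2
      have h2 := A.mem_P.1 hu.1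
      rw [A.comm x v u h1.1 h2.1 h1.2 h2.2]; group
    · intro b; rfl
    · intro v; rfl
  obtain ⟨r, hr⟩ := card_stab_const T hT _ hm
  have hTc : T.card = Nat.card (A.P x) - 1 := by
    have h1 : T = (Finset.univ.filter (fun u => u ∈ A.P x)).erase 1 := by
      ext u
      simp [T, and_comm]
    rw [h1, Finset.card_erase_of_mem (by simp [one_mem]), Nat.card_eq_fintype_card,
      Fintype.card_subtype]
  rw [hBc, ← A.card_stab x, hTc] at hr
  refine ⟨r, ?_⟩
  have hQ : 0 < Nat.card (A.P x) := Nat.card_pos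
  apply Nat.eq_of_mul_eq_mul_right hQ
  rw [hr]; ring

lemma arith_div {Q c k n : ℕ} (hQ : 3 ≤ Q) (hk : 1 ≤ k) (hc : c ∣ Q - 1)
    (h : n * (1 + k * (Q - 2)) = (1 + k * Q) * c) :
    (k = 1 ∧ (c = Q - 1 ∨ 2 * c = Q - 1)) ∨ (k = 3 ∧ Q = 3 ∧ c = 2) := by
  obtain ⟨m, rfl⟩ : ∃ m, Q = m + 2 := ⟨Q - 2, by omega⟩
  simp only [Nat.add_sub_cancel] at h
  have e1 : m + 2 - 1 = m + 1 := by omega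
  rw [e1] at hc ⊢
  have hcpos : 0 < c := Nat.pos_of_dvd_of_pos hc (by omega)
  have hcle := Nat.le_of_dvd (by omega) hc
  have hD : (1 + k * m) ∣ k * (2 * c) := by
    have h1 : (1 + k * m) ∣ (1 + k * m) * c + k * (2 * c) := ⟨n, by
      rw [mul_comm (1 + k * m) n, h]; ring⟩
    exact (Nat.dvd_add_right (dvd_mul_right _ _)).1 h1
  have hcop : Nat.Coprime (1 + k * m) k := by
    rw [Nat.coprime_iff_gcd_eq_one, Nat.gcd_comm, Nat.gcd_add_mul_left_right, Nat.gcd_one_right]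
  have hD2 : (1 + k * m) ∣ 2 * c := hcop.dvd_of_dvd_mul_left hD
  have hDle := Nat.le_of_dvd (by omega) hD2
  have hk4 : k < 4 := by
    by_contra h4
    have : 4 ≤ k := by omega
    have : 4 * m ≤ k * m := Nat.mul_le_mul_right _ this
    omega
  interval_cases k
  · left
    refine ⟨rfl, ?_⟩
    obtain ⟨a, ha⟩ := hD2
    obtain ⟨b, hb⟩ := hc
    have hab : a * b = 2 := by
      have h1 : c * 2 = c * (a * b) := by
        calc c * 2 = (1 + 1 * m) * a := by rw [← ha]; ring
          _ = (m + 1) * a := by ring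
          _ = c * (a * b) := by rw [hb]; ring
      exact (Nat.eq_of_mul_eq_mul_left hcpos h1).symm
    have ha2 : a ≤ 2 := Nat.le_of_dvd (by norm_num) ⟨b, hab.symm⟩
    interval_cases a
    · omega
    · right; omega
    · left; omega
  · exfalso
    have hodd : Nat.Coprime (1 + 2 * m) 2 := by
      rw [Nat.coprime_two_right]; exact ⟨m, by ring⟩
    have := Nat.le_of_dvd hcpos (hodd.dvd_of_dvd_mul_left hD2)
    omega
  · right
    have : m = 1 := by omega
    subst this
    refine ⟨rfl, rfl, ?_⟩
    omega

lemma arith_orb {g Q k s : ℕ} (hg : 0 < g) (hQ : 3 ≤ Q)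
    (h : 2 * g + (1 + k * Q) * Q = (1 + k * Q) + s + (1 + k * Q) + 2 * (g - 1)) :
    s = Q * (1 + k * (Q - 2)) := by
  obtain ⟨m, rfl⟩ : ∃ m, Q = m + 2 := ⟨Q - 2, by omega⟩
  obtain ⟨g', rfl⟩ : ∃ g', g = g' + 1 := ⟨g - 1, by omega⟩
  rw [Nat.add_sub_cancel] at *
  nlinarith

set_option maxHeartbeats 2000000 in
open Classical in
theorem Act.class_div (A : Act Γ X K p χ) (hpp : p.Prime) (hp3 : 3 ≤ p) {x : X}
    (hx : A.P x ≠ ⊥) :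
    (∀ h : Γ, h • x = x) ∨
    ((MulAction.orbit Γ x).ncard = Nat.card (A.P x) + 1 ∧
      ((A.P x).relIndex (MulAction.stabilizer Γ x) = Nat.card (A.P x) - 1 ∨
       2 * (A.P x).relIndex (MulAction.stabilizer Γ x) = Nat.card (A.P x) - 1)) ∨
    (Nat.card (A.P x) = 3 ∧ Nat.card Γ = 60) := by
  have := Fintype.ofFinite Γ
  obtain ⟨S, hS, hSi, hS1, hS2, hSn⟩ := A.exists_S
  obtain ⟨R, hRS, hR1, hR2, hRc, hRb⟩ := burnside (Γ := Γ) S hSi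
  set O := (orbit_finite (Γ := Γ) x).toFinset with hOd
  have hO : ∀ z, z ∈ O ↔ z ∈ MulAction.orbit Γ x := fun z => Set.Finite.mem_toFinset _
  have hOi : ∀ (g : Γ), ∀ z ∈ O, g • z ∈ O := by
    intro g z hz
    rw [hO] at hz ⊢
    obtain ⟨k, rfl⟩ := hz
    exact ⟨g * k, mul_smul _ _ _⟩
  obtain ⟨r, hr⟩ := (A.P_count (x := x) O hOi).1 ((hO x).2 (MulAction.mem_orbit_self x))
  set Q := Nat.card (A.P x) with hQ
  set c := (A.P x).relIndex (MulAction.stabilizer Γ x) with hc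
  set g := Nat.card Γ with hg
  have hpQ : p ∣ Q := A.p_dvd_P hpp hx
  have hQ0 : 0 < Q := Nat.card_pos
  have hQ3 : 3 ≤ Q := hp3.trans (Nat.le_of_dvd hQ0 hpQ)
  have hOc : O.card = (MulAction.orbit Γ x).ncard := by
    rw [← Set.ncard_coe_finset, hOd, Set.Finite.coe_toFinset]
  have hgc : O.card * (Q * c) = g := by
    rw [hOc, A.card_stab x, card_orbit_stab]
  have hg0 : 0 < g := Nat.card_pos
  have hN0 : 0 < O.card := Finset.card_pos.2 ⟨x, (hO x).2 (MulAction.mem_orbit_self x)⟩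
  obtain ⟨k, hk⟩ : ∃ k, O.card = 1 + k * Q := by
    have hr1 : 1 ≤ r := by
      by_contra h0
      have : r = 0 := by omega
      rw [this] at hr; omega
    refine ⟨r - 1, ?_⟩
    obtain ⟨r', rfl⟩ : ∃ r', r = r' + 1 := ⟨r - 1, by omega⟩
    rw [Nat.add_sub_cancel]
    rw [add_mul] at hr
    omega
  -- unipotent counting
  have hun : ∑ h : Γ, (O.filter (fun y => h ∈ A.P y)).card = O.card * Q := by
    have h1 : ∀ y ∈ O, ∑ h : Γ, (if h ∈ A.P y then 1 else 0) = Q := by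
      intro y hy
      obtain ⟨a, rfl⟩ := (hO y).1 hy
      rw [hQ, ← A.card_P (x := x) a, Finset.sum_boole, Nat.cast_id, Nat.card_eq_fintype_card,
        Fintype.card_subtype]
    rw [← smul_eq_mul, ← Finset.sum_const, ← Finset.sum_congr rfl h1, Finset.sum_comm]
    refine Finset.sum_congr rfl fun h _ => ?_
    rw [Finset.sum_boole, Nat.cast_id]
  have htot : ∀ h ∈ Finset.univ.erase (1 : Γ), (S.filter (fun x => h • x = x)).card +
      (O.filter (fun y => h ∈ A.P y)).card = 2 := by
    intro h hh
    have h1 := Finset.ne_of_mem_erase hh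
    by_cases hu : ∃ y, h ∈ A.P y
    · rw [hS1 h h1 hu]
      obtain ⟨y, hy⟩ := hu
      have : O.filter (fun y => h ∈ A.P y) = {y} := by
        ext z
        rw [Finset.mem_filter, Finset.mem_singleton, hO]
        constructor
        · rintro ⟨-, hz⟩
          exact ((A.mem_P_iff h1).1 hy z).1 (A.mem_P.1 hz).1
        · rintro rfl
          refine ⟨A.single_orbit hpp hx fun hb => h1 ?_, hy⟩
          rw [hb] at hy; simpa using hy
      rw [this, Finset.card_singleton]
    · rw [hS2 h h1 hu]
      have : O.filter (fun y => h ∈ A.P y) = ∅ := by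
        ext z
        simp only [Finset.mem_filter, Finset.notMem_empty, iff_false, not_and]
        exact fun _ hz => hu ⟨z, hz⟩
      rw [this, Finset.card_empty]
  have hmain : R.card * g + O.card * Q = S.card + O.card + 2 * (g - 1) := by
    rw [← hRb, ← hun, sum_stab_eq, ← Finset.sum_add_distrib,
      ← Finset.add_sum_erase _ _ (Finset.mem_univ (1 : Γ)), Finset.sum_congr rfl htot]
    have e1 : (S.filter (fun x => (1 : Γ) • x = x)).card = S.card := by simp
    have e2 : (O.filter (fun x => (1 : Γ) ∈ A.P x)).card = O.card := by simp [one_mem]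
    rw [e1, e2, Finset.sum_const, Finset.card_erase_of_mem (Finset.mem_univ _),
      Finset.card_univ, ← Nat.card_eq_fintype_card, smul_eq_mul, mul_comm 2]
  -- the representative of O
  have hxS : x ∈ S := by
    rw [hS]
    obtain ⟨u, hu⟩ := (A.P x).ne_bot_iff_exists_ne_one.1 hx
    exact ⟨u, fun h => hu (Subtype.ext h), (A.mem_P.1 u.2).1⟩
  obtain ⟨x0, hx0R, hx0⟩ := hR1 x hxS
  have horb : MulAction.orbit Γ x0 = MulAction.orbit Γ x := MulAction.orbit_eq_iff.2 hx0
  have hSsum : S.card = O.card + ∑ y ∈ R.erase x0, (MulAction.orbit Γ y).ncard := by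
    rw [hRc, ← Finset.add_sum_erase _ _ hx0R, horb, hOc]
  have hos : ∀ y ∈ R.erase x0, 2 * (MulAction.orbit Γ y).ncard ≤ g := by
    intro y hy
    have h1 := card_orbit_stab (Γ := Γ) y
    have h2 := hSn y (hRS (Finset.mem_of_mem_erase hy))
    nlinarith
  have hSle : 2 * ∑ y ∈ R.erase x0, (MulAction.orbit Γ y).ncard ≤ (R.erase x0).card * g := by
    rw [Finset.mul_sum]
    calc _ ≤ ∑ y ∈ R.erase x0, g := Finset.sum_le_sum hos
      _ = _ := by rw [Finset.sum_const, smul_eq_mul]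
  have hRcard : R.card = (R.erase x0).card + 1 := (Finset.card_erase_add_one hx0R).symm
  have hOQ : 3 * O.card ≤ O.card * Q := by nlinarith
  rw [hRcard, add_mul, one_mul, hSsum] at hmain
  have hle1 : (R.erase x0).card ≤ 1 := by
    by_contra h
    have : 2 * g ≤ (R.erase x0).card * g := Nat.mul_le_mul_right _ (by omega)
    omega
  have hfixed : O.card = 1 → ∀ h : Γ, h • x = x := by
    intro h1 h
    rw [hOc] at h1
    obtain ⟨a, ha⟩ := Set.ncard_eq_one.1 h1
    have h1 : x ∈ MulAction.orbit Γ x := MulAction.mem_orbit_self x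
    have h2 : h • x ∈ MulAction.orbit Γ x := MulAction.mem_orbit x h
    rw [ha] at h1 h2
    rw [Set.mem_singleton_iff] at h1 h2
    rw [h2, h1]
  have hcpos : 0 < c := by
    by_contra h0
    have : c = 0 := by omega
    rw [this] at hgc; simp at hgc; omega
  have hcQ : c ∣ Q - 1 := A.c_dvd x
  obtain h0 | h1 : (R.erase x0).card = 0 ∨ (R.erase x0).card = 1 := by omega
  · left
    apply hfixed
    rw [Finset.card_eq_zero.1 h0, Finset.sum_empty, Finset.card_empty] at hmain
    have : O.card * Q ≤ g := by rw [← hgc]; nlinarith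
    omega
  · obtain ⟨y, hy⟩ := Finset.card_eq_one.1 h1
    rw [hy, Finset.sum_singleton, Finset.card_singleton] at hmain
    have hst := card_orbit_stab (Γ := Γ) y
    rw [← hg] at hst
    by_cases hk0 : k = 0
    · left; apply hfixed; rw [hk, hk0]; simp
    right
    set s := (MulAction.orbit Γ y).ncard with hs
    have hs' : s = Q * (1 + k * (Q - 2)) := by
      rw [hk] at hmain
      exact arith_orb hg0 hQ3 (by linarith)
    have heq : Nat.card (MulAction.stabilizer Γ y) * (1 + k * (Q - 2)) = (1 + k * Q) * c := by
      apply Nat.eq_of_mul_eq_mul_left hQ0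
      calc _ = s * Nat.card (MulAction.stabilizer Γ y) := by rw [hs']; ring
        _ = O.card * (Q * c) := by rw [hst, hgc]
        _ = _ := by rw [hk]; ring
    rcases arith_div hQ3 (by omega) hcQ heq with ⟨h1, h2⟩ | ⟨h1, h2, h3⟩
    · left
      refine ⟨?_, h2⟩
      rw [← hOc, hk, h1]; ring
    · right
      refine ⟨h2, ?_⟩
      rw [← hgc, hk, h1, h2, h3]

end ActSec

section ActSec4
variable {Γ : Type} [Group Γ] [Finite Γ] {X : Type} [MulAction Γ X] {K : Type} [Field K]
  {p : ℕ} {χ : X → Γ → K}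

lemma Act.cyc_gen (A : Act Γ X K p χ) (x : X) : ∃ g, g • x = x ∧
    ∀ h : Γ, h • x = x → ∃ j : ℕ, ∃ u ∈ A.P x, h = g ^ j * u := by
  have hfr : Finite (A.hom x).range :=
    Finite.of_surjective _ (A.hom x).rangeRestrict_surjective
  have : IsCyclic (A.hom x).range := isCyclic_subgroup_units _
  obtain ⟨⟨_, ⟨g, rfl⟩⟩, hg⟩ := this.exists_zpow_surjective
  refine ⟨g, g.2, fun h hh => ?_⟩
  obtain ⟨j, hj⟩ := hg ⟨_, ⟨⟨h, hh⟩, rfl⟩⟩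
  have hj' : A.hom x g ^ j = A.hom x ⟨h, hh⟩ := congrArg Subtype.val hj
  obtain ⟨k, hk⟩ : ∃ k : ℕ, g ^ j = g ^ k := by
    have := (mem_powers_iff_mem_zpowers (x := g) (y := g ^ j)).2 ⟨j, rfl⟩
    obtain ⟨k, hk⟩ := this
    exact ⟨k, hk.symm⟩
  rw [← map_zpow, hk] at hj'
  refine ⟨k, (g : Γ) ^ (-(k : ℤ)) * h, ?_, ?_⟩
  · have h1 : A.hom x ((g ^ k)⁻¹ * ⟨h, hh⟩) = 1 := by
      rw [map_mul, map_inv, hj', inv_mul_cancel]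
    have h2 : ((g : Γ) ^ (-(k : ℤ)) * h) =
      (((g ^ k)⁻¹ * ⟨h, hh⟩ : MulAction.stabilizer Γ x) : Γ) := by simp
    rw [h2]
    exact ⟨_, MonoidHom.mem_ker.2 h1, rfl⟩
  · simp

lemma Act.comm_P (A : Act Γ X K p χ) {x : X} {a b : Γ} (ha : a • x = x) (hb : b • x = x) :
    a * b * a⁻¹ * b⁻¹ ∈ A.P x := by
  have h1 : A.hom x (⟨a, ha⟩ * ⟨b, hb⟩ * ⟨a, ha⟩⁻¹ * ⟨b, hb⟩⁻¹) = 1 := by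
    simp only [map_mul, map_inv]
    rw [mul_comm (A.hom x ⟨a, ha⟩)]; group
  exact ⟨_, MonoidHom.mem_ker.2 h1, rfl⟩

lemma Act.invol_not_P (A : Act Γ X K p χ) (hp : Odd p) {x : X} {z : Γ} (hz : z * z = 1)
    (hz1 : z ≠ 1) : z ∉ A.P x := by
  intro h
  have h1 := A.mem_P.1 h
  have h2 := A.exp x z h1.1 h1.2
  obtain ⟨k, rfl⟩ := hp
  rw [pow_succ, pow_mul, pow_two, hz, one_pow, one_mul] at h2
  exact hz1 h2

lemma Act.invol_inv (A : Act Γ X K p χ) {x : X} {z u : Γ} (hzx : z • x = x) (hz : z * z = 1)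
    (hzP : z ∉ A.P x) (hu : u ∈ A.P x) : z * u * z⁻¹ = u⁻¹ := by
  have hz' : z⁻¹ = z := inv_eq_of_mul_eq_one_left hz
  have h1 : z * u * z⁻¹ ∈ A.P x := (A.P_normal hzx u).1 hu
  by_contra hne
  apply hzP
  refine A.centralizer (u := u * (z * u * z⁻¹)) (mul_mem hu h1) ?_ ?_
  · intro h
    exact hne (eq_inv_of_mul_eq_one_right h)
  · have m1 := A.mem_P.1 hu
    have m2 := A.mem_P.1 h1
    have hc := A.comm x _ _ m1.1 m2.1 m1.2 m2.2
    have e1 : z * (u * (z * u * z⁻¹)) * z⁻¹ = u * (z * u * z⁻¹) := by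
      rw [hc, hz']
      calc _ = z * (z * u * z) * (u * z) := by group
        _ = (z * z) * u * (z * (u * z)) := by group
        _ = u * (z * u * z) := by rw [hz]; group
        _ = z * u * z * u := by rw [hz'] at hc; exact hc
    calc _ = z * (u * (z * u * z⁻¹)) * z⁻¹ * z := by group
      _ = _ := by rw [e1]

lemma exists_invol (H : Subgroup Γ) (h : 2 ∣ Nat.card H) : ∃ z ∈ H, z * z = 1 ∧ z ≠ 1 := by
  have : Fact (Nat.Prime 2) := ⟨Nat.prime_two⟩
  obtain ⟨z, hz⟩ := exists_prime_orderOf_dvd_card' 2 h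
  refine ⟨z, z.2, ?_, fun h => ?_⟩
  · have := pow_orderOf_eq_one z
    rw [hz, pow_two] at this
    exact congrArg Subtype.val this
  · have : z = 1 := Subtype.ext h
    rw [this, orderOf_one] at hz
    omega

end ActSec4

section
variable {G : Type} [Group G] [Finite G] {L : Type} [Group L] [Finite L]
  {M : Subgroup G} [M.Normal] {π : M →* L} {H : Subgroup L} {n : ℕ}
  {X : Type} [MulAction L X] {K : Type} [Field K] {p : ℕ} {χ : X → L → K}

lemma Dat.caseI_act (h : Dat M π H n) (hπ : Function.Surjective π) (hG : TwoPrimeHypothesis G)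
    (h2 : IsPGroup 2 (G ⧸ M)) (A : Act L X K p χ) (hpp : p.Prime) (hp : Odd p) {x : X}
    (hx : ∀ h ∈ H, h • x = x) (hP : ∃ u ∈ H, u ∈ A.P x ∧ u ≠ 1) (hev : 2 ∣ Nat.card H) :
    (2 * H.index ∣ n ∨ p * H.index ∣ n) ∨ n.primeFactorsList.length ≤ 2 := by
  obtain ⟨z, hzH, hz, hz1⟩ := exists_invol H hev
  have hzP := A.invol_not_P hp (x := x) hz hz1
  obtain ⟨u, huH, huP, hu1⟩ := hP
  have hg' : ∃ g ∈ H, ∀ h ∈ H, ∃ j : ℕ, ∃ u ∈ H ⊓ A.P x, h = g ^ j * u := by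
    obtain ⟨g, hgx, hg⟩ := (A.sub H).cyc_gen x
    refine ⟨g, g.2, fun h hh => ?_⟩
    obtain ⟨j, u, hu, hju⟩ := hg ⟨h, hh⟩ (hx h hh)
    have hu' := (A.sub H).mem_P.1 hu
    exact ⟨j, u, ⟨u.2, A.mem_P.2 hu'⟩, congrArg Subtype.val hju⟩
  obtain ⟨g, hgH, hgen⟩ := hg'
  refine h.caseI hπ hG h2 ⟨z, hzH, u, huH, fun hc => hzP (A.centralizer huP hu1 hc)⟩ hpp hp
    (P := H ⊓ A.P x) inf_le_left ?_ ?_ ?_ hgH hgen hzH hz ?_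
  · intro h hh k
    rw [Subgroup.mem_inf, Subgroup.mem_inf, ← A.P_normal (hx h hh) k, and_congr_left_iff]
    intro _
    rw [Subgroup.mul_mem_cancel_right _ (inv_mem hh), Subgroup.mul_mem_cancel_left _ hh]
  · intro u hu
    have := A.mem_P.1 hu.2
    exact A.exp x u this.1 this.2
  · intro a ha b hb
    exact ⟨H.mul_mem (H.mul_mem (H.mul_mem ha hb) (H.inv_mem ha)) (H.inv_mem hb),
      A.comm_P (hx a ha) (hx b hb)⟩
  · intro u hu
    exact A.invol_inv (hx z hzH) hz hzP hu.2

lemma Dat.dihedral_act (h : Dat M π H n) (hπ : Function.Surjective π) (hG : TwoPrimeHypothesis G)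
    (h2 : IsPGroup 2 (G ⧸ M)) (A : Act L X K p χ) (hpp : p.Prime) (hpH : ¬ p ∣ Nat.card H)
    {x : X} (hx : 2 * Nat.card (MulAction.stabilizer H x) = Nat.card H)
    (hna : ∃ a b : H, a * b ≠ b * a) :
    2 * H.index ∣ n ∨ n.primeFactorsList.length ≤ 2 := by
  obtain ⟨g, hgx, hg⟩ := (A.sub H).cyc_gen x
  have hbot : (A.sub H).P x = ⊥ := by
    by_contra hb
    exact hpH (((A.sub H).p_dvd_P hpp hb).trans (Subgroup.card_subgroup_dvd_card _))
  have hz : MulAction.stabilizer H x = Subgroup.zpowers g := by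
    apply le_antisymm
    · intro k hk
      obtain ⟨j, u, hu, hju⟩ := hg k hk
      rw [hbot, Subgroup.mem_bot] at hu
      rw [hju, hu, mul_one]
      exact Subgroup.npow_mem_zpowers g j
    · rw [Subgroup.zpowers_le]; exact hgx
  obtain ⟨a, b, hab⟩ := hna
  refine h.dihedral hπ hG h2 ⟨a, a.2, b, b.2, fun h => hab (Subtype.ext h)⟩ g.2 ?_
  have e : Subgroup.zpowers (g : L) = (MulAction.stabilizer H x).map H.subtype := by
    rw [hz, MonoidHom.map_zpowers]; rfl
  have h1 : (Subgroup.zpowers (g : L)).relIndex H = (MulAction.stabilizer H x).index := by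
    rw [e, Subgroup.relIndex, Subgroup.subgroupOf,
      Subgroup.comap_map_eq_self_of_injective H.subtype_injective]
  rw [h1]
  have h3 := (MulAction.stabilizer H x).card_mul_index
  have h4 : 0 < Nat.card (MulAction.stabilizer H x) := Nat.card_pos
  rw [← hx, mul_comm 2] at h3
  exact Nat.eq_of_mul_eq_mul_left h4 h3

lemma Dat.pgl_act (h : Dat M π H n) (hπ : Function.Surjective π) (hG : TwoPrimeHypothesis G)
    (h2 : IsPGroup 2 (G ⧸ M)) (A : Act L X K p χ) (hpp : p.Prime) (hp5 : 5 ≤ p)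
    {x : X} (hP : Nat.card ((A.sub H).P x) = p) (ho : (MulAction.orbit H x).ncard = p + 1)
    (hc : ((A.sub H).P x).relIndex (MulAction.stabilizer H x) = p - 1) :
    (2 * H.index ∣ n ∨ p * H.index ∣ n) ∨ n.primeFactorsList.length ≤ 2 := by
  set A' := A.sub H with hA'
  have hodd : Odd p := hpp.odd_of_ne_two (by omega)
  have hst := A'.card_stab x
  rw [hP, hc] at hst
  have hev : 2 ∣ Nat.card (MulAction.stabilizer H x) := by
    rw [← hst]
    obtain ⟨k, rfl⟩ := hodd
    exact Dvd.dvd.mul_left ⟨k, by omega⟩ _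
  obtain ⟨z, hzx, hz, hz1⟩ := exists_invol _ hev
  have hzP := A'.invol_not_P hodd (x := x) hz hz1
  obtain ⟨g, hgx, hg⟩ := A'.cyc_gen x
  have hPne : A'.P x ≠ ⊥ := by
    intro hb
    rw [hb, Subgroup.card_bot] at hP
    omega
  obtain ⟨u0, hu00⟩ := (A'.P x).ne_bot_iff_exists_ne_one.1 hPne
  have hu01 : (u0 : H) ≠ 1 := fun h => hu00 (Subtype.ext h)
  have : Fact p.Prime := ⟨hpp⟩
  have hcyc : ∀ u ∈ A'.P x, ∃ j : ℕ, u = (u0 : H) ^ j := by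
    intro u hu
    have := mem_powers_of_prime_card (G := A'.P x) (p := p) hP hu00 (g' := ⟨u, hu⟩)
    obtain ⟨j, hj⟩ := this
    exact ⟨j, (congrArg Subtype.val hj).symm⟩
  obtain ⟨w, hw⟩ : ∃ w : H, w • x ≠ x := by
    by_contra hcon
    push Not at hcon
    have : MulAction.orbit H x = {x} := by
      ext y
      constructor
      · rintro ⟨w, rfl⟩; exact hcon w
      · rintro rfl; exact MulAction.mem_orbit_self _
    rw [this, Set.ncard_singleton] at ho
    omega
  have htrans : ∀ k : H, k • x ≠ x → ∃ u ∈ A'.P x, u • w • x = k • x := by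
    have hfin : (MulAction.orbit H x).Finite := orbit_finite x
    set T : Set X := (fun u : A'.P x => (u : H) • w • x) '' Set.univ with hT
    have hinj : Function.Injective (fun u : A'.P x => (u : H) • w • x) := by
      intro a b hab
      by_contra hne
      have h1 : ((b : H)⁻¹ * a) • w • x = w • x := by
        rw [mul_smul, inv_smul_eq_iff]; exact hab
      have h2 : (b : H)⁻¹ * a ∈ A'.P x := mul_mem (inv_mem b.2) a.2
      have h3 := A'.mem_P.1 h2
      refine hw (A'.uni x _ h3.1 h3.2 ?_ _ h1)
      intro h4
      exact hne (Subtype.ext (inv_mul_eq_one.1 h4).symm)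
    have hTc : T.ncard = p := by
      rw [hT, Set.ncard_image_of_injective _ hinj, Set.ncard_univ, hP]
    have hsub : T ⊆ MulAction.orbit H x \ {x} := by
      rintro _ ⟨u, -, rfl⟩
      refine ⟨⟨(u : H) * w, mul_smul _ _ _⟩, fun h => hw ?_⟩
      have h1 : (u : H) • w • x = x := h
      rw [← eq_inv_smul_iff] at h1
      rw [h1, inv_smul_eq_iff, (A'.mem_P.1 u.2).1]
    have hd : (MulAction.orbit H x \ {x}).ncard = p := by
      rw [Set.ncard_sdiff_singleton_of_mem (MulAction.mem_orbit_self x), ho]; rfl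
    have heq := Set.eq_of_subset_of_ncard_le hsub (by rw [hTc, hd]) hfin.sdiff
    intro k hk
    have : k • x ∈ T := by
      rw [heq]; exact ⟨MulAction.mem_orbit x k, hk⟩
    obtain ⟨u, -, hu⟩ := this
    exact ⟨u, u.2, hu⟩
  refine h.pgl hπ hG h2
    (P := (A'.P x).map H.subtype) (B := (MulAction.stabilizer H x).map H.subtype)
    (u0 := ((u0 : H) : L)) (g := g) (z := z) (w := w) ?_ hpp hp5
    (Subgroup.map_mono (A'.P_le x)) ?_ ?_ ⟨_, u0.2, rfl⟩ ?_ ?_ ?_ ⟨_, hgx, rfl⟩ ?_ ⟨_, hzx, rfl⟩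
    ?_ ?_ ?_ ?_ ?_ w.2 ?_
  · exact ⟨z, z.2, (u0 : H), (u0 : H).2, fun hc => hzP (A'.centralizer u0.2 hu01 (Subtype.ext hc))⟩
  · rintro _ ⟨b, -, rfl⟩; exact b.2
  · rintro _ ⟨b, hb, rfl⟩ k
    constructor
    · rintro ⟨k, hk, rfl⟩
      exact ⟨b * k * b⁻¹, (A'.P_normal hb k).1 hk, rfl⟩
    · rintro ⟨k', hk', he⟩
      refine ⟨b⁻¹ * k' * b, ?_, ?_⟩
      · have := (A'.P_normal hb (b⁻¹ * k' * b)).2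
        apply this
        have e : b * (b⁻¹ * k' * b) * b⁻¹ = k' := by group
        rw [e]; exact hk'
      · have e : k = (b : L)⁻¹ * (k' : L) * b := by
          have he' : (k' : L) = b * k * (b : L)⁻¹ := he
          rw [he']; group
        rw [e]; rfl
  · rintro _ ⟨u, hu, rfl⟩
    obtain ⟨j, hj⟩ := hcyc u hu
    exact ⟨j, congrArg Subtype.val hj⟩
  · have := A'.mem_P.1 u0.2
    exact congrArg Subtype.val (A'.exp x _ this.1 this.2)
  · rintro _ ⟨a, ha, rfl⟩ _ ⟨b, hb, rfl⟩
    exact ⟨_, A'.comm_P ha hb, rfl⟩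
  · rintro _ ⟨a, ha, rfl⟩
    obtain ⟨j, u, hu, hju⟩ := hg a ha
    exact ⟨j, u, ⟨u, hu, rfl⟩, congrArg Subtype.val hju⟩
  · exact congrArg Subtype.val hz
  · rintro _ ⟨u, hu, rfl⟩
    exact congrArg Subtype.val (A'.invol_inv hzx hz hzP hu)
  · rintro _ ⟨b, hb, rfl⟩ hbu
    exact ⟨b, A'.centralizer u0.2 hu01 (Subtype.ext hbu), rfl⟩
  · rw [← hc, Subgroup.relIndex_map_map_of_injective _ _ H.subtype_injective]
  · rw [Subgroup.relIndex, Subgroup.subgroupOf,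
      Subgroup.comap_map_eq_self_of_injective H.subtype_injective, ← ho,
      MulAction.index_stabilizer]
  · intro k hk
    by_cases hkx : (⟨k, hk⟩ : H) • x = x
    · exact Or.inl ⟨⟨k, hk⟩, hkx, rfl⟩
    · right
      obtain ⟨u, hu, huw⟩ := htrans ⟨k, hk⟩ hkx
      refine ⟨u, ⟨u, hu, rfl⟩, ((u * w)⁻¹ * ⟨k, hk⟩ : H),
        ⟨((u * w)⁻¹ * ⟨k, hk⟩ : H), ?_, rfl⟩, ?_⟩
      · show ((u * w)⁻¹ * ⟨k, hk⟩ : H) • x = x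
        rw [mul_smul, inv_smul_eq_iff, mul_smul, huw]
      · simp [mul_assoc]
end

section ProjLine
open Matrix OnePoint
open scoped MatrixGroups
variable {K : Type} [Field K] [DecidableEq K]

/-- eigenvalue of `s` at a fixed point `x` -/
def lam (s : SL(2, K)) (x : OnePoint K) : K := x.elim (s 0 0) (fun t => s 1 0 * t + s 1 1)

lemma sl_det (s : SL(2, K)) : s 0 0 * s 1 1 - s 0 1 * s 1 0 = 1 := by
  have := s.det_coe
  rwa [det_fin_two] at this

lemma sl_mul_apply (s s' : SL(2, K)) (i j : Fin 2) :
    (s * s') i j = s i 0 * s' 0 j + s i 1 * s' 1 j := by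
  simp [mul_apply, Fin.sum_univ_two]

lemma sl_fix_infty (s : SL(2, K)) :
    (s : GL (Fin 2) K) • (∞ : OnePoint K) = ∞ ↔ s 1 0 = 0 := by
  rw [OnePoint.smul_infty_eq_self_iff]; rfl

lemma sl_fix_coe (s : SL(2, K)) (t : K) :
    (s : GL (Fin 2) K) • (t : OnePoint K) = t ↔ s 0 0 * t + s 0 1 = t * (s 1 0 * t + s 1 1) := by
  rw [OnePoint.smul_some_eq_ite]
  have hd := sl_det s
  change (if s 1 0 * t + s 1 1 = 0 then _ else
    (((s 0 0 * t + s 0 1) / (s 1 0 * t + s 1 1) : K) : OnePoint K)) = _ ↔ _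
  split_ifs with h
  · constructor
    · intro h; exact absurd h (infty_ne_coe _)
    · intro h2
      exfalso
      rw [h, mul_zero] at h2
      apply one_ne_zero (α := K)
      linear_combination -hd + (s 0 0) * h - s 1 0 * h2
  · rw [coe_eq_coe, div_eq_iff h]

/-- `s` is plus or minus the identity -/
def IsPM (s : SL(2, K)) : Prop := s 0 1 = 0 ∧ s 1 0 = 0 ∧ s 0 0 = s 1 1

lemma lam_ne_zero (s : SL(2, K)) (x : OnePoint K) (hx : (s : GL (Fin 2) K) • x = x) :
    lam s x ≠ 0 := by
  have hd := sl_det s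
  intro h
  induction x using OnePoint.rec with
  | infty =>
    rw [sl_fix_infty] at hx
    change s 0 0 = 0 at h
    rw [h, hx] at hd; simp at hd
  | coe t =>
    rw [sl_fix_coe] at hx
    change s 1 0 * t + s 1 1 = 0 at h
    rw [h, mul_zero] at hx
    apply one_ne_zero (α := K)
    linear_combination -hd + (s 0 0) * h - s 1 0 * hx

lemma lam_mul (s s' : SL(2, K)) (x : OnePoint K) (hx' : (s' : GL (Fin 2) K) • x = x) :
    lam (s * s') x = lam s x * lam s' x := by
  induction x using OnePoint.rec with
  | infty =>
    rw [sl_fix_infty] at hx'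
    change (s * s') 0 0 = s 0 0 * s' 0 0
    rw [sl_mul_apply, hx']; ring
  | coe t =>
    rw [sl_fix_coe] at hx'
    change (s * s') 1 0 * t + (s * s') 1 1 = (s 1 0 * t + s 1 1) * (s' 1 0 * t + s' 1 1)
    rw [sl_mul_apply, sl_mul_apply]
    linear_combination s 1 0 * hx'

/-- product of eigenvalues at distinct fixed points -/
lemma lam_prod (s : SL(2, K)) (x y : OnePoint K) (hx : (s : GL (Fin 2) K) • x = x)
    (hy : (s : GL (Fin 2) K) • y = y) (hxy : x ≠ y) : lam s x * lam s y = 1 := by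
  have hd := sl_det s
  induction x using OnePoint.rec with
  | infty =>
    induction y using OnePoint.rec with
    | infty => exact absurd rfl hxy
    | coe t =>
      rw [sl_fix_infty] at hx
      change s 0 0 * (s 1 0 * t + s 1 1) = 1
      rw [hx] at hd ⊢
      linear_combination hd
  | coe u =>
    induction y using OnePoint.rec with
    | infty =>
      rw [sl_fix_infty] at hy
      change (s 1 0 * u + s 1 1) * s 0 0 = 1
      rw [hy] at hd ⊢
      linear_combination hd
    | coe t =>
      rw [sl_fix_coe] at hx hy
      have hut : u - t ≠ 0 := fun h => hxy (by rw [sub_eq_zero.1 h])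
      change (s 1 0 * u + s 1 1) * (s 1 0 * t + s 1 1) = 1
      have h1 : s 0 0 = s 1 0 * (u + t) + s 1 1 := by
        apply mul_left_cancel₀ hut
        linear_combination hx - hy
      have h2 : s 0 1 = - (s 1 0 * u * t) := by
        rw [h1] at hx; linear_combination hx
      rw [h1, h2] at hd
      linear_combination hd

lemma lam_uni (s : SL(2, K)) (x y : OnePoint K) (hx : (s : GL (Fin 2) K) • x = x)
    (h1 : lam s x ^ 2 = 1) (hs : ¬ IsPM s) (hy : (s : GL (Fin 2) K) • y = y) : y = x := by
  by_contra hxy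
  have h2 := lam_prod s x y hx hy (Ne.symm hxy)
  have hne := lam_ne_zero s x hx
  have h3 : lam s y = lam s x := by
    apply mul_left_cancel₀ hne
    rw [h2, ← h1]; ring
  have hd := sl_det s
  apply hs
  induction x using OnePoint.rec with
  | infty =>
    induction y using OnePoint.rec with
    | infty => exact absurd rfl hxy
    | coe t =>
      rw [sl_fix_infty] at hx
      rw [sl_fix_coe] at hy
      change s 1 0 * t + s 1 1 = s 0 0 at h3
      refine ⟨?_, hx, ?_⟩
      · rw [h3] at hy; linear_combination hy
      · rw [hx] at h3; linear_combination -h3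
  | coe u =>
    induction y using OnePoint.rec with
    | infty =>
      rw [sl_fix_infty] at hy
      rw [sl_fix_coe] at hx
      change s 0 0 = s 1 0 * u + s 1 1 at h3
      refine ⟨?_, hy, ?_⟩
      · rw [← h3] at hx; linear_combination hx
      · rw [hy] at h3; linear_combination h3
    | coe t =>
      rw [sl_fix_coe] at hx hy
      change s 1 0 * t + s 1 1 = s 1 0 * u + s 1 1 at h3
      have hut : t - u ≠ 0 := fun h => hxy (by rw [sub_eq_zero.1 h])
      have hc : s 1 0 = 0 := by
        apply mul_left_cancel₀ hut; linear_combination h3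
      rw [hc] at hx hy
      have ha : s 0 0 = s 1 1 := by
        apply mul_left_cancel₀ hut; linear_combination hy - hx
      refine ⟨?_, hc, ha⟩
      rw [ha] at hx; linear_combination hx

lemma lam_two (s : SL(2, K)) (x : OnePoint K) (hx : (s : GL (Fin 2) K) • x = x)
    (h1 : lam s x ^ 2 ≠ 1) :
    ∃ y, y ≠ x ∧ ∀ z, (s : GL (Fin 2) K) • z = z ↔ z = x ∨ z = y := by
  have hd := sl_det s
  induction x using OnePoint.rec with
  | infty =>
    rw [sl_fix_infty] at hx
    change (s 0 0) ^ 2 ≠ 1 at h1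
    rw [hx] at hd
    have hda : s 1 1 - s 0 0 ≠ 0 := by
      intro h
      apply h1
      rw [sub_eq_zero.1 h] at hd
      linear_combination hd
    refine ⟨((s 0 1 / (s 1 1 - s 0 0) : K) : OnePoint K), coe_ne_infty _, fun z => ?_⟩
    induction z using OnePoint.rec with
    | infty => simp [sl_fix_infty, hx]
    | coe t =>
      rw [sl_fix_coe, hx, coe_eq_coe, eq_div_iff hda]
      simp only [coe_ne_infty, false_or]
      constructor
      · intro h; linear_combination -h
      · intro h; linear_combination -h
  | coe t =>
    rw [sl_fix_coe] at hx
    change (s 1 0 * t + s 1 1) ^ 2 ≠ 1 at h1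
    by_cases hc : s 1 0 = 0
    · rw [hc] at hx hd h1
      have hda : s 1 1 - s 0 0 ≠ 0 := by
        intro h
        apply h1
        rw [← sub_eq_zero.1 h] at hd
        linear_combination hd
      refine ⟨∞, infty_ne_coe _, fun z => ?_⟩
      induction z using OnePoint.rec with
      | infty => simp [sl_fix_infty, hc]
      | coe u =>
        rw [sl_fix_coe, hc, coe_eq_coe]
        simp only [coe_ne_infty, or_false]
        constructor
        · intro h
          apply mul_left_cancel₀ hda
          linear_combination hx - h
        · rintro rfl; exact hx
    · set u := (s 0 0 - s 1 1) / s 1 0 - t with hu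
      have hcu : s 1 0 * (u + t) = s 0 0 - s 1 1 := by rw [hu]; field_simp; ring
      refine ⟨u, ?_, fun z => ?_⟩
      · rw [Ne, coe_eq_coe]
        intro h
        apply h1
        rw [h] at hcu
        linear_combination hd + s 1 0 * hx + (s 1 0 * t + s 1 1) * hcu
      · induction z using OnePoint.rec with
        | infty => simp [sl_fix_infty, hc]
        | coe v =>
          rw [sl_fix_coe, coe_eq_coe, coe_eq_coe]
          constructor
          · intro h
            have : s 1 0 * ((v - t) * (v - u)) = 0 := by
              linear_combination (-1) * h + hx + (t - v) * hcu
            rcases mul_eq_zero.1 ((mul_eq_zero.1 this).resolve_left hc) with h | h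
            · exact Or.inl (sub_eq_zero.1 h)
            · exact Or.inr (sub_eq_zero.1 h)
          · rintro (rfl | rfl)
            · exact hx
            · linear_combination hx + (t - u) * hcu

/-- normal form of unipotent elements -/
lemma lam_nf (s : SL(2, K)) (x : OnePoint K) (hx : (s : GL (Fin 2) K) • x = x)
    (h1 : lam s x ^ 2 = 1) :
    (x = ∞ ∧ s 1 0 = 0 ∧ s 0 0 = lam s x ∧ s 1 1 = lam s x) ∨
    ∃ t : K, x = t ∧ s 0 0 = lam s x + s 1 0 * t ∧ s 1 1 = lam s x - s 1 0 * t ∧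
      s 0 1 = - (s 1 0 * t ^ 2) := by
  have hd := sl_det s
  have hne := lam_ne_zero s x hx
  induction x using OnePoint.rec with
  | infty =>
    rw [sl_fix_infty] at hx
    left
    refine ⟨rfl, hx, rfl, ?_⟩
    apply mul_left_cancel₀ hne
    rw [hx] at hd
    change s 0 0 * s 1 1 = _
    rw [← pow_two, h1]; linear_combination hd
  | coe t =>
    right
    rw [sl_fix_coe] at hx
    have hl : lam s (t : OnePoint K) = s 1 0 * t + s 1 1 := rfl
    have ha : s 0 0 = lam s (t : OnePoint K) + s 1 0 * t := by
      apply mul_left_cancel₀ hne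
      rw [hl] at h1 ⊢
      linear_combination hd - h1 + s 1 0 * hx
    refine ⟨t, rfl, ha, by rw [hl]; ring, ?_⟩
    rw [ha] at hx
    rw [← hl] at hx
    linear_combination hx

lemma lam_comm (s s' : SL(2, K)) (x : OnePoint K) (hx : (s : GL (Fin 2) K) • x = x)
    (hx' : (s' : GL (Fin 2) K) • x = x) (h1 : lam s x ^ 2 = 1) (h1' : lam s' x ^ 2 = 1) :
    s * s' = s' * s := by
  have n1 := lam_nf s x hx h1
  have n2 := lam_nf s' x hx' h1'
  generalize lam s x = e at *
  generalize lam s' x = e' at *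
  rcases n1 with ⟨h0, h2, h3, h4⟩ | ⟨t, rfl, h2, h3, h4⟩
  · rcases n2 with ⟨-, k2, k3, k4⟩ | ⟨t, rfl, k2, k3, k4⟩
    · ext i j
      fin_cases i <;> fin_cases j <;>
        simp [mul_apply, Fin.sum_univ_two, h2, h3, h4, k2, k3, k4] <;> ring
    · exact absurd h0 (coe_ne_infty _)
  · rcases n2 with ⟨h0, k2, k3, k4⟩ | ⟨u, htu, k2, k3, k4⟩
    · exact absurd h0 (coe_ne_infty _)
    · rw [coe_eq_coe] at htu
      subst htu
      ext i j
      fin_cases i <;> fin_cases j <;>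
        simp [mul_apply, Fin.sum_univ_two, h2, h3, h4, k2, k3, k4] <;> ring

lemma lam_exp {p : ℕ} [Fact p.Prime] [CharP K p] (s : SL(2, K)) (x : OnePoint K)
    (hx : (s : GL (Fin 2) K) • x = x) (h1 : lam s x ^ 2 = 1) : IsPM (s ^ p) := by
  have n1 := lam_nf s x hx h1
  generalize lam s x = e at *
  set N : Matrix (Fin 2) (Fin 2) K := (s : Matrix (Fin 2) (Fin 2) K) - Matrix.scalar (Fin 2) e
    with hN
  have hNN : N ^ 2 = 0 := by
    rw [pow_two]
    rcases n1 with ⟨h0, h2, h3, h4⟩ | ⟨t, rfl, h2, h3, h4⟩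
    · ext i j
      fin_cases i <;> fin_cases j <;>
        simp [hN, mul_apply, Fin.sum_univ_two, h2, h3, h4, scalar_apply]
    · ext i j
      fin_cases i <;> fin_cases j <;>
        simp [hN, mul_apply, Fin.sum_univ_two, h2, h3, h4, scalar_apply] <;> ring
  have hp2 : 2 ≤ p := (Fact.out : p.Prime).two_le
  have hs : (s : Matrix (Fin 2) (Fin 2) K) = N + Matrix.scalar (Fin 2) e := by rw [hN]; simp
  have hsp : ((s ^ p : SL(2, K)) : Matrix (Fin 2) (Fin 2) K) = Matrix.scalar (Fin 2) (e ^ p) := by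
    have e1 : ((s ^ p : SL(2, K)) : Matrix (Fin 2) (Fin 2) K) =
      (s : Matrix (Fin 2) (Fin 2) K) ^ p := by simp
    rw [e1, hs, add_pow_char_of_commute (p := p), map_pow]
    · have : N ^ p = 0 := by
        obtain ⟨k, rfl⟩ := Nat.exists_eq_add_of_le hp2
        rw [pow_add, hNN, zero_mul]
      rw [this, zero_add]
    · exact (Matrix.scalar_commute e (fun r => mul_comm _ _) N).symm
  refine ⟨?_, ?_, ?_⟩ <;> rw [hsp] <;> simp

lemma lam_fix [IsAlgClosed K] (h2 : (2 : K) ≠ 0) (s : SL(2, K)) :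
    ∃ x : OnePoint K, (s : GL (Fin 2) K) • x = x := by
  by_cases hc : s 1 0 = 0
  · exact ⟨∞, (sl_fix_infty s).2 hc⟩
  · obtain ⟨r, hr⟩ := IsAlgClosed.exists_eq_mul_self
      ((s 0 0 - s 1 1) ^ 2 + 4 * s 1 0 * s 0 1)
    refine ⟨(((s 0 0 - s 1 1 + r) / (2 * s 1 0) : K) : OnePoint K), (sl_fix_coe s _).2 ?_⟩
    field_simp
    linear_combination hr
end ProjLine

section ProjLine2
open Matrix OnePoint
open scoped MatrixGroups

lemma sl_center_iff {F : Type} [Field F] (s : SL(2, F)) :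
    s ∈ Subgroup.center SL(2, F) ↔ IsPM s := by
  rw [Matrix.SpecialLinearGroup.mem_center_iff]
  constructor
  · rintro ⟨r, -, hr⟩
    refine ⟨?_, ?_, ?_⟩ <;> rw [← hr] <;> simp
  · rintro ⟨h1, h2, h3⟩
    have hd := s.det_coe
    rw [det_fin_two] at hd
    refine ⟨s 0 0, ?_, ?_⟩
    · rw [Fintype.card_fin, pow_two]
      nth_rewrite 2 [h3]
      rw [h1] at hd
      linear_combination hd
    · ext i j
      fin_cases i <;> fin_cases j <;> simp [h1, h2, ← h3]

variable (F : Type) [Field F]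

/-- the algebraic closure -/
abbrev KK : Type := AlgebraicClosure F

noncomputable instance instDecKK : DecidableEq (KK F) := Classical.decEq _

/-- embedding of matrix groups -/
noncomputable def embK : SL(2, F) →* SL(2, KK F) := SpecialLinearGroup.map (algebraMap F (KK F))

variable {F}

lemma embK_apply (s : SL(2, F)) (i j : Fin 2) : embK F s i j = algebraMap F (KK F) (s i j) := rfl

lemma embK_PM (s : SL(2, F)) : IsPM (embK F s) ↔ IsPM s := by
  have hi := (algebraMap F (KK F)).injective
  unfold IsPM
  rw [embK_apply, embK_apply, embK_apply, embK_apply, map_eq_zero, map_eq_zero, hi.eq_iff]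

lemma PM_fix {K : Type} [Field K] [DecidableEq K] (s : SL(2, K)) (h : IsPM s) (x : OnePoint K) :
    (s : GL (Fin 2) K) • x = x := by
  obtain ⟨h1, h2, h3⟩ := h
  induction x using OnePoint.rec with
  | infty => rw [sl_fix_infty, h2]
  | coe t => rw [sl_fix_coe, h1, h2, h3]; ring

lemma PM_lam {K : Type} [Field K] [DecidableEq K] (s : SL(2, K)) (h : IsPM s) (x : OnePoint K) :
    lam s x ^ 2 = 1 := by
  obtain ⟨h1, h2, h3⟩ := h
  have hd := sl_det s
  rw [h1, h3] at hd
  induction x using OnePoint.rec with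
  | infty => change (s 0 0) ^ 2 = 1; rw [h3]; linear_combination hd
  | coe t => change (s 1 0 * t + s 1 1) ^ 2 = 1; rw [h2]; linear_combination hd

variable (F)
/-- action homomorphism -/
noncomputable def actSL : SL(2, F) →* Equiv.Perm (OnePoint (KK F)) :=
  (MulAction.toPermHom (GL (Fin 2) (KK F)) (OnePoint (KK F))).comp
    (SpecialLinearGroup.toGL.comp (embK F))

/-- action homomorphism on the quotient -/
noncomputable def actPSL : PSL2 F →* Equiv.Perm (OnePoint (KK F)) :=
  QuotientGroup.lift _ (actSL F) (by
    intro s hs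
    ext x
    exact PM_fix _ ((embK_PM s).2 ((sl_center_iff s).1 hs)) x)

noncomputable instance instActPSL : MulAction (PSL2 F) (OnePoint (KK F)) :=
  MulAction.compHom _ (actPSL F)

variable {F}

lemma psl_smul (s : SL(2, F)) (x : OnePoint (KK F)) :
    (QuotientGroup.mk s : PSL2 F) • x = (embK F s : GL (Fin 2) (KK F)) • x := rfl

/-- the squared eigenvalue -/
noncomputable def chiK (x : OnePoint (KK F)) (g : PSL2 F) : KK F := lam (embK F g.out) x ^ 2

lemma chiK_mk (x : OnePoint (KK F)) (s : SL(2, F)) :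
    chiK x (QuotientGroup.mk s : PSL2 F) = lam (embK F s) x ^ 2 := by
  obtain ⟨z, hz⟩ := QuotientGroup.mk_out_eq_mul (Subgroup.center SL(2, F)) s
  have hPM := (embK_PM _).2 ((sl_center_iff _).1 z.2)
  rw [chiK, hz, map_mul, lam_mul _ _ _ (PM_fix _ hPM x), mul_pow, PM_lam _ hPM, mul_one]

lemma psl_mk_eq_one (s : SL(2, F)) : (QuotientGroup.mk s : PSL2 F) = 1 ↔ IsPM (embK F s) := by
  rw [QuotientGroup.eq_one_iff, sl_center_iff, embK_PM]

theorem act_psl {p : ℕ} [Fact p.Prime] [CharP F p] (hp : Odd p) :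
    Act (PSL2 F) (OnePoint (KK F)) (KK F) p chiK := by
  have : CharP (KK F) p := charP_of_injective_algebraMap (algebraMap F (KK F)).injective p
  refine ⟨?_, ?_, ?_, ?_, ?_, ?_, ?_⟩
  · intro x
    have := chiK_mk x (1 : SL(2, F))
    rw [map_one] at this
    rw [← QuotientGroup.mk_one, this]
    exact PM_lam _ (by simp [IsPM]) x
  · intro x g k hg hk
    induction g using QuotientGroup.induction_on with | H s =>
    induction k using QuotientGroup.induction_on with | H r =>
    rw [← QuotientGroup.mk_mul, chiK_mk, chiK_mk, chiK_mk, map_mul, lam_mul _ _ _ hk, mul_pow]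
  · intro x g hg h1 h2 y hy
    induction g using QuotientGroup.induction_on with | H s =>
    rw [chiK_mk] at h1
    rw [Ne, psl_mk_eq_one] at h2
    exact lam_uni _ x y hg h1 h2 hy
  · intro x g hg h1
    induction g using QuotientGroup.induction_on with | H s =>
    rw [chiK_mk] at h1
    exact lam_two _ x hg h1
  · intro x g k hg hk h1 h2
    induction g using QuotientGroup.induction_on with | H s =>
    induction k using QuotientGroup.induction_on with | H r =>
    rw [chiK_mk] at h1 h2
    have := lam_comm _ _ x hg hk h1 h2
    rw [← map_mul, ← map_mul] at this
    have h3 : s * r = r * s := by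
      ext i j
      apply (algebraMap F (KK F)).injective
      rw [← embK_apply, ← embK_apply, this]
    rw [← QuotientGroup.mk_mul, h3]; rfl
  · intro x g hg h1
    induction g using QuotientGroup.induction_on with | H s =>
    rw [chiK_mk] at h1
    rw [← QuotientGroup.mk_pow, psl_mk_eq_one, map_pow]
    exact lam_exp _ x hg h1
  · intro g
    induction g using QuotientGroup.induction_on with | H s =>
    refine lam_fix ?_ (embK F s)
    intro h
    have h3 := (CharP.cast_eq_zero_iff (KK F) p 2).1 (by exact_mod_cast h)
    have := (Nat.prime_dvd_prime_iff_eq Fact.out Nat.prime_two).1 h3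
    rw [this] at hp
    exact absurd hp (by decide)

/-- rational points -/
def IsRat (x : OnePoint (KK F)) : Prop := x = ∞ ∨ ∃ t : F, x = ((algebraMap F (KK F) t : KK F))

variable [Fintype F]

lemma pow_card_eq (t : KK F) : t ^ Fintype.card F = t ↔ ∃ r : F, algebraMap F (KK F) r = t := by
  classical
  constructor
  · intro h
    have h1 := FiniteField.X_pow_card_sub_X_natDegree_eq (KK F) (Fintype.one_lt_card (α := F))
    have hne := FiniteField.X_pow_card_sub_X_ne_zero (KK F) (Fintype.one_lt_card (α := F))
    set P : Polynomial (KK F) := Polynomial.X ^ Fintype.card F - Polynomial.X with hP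
    set T : Finset (KK F) := Finset.univ.image (algebraMap F (KK F)) with hT
    have hTc : T.card = Fintype.card F :=
      Finset.card_image_of_injective _ (algebraMap F (KK F)).injective
    have hsub : T ⊆ P.roots.toFinset := by
      intro y hy
      obtain ⟨r, -, rfl⟩ := Finset.mem_image.1 hy
      rw [Multiset.mem_toFinset, Polynomial.mem_roots hne]
      simp [hP, ← map_pow, FiniteField.pow_card]
    have hle : P.roots.toFinset.card ≤ T.card := by
      rw [hTc, ← h1]
      exact (Multiset.toFinset_card_le _).trans (Polynomial.card_roots' _)
    have heq := Finset.eq_of_subset_of_card_le hsub hle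
    have : t ∈ P.roots.toFinset := by
      rw [Multiset.mem_toFinset, Polynomial.mem_roots hne]
      simp [hP, h]
    rw [← heq] at this
    obtain ⟨r, -, hr⟩ := Finset.mem_image.1 this
    exact ⟨r, hr⟩
  · rintro ⟨r, rfl⟩
    rw [← map_pow, FiniteField.pow_card]

lemma frob_add {p f : ℕ} [Fact p.Prime] [CharP F p] (hF : Fintype.card F = p ^ f) (a b : KK F) :
    (a + b) ^ Fintype.card F = a ^ Fintype.card F + b ^ Fintype.card F := by
  have : CharP (KK F) p := charP_of_injective_algebraMap (algebraMap F (KK F)).injective p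
  rw [hF, add_pow_char_pow]

lemma rat_chi (hq : Odd (Fintype.card F)) (x : OnePoint (KK F)) (hx : IsRat x) (g : PSL2 F)
    (hg : g • x = x) : chiK x g ^ ((Fintype.card F - 1) / 2) = 1 := by
  induction g using QuotientGroup.induction_on with | H s =>
  rw [chiK_mk, ← pow_mul]
  have hne := lam_ne_zero _ x hg
  have e : 2 * ((Fintype.card F - 1) / 2) = Fintype.card F - 1 := by
    obtain ⟨k, hk⟩ := hq; omega
  rw [e]
  have hl : ∃ r : F, algebraMap F (KK F) r = lam (embK F s) x := by
    rcases hx with rfl | ⟨t, rfl⟩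
    · exact ⟨s 0 0, rfl⟩
    · refine ⟨s 1 0 * t + s 1 1, ?_⟩
      rw [map_add, map_mul]; rfl
  obtain ⟨r, hr⟩ := hl
  rw [← hr] at hne ⊢
  rw [← map_pow, FiniteField.pow_card_sub_one_eq_one, map_one]
  rintro rfl
  exact hne (map_zero _)

lemma frob_fix {p f : ℕ} [Fact p.Prime] [CharP F p] (hF : Fintype.card F = p ^ f)
    (t : KK F) (s : SL(2, F)) (h : (embK F s : GL (Fin 2) (KK F)) • (t : OnePoint (KK F)) = t) :
    (embK F s : GL (Fin 2) (KK F)) • ((t ^ Fintype.card F : KK F) : OnePoint (KK F)) =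
      ((t ^ Fintype.card F : KK F)) ∧
    lam (embK F s) ((t ^ Fintype.card F : KK F) : OnePoint (KK F)) =
      lam (embK F s) (t : OnePoint (KK F)) ^ Fintype.card F := by
  have hr : ∀ i j, (embK F s i j) ^ Fintype.card F = embK F s i j := fun i j =>
    (pow_card_eq _).2 ⟨s i j, rfl⟩
  have h2 : lam (embK F s) ((t ^ Fintype.card F : KK F) : OnePoint (KK F)) =
      lam (embK F s) (t : OnePoint (KK F)) ^ Fintype.card F := by
    change embK F s 1 0 * t ^ Fintype.card F + embK F s 1 1 =
      (embK F s 1 0 * t + embK F s 1 1) ^ Fintype.card F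
    rw [frob_add hF, mul_pow, hr, hr]
  refine ⟨?_, h2⟩
  rw [sl_fix_coe] at h ⊢
  have := congrArg (· ^ Fintype.card F) h
  simp only [mul_pow, frob_add hF, hr] at this
  exact this

lemma nrat_pow {x : OnePoint (KK F)} (hx : ¬ IsRat x) : ∃ t : KK F, x = t ∧
    t ^ Fintype.card F ≠ t := by
  induction x using OnePoint.rec with
  | infty => exact absurd (Or.inl rfl) hx
  | coe t =>
    refine ⟨t, rfl, fun h => ?_⟩
    obtain ⟨r, hr⟩ := (pow_card_eq t).1 h
    exact hx (Or.inr ⟨r, by rw [hr]⟩)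

lemma nrat_chi {p f : ℕ} [Fact p.Prime] [CharP F p] (hF : Fintype.card F = p ^ f)
    (hq : Odd (Fintype.card F)) (x : OnePoint (KK F)) (hx : ¬ IsRat x) (g : PSL2 F)
    (hg : g • x = x) : chiK x g ^ ((Fintype.card F + 1) / 2) = 1 := by
  obtain ⟨t, rfl, ht⟩ := nrat_pow hx
  induction g using QuotientGroup.induction_on with | H s =>
  rw [chiK_mk, ← pow_mul]
  have e : 2 * ((Fintype.card F + 1) / 2) = Fintype.card F + 1 := by
    obtain ⟨k, hk⟩ := hq; omega
  obtain ⟨h1, h2⟩ := frob_fix hF t s hg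
  rw [e, pow_succ, ← h2]
  exact lam_prod _ _ _ h1 hg (fun h => ht (coe_eq_coe.1 h))

lemma nrat_P {p f : ℕ} [Fact p.Prime] [CharP F p] (hF : Fintype.card F = p ^ f)
    (x : OnePoint (KK F)) (hx : ¬ IsRat x) (g : PSL2 F)
    (hg : g • x = x) (h1 : chiK x g = 1) : g = 1 := by
  obtain ⟨t, rfl, ht⟩ := nrat_pow hx
  induction g using QuotientGroup.induction_on with | H s =>
  rw [chiK_mk] at h1
  by_contra hne
  rw [psl_mk_eq_one] at hne
  exact ht (coe_eq_coe.1 (lam_uni _ _ _ hg h1 hne (frob_fix hF t s hg).1))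

end ProjLine2

section Cards
open Matrix
open scoped MatrixGroups
variable {F : Type} [Field F] [Fintype F]

lemma card_SL2 : Nat.card SL(2, F) = Fintype.card F * (Fintype.card F ^ 2 - 1) := by
  classical
  set q := Fintype.card F with hq
  have hq2 : 1 < q := Fintype.one_lt_card
  have h1 : Nat.card (GL (Fin 2) F) = (q ^ 2 - 1) * (q ^ 2 - q) := by
    rw [card_GL_field, Fin.prod_univ_two]; simp [← hq]
  let d : GL (Fin 2) F →* Fˣ := GeneralLinearGroup.det
  have hsurj : Function.Surjective d := by
    intro u
    have hdet : (!![(u : F), 0; 0, 1] : Matrix (Fin 2) (Fin 2) F).det = u := by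
      simp [det_fin_two]
    refine ⟨GeneralLinearGroup.mkOfDetNeZero !![(u : F), 0; 0, 1] (by rw [hdet]; exact u.ne_zero), ?_⟩
    exact Units.ext hdet
  have hker : Nat.card d.ker = Nat.card SL(2, F) := by
    have : d.ker = (SpecialLinearGroup.toGL : SL(2, F) →* GL (Fin 2) F).range := by
      ext g
      constructor
      · intro hg
        have h2 := congrArg Units.val (MonoidHom.mem_ker.1 hg)
        exact ⟨⟨g.1, h2⟩, by ext; rfl⟩
      · rintro ⟨s, rfl⟩
        rw [MonoidHom.mem_ker]
        ext
        exact s.2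
    rw [this]
    exact (Nat.card_congr (MonoidHom.ofInjective SpecialLinearGroup.toGL_injective).toEquiv).symm
  have h2 := d.ker.card_mul_index
  rw [Subgroup.index_ker, hker, MonoidHom.range_eq_top.2 hsurj, Subgroup.card_top,
    Nat.card_units, Nat.card_eq_fintype_card (α := F), ← hq, h1] at h2
  have e : q ^ 2 - q = q * (q - 1) := by rw [Nat.mul_sub, pow_two, mul_one]
  rw [e] at h2
  apply Nat.eq_of_mul_eq_mul_right (show 0 < q - 1 by omega)
  rw [h2]; ring

lemma card_center_SL2 {p : ℕ} [CharP F p] (hp : p ≠ 2) :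
    Nat.card (Subgroup.center SL(2, F)) = 2 := by
  rw [Nat.card_congr (SpecialLinearGroup.center_equiv_rootsOfUnity' (0 : Fin 2)).toEquiv]
  have := (IsPrimitiveRoot.neg_one (R := F) p hp).card_rootsOfUnity
  exact this

lemma card_PSL2 {p : ℕ} [CharP F p] (hp : p ≠ 2) :
    2 * Nat.card (PSL2 F) = Fintype.card F * (Fintype.card F ^ 2 - 1) := by
  have := Subgroup.card_eq_card_quotient_mul_card_subgroup (Subgroup.center SL(2, F))
  rw [card_SL2, card_center_SL2 hp] at this
  rw [this, mul_comm]
end Cards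

section ActSec7
variable {Γ : Type} [Group Γ] [Finite Γ] {X : Type} [MulAction Γ X] {K : Type} [Field K]
  {p : ℕ} {χ : X → Γ → K}

lemma Act.c_dvd_m (A : Act Γ X K p χ) {x : X} {m : ℕ}
    (hm : ∀ h : Γ, h • x = x → χ x h ^ m = 1) :
    (A.P x).relIndex (MulAction.stabilizer Γ x) ∣ m := by
  have e : (A.P x).relIndex (MulAction.stabilizer Γ x) = Nat.card (A.hom x).range := by
    rw [← Subgroup.index_ker, Act.P, Subgroup.relIndex, Subgroup.subgroupOf,
      Subgroup.comap_map_eq_self_of_injective (Subgroup.subtype_injective _)]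
  rw [e]
  have hfr : Finite (A.hom x).range :=
    Finite.of_surjective _ (A.hom x).rangeRestrict_surjective
  obtain ⟨⟨_, ⟨g, rfl⟩⟩, hg⟩ := (isCyclic_subgroup_units (A.hom x).range).exists_generator
  rw [← orderOf_eq_card_of_forall_mem_zpowers hg]
  apply orderOf_dvd_of_pow_eq_one
  apply Subtype.ext
  apply Units.ext
  exact hm g g.2

lemma Act.P_pow (A : Act Γ X K p χ) (hpp : p.Prime) (x : X) : ∃ a, Nat.card (A.P x) = p ^ a := by
  have : Fact p.Prime := ⟨hpp⟩
  rw [← IsPGroup.iff_card]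
  intro u
  have := A.mem_P.1 u.2
  exact ⟨1, Subtype.ext (by rw [pow_one]; exact A.exp x u this.1 this.2)⟩
end ActSec7

section Types
open OnePoint
variable {F : Type} [Field F] [Fintype F]

theorem types {p f : ℕ} [Fact p.Prime] [CharP F p] (hp : Odd p) (hp3 : 3 ≤ p) (hf : 0 < f)
    (hF : Fintype.card F = p ^ f) (A : Act (PSL2 F) (OnePoint (KK F)) (KK F) p chiK)
    (H : Subgroup (PSL2 F)) (hH : H ≠ ⊤) :
    (∃ (x : OnePoint (KK F)) (Q c : ℕ), (∀ h ∈ H, h • x = x) ∧ Nat.card H = Q * c ∧ Q ∣ p ^ f ∧ c ∣ (p ^ f - 1) / 2 ∧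
      (Q ≠ 1 → ∃ u ∈ H, u ∈ A.P x ∧ u ≠ 1)) ∨
    (Nat.card H ∣ (p ^ f + 1) / 2) ∨
    (∃ (x : OnePoint (KK F)) (z : ℕ), ¬ p ∣ Nat.card H ∧ 2 * Nat.card (MulAction.stabilizer H x) = Nat.card H ∧
      Nat.card H = 2 * z ∧ (z ∣ (p ^ f - 1) / 2 ∨ z ∣ (p ^ f + 1) / 2) ∧
      (4 < Nat.card H → ∃ a b : H, a * b ≠ b * a)) ∨
    (¬ p ∣ Nat.card H ∧ (Nat.card H = 12 ∨ Nat.card H = 24 ∨ Nat.card H = 60) ∧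
      ∃ a b : H, a * b ≠ b * a) ∨
    (∃ (x : OnePoint (KK F)) (a c : ℕ), 1 ≤ a ∧ a < f ∧ a ∣ f ∧ Nat.card ((A.sub H).P x) = p ^ a ∧
      (MulAction.orbit H x).ncard = p ^ a + 1 ∧
      ((A.sub H).P x).relIndex (MulAction.stabilizer H x) = c ∧
      (c = p ^ a - 1 ∨ 2 * c = p ^ a - 1) ∧ Nat.card H = (p ^ a + 1) * (p ^ a * c)) ∨
    (p = 3 ∧ Nat.card H = 60) := by
  have hpp : p.Prime := Fact.out
  have hqodd : Odd (Fintype.card F) := by rw [hF]; exact hp.pow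
  have hL := card_PSL2 (F := F) (p := p) (by omega)
  rw [hF] at hL
  set q := p ^ f with hq
  have hq3 : 3 ≤ q := hp3.trans (Nat.le_self_pow hf.ne' p)
  have hcH : Nat.card H ∣ Nat.card (PSL2 F) := Subgroup.card_subgroup_dvd_card H
  set A' := A.sub H with hA'
  have hrat : ∀ x : OnePoint (KK F), IsRat x → (A'.P x).relIndex (MulAction.stabilizer H x) ∣ (q - 1) / 2 := by
    intro x hx
    refine A'.c_dvd_m fun h hh => ?_
    rw [← hF]
    exact rat_chi hqodd x hx h hh
  have hnrat : ∀ x : OnePoint (KK F), ¬ IsRat x → A'.P x = ⊥ ∧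
      Nat.card (MulAction.stabilizer H x) ∣ (q + 1) / 2 := by
    intro x hx
    have h1 : A'.P x = ⊥ := by
      rw [Subgroup.eq_bot_iff_forall]
      intro h hh
      have := A'.mem_P.1 hh
      exact Subtype.ext (nrat_P hF x hx h this.1 this.2)
    refine ⟨h1, ?_⟩
    have h2 : (A'.P x).relIndex (MulAction.stabilizer H x) ∣ (q + 1) / 2 := by
      refine A'.c_dvd_m fun h hh => ?_
      rw [← hF]
      exact nrat_chi hF hqodd x hx h hh
    rwa [h1, Subgroup.relIndex_bot_left] at h2
  have hPq : ∀ x : OnePoint (KK F), Nat.card (A'.P x) ∣ q := by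
    intro x
    obtain ⟨a, ha⟩ := A'.P_pow hpp x
    have h1 : Nat.card (A'.P x) ∣ q * (q ^ 2 - 1) := by
      rw [← hL]
      exact ((Subgroup.card_subgroup_dvd_card _).trans hcH).mul_left 2
    rw [ha] at h1 ⊢
    refine Nat.Coprime.dvd_of_dvd_mul_right (Nat.Coprime.pow_left _ ?_) h1
    rw [hpp.coprime_iff_not_dvd]
    intro h2
    have h3 : p ∣ q ^ 2 := (dvd_pow_self p hf.ne').trans (dvd_pow_self q two_ne_zero)
    have h4 := (Nat.dvd_sub_iff_right (Nat.one_le_pow 2 q (by omega)) h3).1 h2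
    exact hpp.one_lt.ne' (Nat.dvd_one.1 h4)
  have hfix : ∀ x : OnePoint (KK F), (∀ h : H, h • x = x) →
    (∃ (x : OnePoint (KK F)) (Q c : ℕ), (∀ h ∈ H, h • x = x) ∧ Nat.card H = Q * c ∧ Q ∣ q ∧ c ∣ (q - 1) / 2 ∧
      (Q ≠ 1 → ∃ u ∈ H, u ∈ A.P x ∧ u ≠ 1)) ∨ (Nat.card H ∣ (q + 1) / 2) := by
    intro x hx
    have htop : MulAction.stabilizer H x = ⊤ := by
      rw [Subgroup.eq_top_iff']; exact hx
    by_cases hr : IsRat x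
    · left
      refine ⟨x, _, _, fun h hh => hx ⟨h, hh⟩, ?_, hPq x, hrat x hr, fun h1 => ?_⟩
      · rw [A'.card_stab x, htop, Subgroup.card_top]
      · have : A'.P x ≠ ⊥ := fun hb => h1 (by rw [hb, Subgroup.card_bot])
        obtain ⟨u, hu⟩ := (A'.P x).ne_bot_iff_exists_ne_one.1 this
        refine ⟨(u : H), (u : H).2, A.mem_P.2 (A'.mem_P.1 u.2), fun h => hu ?_⟩
        exact Subtype.ext (Subtype.ext h)
    · right
      have := (hnrat x hr).2
      rwa [htop, Subgroup.card_top] at this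
  by_cases hpH : p ∣ Nat.card H
  · have : CharP (KK F) p := charP_of_injective_algebraMap (algebraMap F (KK F)).injective p
    obtain ⟨x, hx⟩ := A'.exists_P hpp hpH
    rcases A'.class_div hpp hp3 hx with h1 | ⟨h1, h2⟩ | ⟨h1, h2⟩
    · rcases hfix x h1 with h | h
      · exact Or.inl h
      · exact Or.inr (Or.inl h)
    · right; right; right; right; left
      obtain ⟨a, ha⟩ := A'.P_pow hpp x
      have hr : IsRat x := by
        by_contra hr
        exact hx (hnrat x hr).1
      have hc := hrat x hr
      have hcard := card_orbit_stab (Γ := H) x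
      rw [← A'.card_stab x, h1, ha] at hcard
      rw [ha] at h1 h2
      have haf : a ≤ f := by
        have := hPq x
        rw [ha] at this
        exact (Nat.pow_dvd_pow_iff_le_right hpp.one_lt).1 this
      have ha1 : 1 ≤ a := by
        by_contra h0
        have : a = 0 := by omega
        rw [this, pow_zero] at ha
        exact hx (Subgroup.card_eq_one.1 ha)
      have h2c : 2 * ((q - 1) / 2) = q - 1 := by
        rw [hF] at hqodd
        obtain ⟨k, hk⟩ := hqodd; omega
      have hdv : a ∣ f := by
        have h3 : p ^ a - 1 ∣ p ^ f - 1 := by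
          rw [← hq, ← h2c]
          rcases h2 with h2 | h2
          · rw [← h2]; exact hc.mul_left _
          · rw [← h2]; exact Nat.mul_dvd_mul_left _ hc
        have h4 := Nat.pow_sub_one_gcd_pow_sub_one p a f
        rw [Nat.gcd_eq_left h3] at h4
        have h5 : p ^ (a.gcd f) = p ^ a := by
          have := Nat.one_le_pow a p hpp.pos
          have := Nat.one_le_pow (a.gcd f) p hpp.pos
          omega
        have h6 := Nat.pow_right_injective hpp.two_le h5
        exact Nat.gcd_eq_left_iff_dvd.1 h6
      refine ⟨x, a, _, ha1, lt_of_le_of_ne haf ?_, hdv, ha, h1, rfl, h2, hcard.symm⟩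
      rintro rfl
      apply hH
      have hcc : 2 * (A'.P x).relIndex (MulAction.stabilizer H x) = q - 1 := by
        rcases h2 with h2 | h2
        · exfalso
          rw [h2] at hc
          have := Nat.le_of_dvd (by omega) hc
          omega
        · exact h2
      apply Subgroup.eq_top_of_card_eq
      apply Nat.eq_of_mul_eq_mul_left (show 0 < 2 by norm_num)
      rw [hL, ← hcard]
      have e : q ^ 2 - 1 = (q + 1) * (q - 1) := by
        have := Nat.sq_sub_sq q 1
        simpa using this
      rw [e, ← hcc]; ring
    · right; right; right; right; right
      refine ⟨?_, h2⟩
      have := A'.p_dvd_P hpp hx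
      rw [h1] at this
      exact (Nat.prime_dvd_prime_iff_eq hpp Nat.prime_three).1 this
  · rcases A'.class_prime_to hpp hpH with ⟨x, h1⟩ | ⟨x, h1, h2⟩ | ⟨h1, h2⟩
    · rcases hfix x h1 with h | h
      · exact Or.inl h
      · exact Or.inr (Or.inl h)
    · right; right; left
      refine ⟨x, _, hpH, h1, h1.symm, ?_, h2⟩
      by_cases hr : IsRat x
      · left
        have hb : A'.P x = ⊥ := by
          by_contra hb
          exact hpH ((A'.p_dvd_P hpp hb).trans (Subgroup.card_subgroup_dvd_card _))
        have := hrat x hr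
        rwa [hb, Subgroup.relIndex_bot_left] at this
      · exact Or.inr (hnrat x hr).2
    · exact Or.inr (Or.inr (Or.inr (Or.inl ⟨hpH, h1, h2⟩)))
end Types

section Om

lemma om_mul {a b : ℕ} (ha : a ≠ 0) (hb : b ≠ 0) :
    (a * b).primeFactorsList.length = a.primeFactorsList.length + b.primeFactorsList.length := by
  rw [(Nat.perm_primeFactorsList_mul ha hb).length_eq, List.length_append]

lemma om_pos {a : ℕ} (ha : 2 ≤ a) : 1 ≤ a.primeFactorsList.length := by
  rw [Nat.one_le_iff_ne_zero, Ne, List.length_eq_zero_iff, Nat.primeFactorsList_eq_nil]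
  omega

lemma om_mono {a b : ℕ} (hb : b ≠ 0) (h : a ∣ b) :
    a.primeFactorsList.length ≤ b.primeFactorsList.length := by
  obtain ⟨c, rfl⟩ := h
  rw [om_mul (left_ne_zero_of_mul hb) (right_ne_zero_of_mul hb)]
  omega

lemma om3 {a b c : ℕ} (ha : 2 ≤ a) (hb : 2 ≤ b) (hc : 2 ≤ c) :
    3 ≤ (a * b * c).primeFactorsList.length := by
  have h1 := om_pos ha
  have h2 := om_pos hb
  have h3 := om_pos hc
  rw [om_mul (by positivity) (by omega), om_mul (by omega) (by omega)]
  omega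

/-- a composite times something -/
lemma om3' {a b : ℕ} (ha : 2 ≤ a) (hb : 2 ≤ b) (hnp : ¬ b.Prime) :
    3 ≤ (a * b).primeFactorsList.length := by
  obtain ⟨m, hm, hm2, hm3⟩ := (Nat.not_prime_iff_exists_dvd_lt hb).1 hnp
  obtain ⟨k, rfl⟩ := hm
  rw [← mul_assoc]
  refine om3 ha hm2 ?_
  by_contra hk
  interval_cases k <;> omega

/-- `Ω n ≤ 2`, product of two numbers at least two divides `n`. -/
lemma om_eq {a b n : ℕ} (ha : 2 ≤ a) (hb : 2 ≤ b) (hn : n ≠ 0) (h : a * b ∣ n)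
    (ho : n.primeFactorsList.length ≤ 2) : n = a * b := by
  obtain ⟨c, rfl⟩ := h
  by_contra hne
  have hc : 2 ≤ c := by
    by_contra hk
    interval_cases c <;> simp at hn hne
  have := om3 ha hb hc
  omega

lemma count_sets (l : List (Set ℕ)) : ∀ (S : Set ℕ), (∀ C ∈ l, (S ∩ C).Subsingleton) →
    (∀ n ∈ S, ∃ C ∈ l, n ∈ C) → S.ncard ≤ l.length := by
  induction l with
  | nil =>
    intro S _ h
    have : S = ∅ := by
      ext n; simp only [Set.mem_empty_iff_false, iff_false]
      intro hn; obtain ⟨C, hC, _⟩ := h n hn; simp at hC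
    simp [this]
  | cons C l ih =>
    intro S h1 h2
    by_cases hfin : S.Finite
    · have h3 := Set.ncard_inter_add_ncard_sdiff_eq_ncard S C hfin
      have h4 : (S ∩ C).ncard ≤ 1 :=
        (Set.ncard_le_one (hfin.inter_of_left C)).2 (h1 C (by simp))
      have h5 := ih (S \ C) (fun C' hC' a ha b hb => h1 C' (by simp [hC']) ⟨ha.1.1, ha.2⟩ ⟨hb.1.1, hb.2⟩)
        (fun n hn => by
          obtain ⟨C', hC', hn'⟩ := h2 n hn.1
          rcases List.mem_cons.1 hC' with rfl | h
          · exact absurd hn' hn.2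
          · exact ⟨C', h, hn'⟩)
      rw [List.length_cons]; omega
    · rw [Set.Infinite.ncard hfin]; omega

lemma count_cover {S : Set ℕ}
    (hS : ∀ a ∈ S, ∀ b ∈ S, a ≠ b → (Nat.gcd a b).primeFactorsList.length ≤ 2)
    (l m : List ℕ) (hl : ∀ D ∈ l, 3 ≤ D.primeFactorsList.length)
    (hc : ∀ n ∈ S, (∃ D ∈ l, D ∣ n) ∨ n ∈ m) (hlen : l.length + m.length ≤ 9) :
    S.ncard ≤ 9 := by
  have := count_sets ((l.map fun D => {n | D ∣ n}) ++ m.map fun k => {k}) S ?_ ?_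
  · rw [List.length_append, List.length_map, List.length_map] at this
    omega
  · intro C hC
    rw [List.mem_append, List.mem_map, List.mem_map] at hC
    rcases hC with ⟨D, hD, rfl⟩ | ⟨k, hk, rfl⟩
    · intro a ha b hb
      by_contra hne
      have h1 := hS a ha.1 b hb.1 hne
      have h2 := om_mono (a := D) (b := Nat.gcd a b)
        (by intro h; rw [Nat.gcd_eq_zero_iff] at h; exact hne (h.1.trans h.2.symm))
        (Nat.dvd_gcd ha.2 hb.2)
      have := hl D hD
      omega
    · intro a ha b hb
      exact (Set.mem_singleton_iff.1 ha.2).trans (Set.mem_singleton_iff.1 hb.2).symm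
  · intro n hn
    rcases hc n hn with ⟨D, hD, h⟩ | h
    · exact ⟨{n | D ∣ n}, by simp only [List.mem_append, List.mem_map]; exact Or.inl ⟨D, hD, rfl⟩, h⟩
    · exact ⟨{n}, by simp only [List.mem_append, List.mem_map]; exact Or.inr ⟨n, h, rfl⟩, rfl⟩
end Om

/-- arithmetic shadow of a degree `n` in `B₂` -/
def TT (p f q u v n : ℕ) (P2 : Prop) : Prop :=
  (∃ Q c c' : ℕ, Q ∣ q ∧ c * c' = u ∧ 2 * Q * c' * v ∣ n ∧
    (Q ≠ q → 2 ∣ c → P2 → ((2 * (2 * Q * c' * v) ∣ n ∨ p * (2 * Q * c' * v) ∣ n) ∨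
      n.primeFactorsList.length ≤ 2))) ∨
  (2 * q * u ∣ n) ∨
  (∃ z z' : ℕ, z * z' = u ∧ q * z' * v ∣ n ∧ (2 < z → P2 → 2 * (q * z' * v) ∣ n ∨
      n.primeFactorsList.length ≤ 2)) ∨
  (∃ z z' : ℕ, z * z' = v ∧ q * u * z' ∣ n ∧ (2 < z → P2 → 2 * (q * u * z') ∣ n ∨
      n.primeFactorsList.length ≤ 2)) ∨
  (∃ h i : ℕ, (h = 12 ∨ h = 24 ∨ h = 60) ∧ h * i = 2 * q * u * v ∧ ¬ p ∣ h ∧ i ∣ n ∧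
    (P2 → (2 * i ∣ n ∨ 3 * i ∣ n ∨ 5 * i ∣ n ∨ 7 * i ∣ n) ∨ n.primeFactorsList.length ≤ 2)) ∨
  (∃ a c i : ℕ, 1 ≤ a ∧ a < f ∧ a ∣ f ∧ (c = p ^ a - 1 ∨ 2 * c = p ^ a - 1) ∧
    (p ^ a + 1) * (p ^ a * c) * i = 2 * q * u * v ∧ i ∣ n ∧
    (a = 1 → c = p - 1 → 5 ≤ p → P2 → (2 * i ∣ n ∨ p * i ∣ n) ∨ n.primeFactorsList.length ≤ 2)) ∨
  (p = 3 ∧ ∃ i : ℕ, 60 * i = 2 * q * u * v ∧ i ∣ n)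

section Cover

/-- class I -/
lemma classI {p f q u v : ℕ} (hp : p.Prime) (hqf : q = p ^ f) (hq1 : q ≠ 1) (hvu : v = u + 1) (hu : 6 ≤ u) :
    ∃ l m : List ℕ, l.length + m.length ≤ 3 ∧ (∀ D ∈ l, 3 ≤ D.primeFactorsList.length) ∧
    (¬ v.Prime → l = [2 * v] ∧ m = []) ∧ (v.Prime → l = [4 * v, 2 * v * p] ∧ m = [2 * v]) ∧
    ∀ (P2 : Prop) (n : ℕ), n ≠ 0 → (v.Prime → P2) →
      (∃ Q c c' : ℕ, Q ∣ q ∧ c * c' = u ∧ 2 * Q * c' * v ∣ n ∧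
    (Q ≠ q → 2 ∣ c → P2 → ((2 * (2 * Q * c' * v) ∣ n ∨ p * (2 * Q * c' * v) ∣ n) ∨
      n.primeFactorsList.length ≤ 2))) → (∃ D ∈ l, D ∣ n) ∨ n ∈ m := by
  by_cases hv : v.Prime
  · refine ⟨[4 * v, 2 * v * p], [2 * v], by simp, ?_, fun h => absurd hv h, fun _ => ⟨rfl, rfl⟩, ?_⟩
    · intro D hD
      simp only [List.mem_cons, List.not_mem_nil, or_false] at hD
      rcases hD with rfl | rfl
      · exact om3 (a := 2) (b := 2) le_rfl le_rfl hv.two_le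
      · exact om3 le_rfl hv.two_le hp.two_le
    · rintro P2 n hn hP ⟨Q, c, c', hQ, hc, hd, himp⟩
      have hue : 2 ∣ u := by
        rcases hv.eq_two_or_odd with h | h
        · omega
        · omega
      simp only [List.mem_cons, List.not_mem_nil, or_false, exists_eq_or_imp, exists_eq_left]
      rw [hqf] at hQ
      obtain ⟨k, hk, rfl⟩ := (Nat.dvd_prime_pow hp).1 hQ
      rcases Nat.eq_zero_or_pos k with rfl | hk0
      · simp only [pow_zero, mul_one] at *
        by_cases h2 : 2 ∣ c'
        · left; left
          obtain ⟨e, rfl⟩ := h2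
          exact (Dvd.intro e (by ring)).trans hd
        · have h2c : 2 ∣ c := by
            rw [← hc] at hue
            exact (Nat.prime_two.dvd_mul.1 hue).resolve_right h2
          rcases himp hq1.symm h2c (hP hv) with (h | h) | h
          · left; left
            exact (Dvd.intro c' (by ring)).trans h
          · left; right
            exact (Dvd.intro c' (by ring)).trans h
          · right
            refine om_eq le_rfl hv.two_le hn ((Dvd.intro c' (by ring)).trans hd) h
      · left; right
        obtain ⟨k', rfl⟩ : ∃ k', k = k' + 1 := ⟨k - 1, by omega⟩
        exact (Dvd.intro (p ^ k' * c') (by ring)).trans hd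
  · refine ⟨[2 * v], [], by simp, ?_, fun _ => ⟨rfl, rfl⟩, fun h => absurd h hv, ?_⟩
    · intro D hD
      rw [List.mem_singleton] at hD
      rw [hD]
      exact om3' le_rfl (by omega) hv
    · rintro P2 n hn hP ⟨Q, c, c', hQ, hc, hd, himp⟩
      left
      refine ⟨2 * v, by simp, (Dvd.intro (Q * c') (by ring)).trans hd⟩
end Cover

section CoverF

lemma d_split {p f q u v h i : ℕ} (hp : p.Prime) (hqf : q = p ^ f) (hph : ¬ p ∣ h)
    (hi : h * i = 2 * q * u * v) : ∃ j, i = q * j ∧ h * j = 2 * u * v := by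
  have hco : Nat.Coprime q h := by
    rw [hqf]; exact Nat.Coprime.pow_left _ (hp.coprime_iff_not_dvd.2 hph)
  have h1 : q ∣ h * i := by rw [hi]; exact Dvd.intro (2 * u * v) (by ring)
  obtain ⟨j, rfl⟩ := hco.dvd_of_dvd_mul_left h1
  refine ⟨j, rfl, ?_⟩
  have hq0 : 0 < q := by rw [hqf]; exact pow_pos hp.pos f
  apply Nat.eq_of_mul_eq_mul_left hq0
  calc q * (h * j) = h * (q * j) := by ring
    _ = _ := by rw [hi]; ring

lemma cover_ge3 {p f q u v : ℕ} {S : Set ℕ} (hp : p.Prime) (hp3 : 3 ≤ p) (hqf : q = p ^ f)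
    (hqu : q = 2 * u + 1) (hvu : v = u + 1) (hu : 6 ≤ u) (hf : 3 ≤ f) (P2 : Prop)
    (hS : ∀ a ∈ S, ∀ b ∈ S, a ≠ b → (Nat.gcd a b).primeFactorsList.length ≤ 2)
    (hS0 : ∀ n ∈ S, n ≠ 0) (hT : ∀ n ∈ S, TT p f q u v n P2) (hvp : v.Prime → P2) :
    S.ncard ≤ 9 := by
  obtain ⟨l, m, hlm, hl, -, -, hI⟩ := classI (f := f) hp hqf (by omega) hvu hu
  set D₁ := if f = 3 then p * p * (p ^ 4 + p ^ 2 + 1) else p * p * ((p ^ 4 + 1) / 2) with hD1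
  have hp4 : 81 ≤ p ^ 4 := by
    calc 81 = 3 ^ 4 := by norm_num
      _ ≤ p ^ 4 := Nat.pow_le_pow_left hp3 4
  have hpodd : p % 2 = 1 := by
    rcases hp.eq_two_or_odd with h | h <;> omega
  have hq3 : p * p * p ∣ q := by
    obtain ⟨k, rfl⟩ : ∃ k, f = k + 3 := ⟨f - 3, by omega⟩
    exact Dvd.intro (p ^ k) (by rw [hqf]; ring)
  refine count_cover hS (l ++ [p * p * p, D₁]) m ?_ ?_ ?_
  · intro D hD
    simp only [List.mem_append, List.mem_cons, List.not_mem_nil, or_false] at hD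
    rcases hD with h | rfl | rfl
    · exact hl D h
    · exact om3 hp.two_le hp.two_le hp.two_le
    · rw [hD1]
      split_ifs
      · exact om3 hp.two_le hp.two_le (by omega)
      · exact om3 hp.two_le hp.two_le (by omega)
  · intro n hn
    have key : p * p * p ∣ n ∨ D₁ ∣ n → (∃ D ∈ l ++ [p * p * p, D₁], D ∣ n) ∨ n ∈ m := by
      rintro (h | h)
      · exact Or.inl ⟨_, by simp, h⟩
      · exact Or.inl ⟨_, by simp, h⟩
    rcases hT n hn with h | h | ⟨z, z', h1, h2, h3⟩ | ⟨z, z', h1, h2, h3⟩ | ⟨h, i, h1, h2, h3, h4, h5⟩ |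
      ⟨a, c, i, ha, haf, hdv, hc, hi, hin, -⟩ | ⟨h3, i, hi, hin⟩
    · rcases hI P2 n (hS0 n hn) hvp h with ⟨D, hD, h⟩ | h
      · exact Or.inl ⟨D, by simp [hD], h⟩
      · exact Or.inr h
    · exact key (Or.inl (hq3.trans ((Dvd.intro (2 * u) (by ring)).trans h)))
    · exact key (Or.inl (hq3.trans ((Dvd.intro (z' * v) (by ring)).trans h2)))
    · exact key (Or.inl (hq3.trans ((Dvd.intro (u * z') (by ring)).trans h2)))
    · obtain ⟨j, rfl, -⟩ := d_split hp hqf h3 h2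
      exact key (Or.inl (hq3.trans ((Dvd.intro j rfl).trans h4)))
    · -- subfield
      have h4uv : 2 * (2 * q * u * v) = p ^ f * (p ^ f * p ^ f - 1) := by
        rw [← hqf]
        have : q * q - 1 = 4 * (u * v) := by
          rw [hqu, hvu]
          have : (2 * u + 1) * (2 * u + 1) = 4 * (u * (u + 1)) + 1 := by ring
          omega
        rw [this]; ring
      obtain ⟨b, rfl⟩ := hdv
      have hb : 2 ≤ b := by
        by_contra hb
        interval_cases b <;> omega
      have hpa : 1 ≤ p ^ a := Nat.one_le_pow _ _ hp.pos
      obtain ⟨w, hw⟩ : ∃ w, p ^ a = w + 1 := ⟨p ^ a - 1, by omega⟩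
      have hw0 : 0 < w := by
        have : p ^ 1 ≤ p ^ a := Nat.pow_le_pow_right hp.pos ha
        rw [pow_one] at this; omega
      by_cases h3 : a + 3 ≤ a * b
      · left
        refine ⟨p * p * p, by simp, Dvd.dvd.trans ?_ hin⟩
        have e1 : p * p * p * p ^ a ∣ (p ^ a + 1) * (p ^ a * c) * i := by
          rw [hi]
          refine Dvd.dvd.trans ?_ (Dvd.intro (2 * u * v) (show q * (2 * u * v) = _ by ring))
          rw [hqf]
          obtain ⟨k, hk⟩ : ∃ k, a * b = a + 3 + k := ⟨_, (Nat.add_sub_cancel' h3).symm⟩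
          rw [hk]
          exact Dvd.intro (p ^ k) (by ring)
        have e2 : p * p * p ∣ ((p ^ a + 1) * c) * i := by
          apply Nat.dvd_of_mul_dvd_mul_right (show 0 < p ^ a by omega)
          refine e1.trans (dvd_of_eq (by ring))
        refine Nat.Coprime.dvd_of_dvd_mul_left ?_ e2
        have hpc : Nat.Coprime p ((p ^ a + 1) * c) := by
          have hpd : p ∣ p ^ a := dvd_pow_self p (by omega)
          rw [hp.coprime_iff_not_dvd, hp.dvd_mul]
          rintro (h | h)
          · have := (Nat.dvd_add_right hpd).1 h
            exact hp.one_lt.ne' (Nat.dvd_one.1 this)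
          · have h' : p ∣ p ^ a - 1 := by
              rcases hc with hc | hc
              · rwa [← hc]
              · rw [← hc]; exact h.mul_left 2
            have := (Nat.dvd_sub_iff_right hpa hpd).1 h'
            exact hp.one_lt.ne' (Nat.dvd_one.1 this)
        have := hpc.pow_left 3
        rwa [show p ^ 3 = p * p * p by ring] at this
      · refine key (Or.inr (Dvd.dvd.trans ?_ hin))
        have hab : a * b < a + 3 := by omega
        have ha2 : a ≤ 2 := by nlinarith
        interval_cases a
        · -- a = 1, f = 3
          have hb3 : b = 3 := by omega
          subst hb3
          simp only [pow_one, one_mul] at *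
          rw [hD1, if_pos trivial]
          have e : p ^ 3 * (p ^ 3 * p ^ 3 - 1) = (p * p * (p ^ 4 + p ^ 2 + 1)) * ((p + 1) * (p * w)) := by
            rw [hw]
            have : (w + 1) ^ 3 * (w + 1) ^ 3 - 1 = ((w + 1) ^ 4 + (w + 1) ^ 2 + 1) * ((w + 2) * w) := by
              have : (w + 1) ^ 3 * (w + 1) ^ 3 = ((w + 1) ^ 4 + (w + 1) ^ 2 + 1) * ((w + 2) * w) + 1 := by ring
              omega
            rw [this]; ring
          rw [← hi, e] at h4uv
          have hpos : 0 < (p + 1) * (p * w) := by positivity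
          rcases hc with hc | hc
          · exfalso
            have hcw : c = w := by omega
            rw [hcw] at h4uv
            have e2 : 2 * i = p * p * (p ^ 4 + p ^ 2 + 1) := by
              apply Nat.eq_of_mul_eq_mul_right hpos
              rw [← h4uv]; ring
            have : Odd (p * p * (p ^ 4 + p ^ 2 + 1)) := by
              have hpo : Odd p := Nat.odd_iff.2 hpodd
              exact (hpo.mul hpo).mul (Even.add_one (hpo.pow.add_odd hpo.pow))
            rw [← e2] at this
            exact absurd this (by simp)
          · have hcw : 2 * c = w := by omega
            have e2 : i = p * p * (p ^ 4 + p ^ 2 + 1) := by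
              apply Nat.eq_of_mul_eq_mul_right hpos
              rw [← h4uv, ← hcw]; ring
            rw [e2]
        · -- a = 2, f = 4
          have hb2 : b = 2 := by omega
          subst hb2
          rw [hD1, if_neg (by norm_num)]
          have hodd4 : 2 * ((p ^ 4 + 1) / 2) = p ^ 4 + 1 := by
            have hpo : Odd p := Nat.odd_iff.2 hpodd
            have := (hpo.pow (n := 4)).add_one
            obtain ⟨k, hk⟩ := this
            omega
          have e : p ^ (2 * 2) * (p ^ (2 * 2) * p ^ (2 * 2) - 1) =
              (p * p * (p ^ 4 + 1)) * ((p ^ 2 + 1) * (p ^ 2 * w)) := by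
            have h1 : p ^ (2 * 2) = (w + 1) * (w + 1) := by rw [← hw]; ring
            have h2 : p ^ 4 = (w + 1) * (w + 1) := by rw [← hw]; ring
            have h3 : p * p = w + 1 := by rw [← hw]; ring
            rw [h1, h3, hw]
            have : (w + 1) * (w + 1) * ((w + 1) * (w + 1)) - 1 = ((w + 1) * (w + 1) + 1) * ((w + 2) * w) := by
              have : (w + 1) * (w + 1) * ((w + 1) * (w + 1)) = ((w + 1) * (w + 1) + 1) * ((w + 2) * w) + 1 := by ring
              omega
            rw [this]; ring
          rw [← hi, e] at h4uv
          have hpos : 0 < (p ^ 2 + 1) * (p ^ 2 * w) := by positivity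
          rcases hc with hc | hc
          · have hcw : c = w := by omega
            rw [hcw] at h4uv
            have e2 : 2 * i = p * p * (p ^ 4 + 1) := by
              apply Nat.eq_of_mul_eq_mul_right hpos
              rw [← h4uv]; ring
            have e3 : i = p * p * ((p ^ 4 + 1) / 2) := by
              apply Nat.eq_of_mul_eq_mul_left (show 0 < 2 by norm_num)
              rw [e2, ← hodd4]; simp only [Nat.mul_div_cancel_left _ (show 0 < 2 by norm_num)]; ring
            rw [e3]
          · have hcw : 2 * c = w := by omega
            have e2 : i = p * p * (p ^ 4 + 1) := by
              apply Nat.eq_of_mul_eq_mul_right hpos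
              rw [← h4uv, ← hcw]; ring
            rw [e2]
            exact Nat.mul_dvd_mul_left _ (Dvd.intro_left 2 hodd4)
    · subst h3
      left
      by_cases hf3 : f = 3
      · exfalso
        subst hf3
        norm_num at hqf
        have hu13 : u = 13 := by omega
        rw [hqf, hvu, hu13] at hi
        omega
      · obtain ⟨k, rfl⟩ : ∃ k, f = k + 4 := ⟨f - 4, by omega⟩
        refine ⟨3 * 3 * 3, by simp, Dvd.dvd.trans ?_ hin⟩
        have e : 20 * i = 27 * (2 * (3 ^ k * u * v)) := by
          have : 60 * i = 3 * (27 * (2 * (3 ^ k * u * v))) := by rw [hi, hqf]; ring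
          omega
        have : 27 ∣ 20 * i := ⟨_, e⟩
        exact Nat.Coprime.dvd_of_dvd_mul_left (by norm_num) this
  · simp only [List.length_append, List.length_cons, List.length_nil]; omega
end CoverF

section CoverF2

lemma sq_mod24 {p : ℕ} (h2 : p % 2 = 1) (h3 : p % 3 ≠ 0) : p * p % 24 = 1 := by
  have h : p % 24 < 24 := Nat.mod_lt _ (by norm_num)
  have e2 : p % 24 % 2 = 1 := by omega
  have e3 : p % 24 % 3 ≠ 0 := by omega
  rw [Nat.mul_mod]
  generalize p % 24 = r at *
  interval_cases r <;> simp_all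

lemma cover_2 {p q u v : ℕ} {S : Set ℕ} (hp : p.Prime) (hp5 : 5 ≤ p) (hqf : q = p ^ 2)
    (hqu : q = 2 * u + 1) (hvu : v = u + 1) (hu : 6 ≤ u) (P2 : Prop)
    (hS : ∀ a ∈ S, ∀ b ∈ S, a ≠ b → (Nat.gcd a b).primeFactorsList.length ≤ 2)
    (hS0 : ∀ n ∈ S, n ≠ 0) (hT : ∀ n ∈ S, TT p 2 q u v n P2) (hP2 : P2) :
    S.ncard ≤ 9 := by
  obtain ⟨l, m, hlm, hl, hl1, hl2, hI⟩ := classI (f := 2) hp hqf (by omega) hvu hu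
  have hp0 := hp.pos
  have hpodd : p % 2 = 1 := by
    rcases hp.eq_two_or_odd with h | h <;> omega
  have hp3 : p % 3 ≠ 0 := by
    intro h
    have := (Nat.prime_dvd_prime_iff_eq Nat.prime_three hp).1 (Nat.dvd_of_mod_eq_zero h)
    omega
  have h24 := sq_mod24 hpodd hp3
  obtain ⟨u', hu'⟩ : ∃ u', u = 12 * u' := by
    rw [← pow_two, ← hqf] at h24
    exact ⟨u / 12, by omega⟩
  -- common consequence
  have hred : ∀ n ∈ S, ((∃ D ∈ l, D ∣ n) ∨ n ∈ m) ∨ 2 * p * p ∣ n ∨ p * p * v ∣ n ∨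
      2 * p * v ∣ n ∨ (p * v ∣ n ∧ n.primeFactorsList.length ≤ 2) := by
    intro n hn
    rcases hT n hn with h | h | ⟨z, z', h1, h2, h3⟩ | ⟨z, z', h1, h2, h3⟩ | ⟨h, i, h1, h2, h3, h4, h5⟩ |
      ⟨a, c, i, ha, haf, hdv, hc, hi, hin, hpgl⟩ | ⟨h3, i, hi, hin⟩
    · exact Or.inl (hI P2 n (hS0 n hn) (fun _ => hP2) h)
    · right; left
      exact (Dvd.intro u (by rw [hqf]; ring)).trans h
    · right; right; left
      exact (Dvd.intro z' (by rw [hqf]; ring)).trans h2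
    · right; left
      exact (Dvd.intro (6 * u' * z') (by rw [hqf, hu']; ring)).trans h2
    · obtain ⟨j, rfl, hj⟩ := d_split hp hqf h3 h2
      have e : 2 * u * v = 24 * (u' * v) := by rw [hu']; ring
      rw [e] at hj
      rcases h1 with rfl | rfl | rfl
      · right; right; left
        have : j = 2 * (u' * v) := by omega
        exact (Dvd.intro (2 * u') (by rw [this, hqf]; ring)).trans h4
      · right; right; left
        have : j = (u' * v) := by omega
        exact (Dvd.intro u' (by rw [this, hqf]; ring)).trans h4
      · right; left
        obtain ⟨k, hk⟩ : ∃ k, j = 2 * k := ⟨j / 2, by omega⟩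
        exact (Dvd.intro k (by rw [hk, hqf]; ring)).trans h4
    · have ha1 : a = 1 := by omega
      subst ha1
      simp only [pow_one] at *
      obtain ⟨w, hw⟩ : ∃ w, p = w + 1 := ⟨p - 1, by omega⟩
      have e : 2 * (2 * q * u * v) = (2 * (p * v)) * ((p + 1) * (p * w)) := by
        have h2u : 2 * u = (p + 1) * w := by
          have : 2 * u + 1 = (p + 1) * w + 1 := by rw [← hqu, hqf, hw]; ring
          omega
        calc 2 * (2 * q * u * v) = 2 * q * (2 * u) * v := by ring
          _ = _ := by rw [h2u, hqf]; ring
      rw [← hi] at e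
      have hpos : 0 < (p + 1) * (p * w) := Nat.mul_pos (by omega) (Nat.mul_pos hp0 (by omega))
      rcases hc with hc | hc
      · have hcw : c = w := by omega
        rw [hcw] at e
        have hi2 : i = p * v := by
          have : 2 * i = 2 * (p * v) := by
            apply Nat.eq_of_mul_eq_mul_right hpos
            rw [← e]; ring
          omega
        rw [hi2] at hpgl hin
        rcases hpgl trivial hc hp5 hP2 with (h | h) | h
        · right; right; right; left
          rwa [← mul_assoc] at h
        · right; right; left
          rwa [← mul_assoc] at h
        · right; right; right; right
          exact ⟨hin, h⟩
      · have hcw : 2 * c = w := by omega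
        have hi2 : i = 2 * p * v := by
          apply Nat.eq_of_mul_eq_mul_right hpos
          have e' : (p + 1) * (p * (2 * c)) * i = 2 * p * v * ((p + 1) * (p * w)) := by
            calc _ = 2 * ((p + 1) * (p * c) * i) := by ring
              _ = _ := by rw [e]; ring
          rw [hcw] at e'
          rw [← e']; ring
        right; right; right; left
        rwa [hi2] at hin
    · omega
  by_cases hv : v.Prime
  · refine count_cover hS (l ++ [2 * p * p, p * p * v, 2 * p * v]) (m ++ [p * v]) ?_ ?_ ?_
    · intro D hD
      simp only [List.mem_append, List.mem_cons, List.not_mem_nil, or_false] at hD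
      rcases hD with h | rfl | rfl | rfl
      · exact hl D h
      · exact om3 le_rfl hp.two_le hp.two_le
      · exact om3 hp.two_le hp.two_le hv.two_le
      · exact om3 le_rfl hp.two_le hv.two_le
    · intro n hn
      rcases hred n hn with (⟨D, hD, h⟩ | h) | h | h | h | ⟨h, h'⟩
      · exact Or.inl ⟨D, by simp [hD], h⟩
      · exact Or.inr (by simp [h])
      · exact Or.inl ⟨_, by simp, h⟩
      · exact Or.inl ⟨_, by simp, h⟩
      · exact Or.inl ⟨_, by simp, h⟩
      · right
        rw [om_eq hp.two_le hv.two_le (hS0 n hn) h h']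
        simp
    · simp only [List.length_append, List.length_cons, List.length_nil]; omega
  · have hD := om3' hp.two_le (by omega) hv
    refine count_cover hS (l ++ [2 * p * p, p * v]) m ?_ ?_ ?_
    · intro D hD'
      simp only [List.mem_append, List.mem_cons, List.not_mem_nil, or_false] at hD'
      rcases hD' with h | rfl | rfl
      · exact hl D h
      · exact om3 le_rfl hp.two_le hp.two_le
      · exact hD
    · intro n hn
      rcases hred n hn with (⟨D, hD, h⟩ | h) | h | h | h | ⟨h, h'⟩
      · exact Or.inl ⟨D, by simp [hD], h⟩
      · exact Or.inr (by simp [h])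
      · exact Or.inl ⟨_, by simp, h⟩
      · exact Or.inl ⟨p * v, by simp, (Dvd.intro p (by ring)).trans h⟩
      · exact Or.inl ⟨p * v, by simp, (Dvd.intro 2 (by ring)).trans h⟩
      · exact Or.inl ⟨p * v, by simp, h⟩
    · simp only [List.length_append, List.length_cons, List.length_nil]; omega
end CoverF2

section CoverF1

/-- a divisor that handles the group of order `h` -/
lemma getD {p k w : ℕ} (hk : 0 < k) (hp : 2 ≤ p) (h : ∀ j, k * j = w → 2 ≤ j ∧ ¬ j.Prime) :
    ∃ D : ℕ, 3 ≤ D.primeFactorsList.length ∧ ∀ j, k * j = w → D = p * j := by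
  by_cases hex : ∃ j, k * j = w
  · obtain ⟨j, hj⟩ := hex
    refine ⟨p * j, om3' hp (h j hj).1 (h j hj).2, fun j' hj' => ?_⟩
    rw [Nat.eq_of_mul_eq_mul_left hk (hj.trans hj'.symm)]
  · exact ⟨2 * 2 * 2, om3 le_rfl le_rfl le_rfl, fun j hj => absurd ⟨j, hj⟩ hex⟩

lemma prime_ndvd {r h : ℕ} (hr : r.Prime) (hr7 : 7 ≤ r) (hh : h = 12 ∨ h = 24 ∨ h = 60) : ¬ r ∣ h := by
  intro hd
  have h60 : r ∣ 2 * 2 * 2 * 3 * 5 := by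
    rcases hh with rfl | rfl | rfl
    · exact hd.trans (by norm_num)
    · exact hd.trans (by norm_num)
    · exact hd.trans (by norm_num)
  rw [hr.dvd_mul, hr.dvd_mul, hr.dvd_mul, hr.dvd_mul] at h60
  rcases h60 with (((h | h) | h) | h) | h <;> have := Nat.le_of_dvd (by norm_num) h <;> omega

lemma cover_1 {p u v : ℕ} {S : Set ℕ} (hp : p.Prime)
    (hqu : p = 2 * u + 1) (hvu : v = u + 1) (hu : 6 ≤ u) (P2 : Prop)
    (hS : ∀ a ∈ S, ∀ b ∈ S, a ≠ b → (Nat.gcd a b).primeFactorsList.length ≤ 2)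
    (hS0 : ∀ n ∈ S, n ≠ 0) (hT : ∀ n ∈ S, TT p 1 p u v n P2) (hP2 : P2) :
    S.ncard ≤ 9 := by
  obtain ⟨l, m, hlm, hl, hl1, hl2, hI⟩ := classI (p := p) (f := 1) (q := p) hp (by ring) (by omega) hvu hu
  have hp0 := hp.pos
  by_cases hv : v.Prime
  · have hue : u % 2 = 0 := by
      rcases hv.eq_two_or_odd with h | h <;> omega
    obtain ⟨u', hu'⟩ : ∃ u', u = 2 * u' := ⟨u / 2, by omega⟩
    obtain ⟨el, em⟩ := hl2 hv
    refine count_cover hS (l ++ [p * u, p * v * u', 3 * p * v, 5 * p * v, 7 * p * v])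
      (m ++ [p * v]) ?_ ?_ ?_
    · intro D hD
      simp only [List.mem_append, List.mem_cons, List.not_mem_nil, or_false] at hD
      rcases hD with h | rfl | rfl | rfl | rfl | rfl
      · exact hl D h
      · rw [hu', ← mul_assoc]; exact om3 hp.two_le le_rfl (by omega)
      · exact om3 hp.two_le hv.two_le (by omega)
      · exact om3 (by norm_num) hp.two_le hv.two_le
      · exact om3 (by norm_num) hp.two_le hv.two_le
      · exact om3 (by norm_num) hp.two_le hv.two_le
    · intro n hn
      have hlow : n.primeFactorsList.length ≤ 2 → p * v ∣ n → n ∈ m ++ [p * v] := by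
        intro h1 h2
        rw [om_eq hp.two_le hv.two_le (hS0 n hn) h2 h1]; simp
      have h2pv : 2 * v * p ∈ l := by rw [el]; simp
      rcases hT n hn with h | h | ⟨z, z', h1, h2, h3⟩ | ⟨z, z', h1, h2, h3⟩ | ⟨h, i, h1, h2, h3, h4, h5⟩ |
        ⟨a, c, i, ha, haf, hdv, hc, hi, hin, hpgl⟩ | ⟨h3, i, hi, hin⟩
      · rcases hI P2 n (hS0 n hn) (fun _ => hP2) h with ⟨D, hD, h⟩ | h
        · exact Or.inl ⟨D, by simp [hD], h⟩
        · exact Or.inr (by simp [h])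
      · exact Or.inl ⟨p * u, by simp, (Dvd.intro 2 (by ring)).trans h⟩
      · have hz : z ≠ 0 := by rintro rfl; omega
        rcases Nat.lt_or_ge 2 z with hz2 | hz2
        · rcases h3 hz2 hP2 with h | h
          · exact Or.inl ⟨2 * v * p, by simp [h2pv], (Dvd.intro z' (by ring)).trans h⟩
          · exact Or.inr (hlow h ((Dvd.intro z' (by ring)).trans h2))
        · have : z = 1 ∨ z = 2 := by omega
          rcases this with rfl | rfl
          · have : z' = u := by omega
            exact Or.inl ⟨p * u, by simp, (Dvd.intro v (by rw [this])).trans h2⟩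
          · have : z' = u' := by omega
            exact Or.inl ⟨p * v * u', by simp, (Dvd.intro 1 (by rw [this]; ring)).trans h2⟩
      · exact Or.inl ⟨p * u, by simp, (Dvd.intro z' (by ring)).trans h2⟩
      · obtain ⟨j, rfl, hj⟩ := d_split (f := 1) hp (by ring) h3 h2
        have hvj : v ∣ j := by
          refine Nat.Coprime.dvd_of_dvd_mul_left
            (hv.coprime_iff_not_dvd.2 (prime_ndvd hv (by omega) h1)) ?_
          exact Dvd.intro_left _ hj.symm
        obtain ⟨k, rfl⟩ := hvj
        rcases h5 hP2 with (h | h | h | h) | h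
        · exact Or.inl ⟨2 * v * p, by simp [h2pv], (Dvd.intro k (by ring)).trans h⟩
        · exact Or.inl ⟨3 * p * v, by simp, (Dvd.intro k (by ring)).trans h⟩
        · exact Or.inl ⟨5 * p * v, by simp, (Dvd.intro k (by ring)).trans h⟩
        · exact Or.inl ⟨7 * p * v, by simp, (Dvd.intro k (by ring)).trans h⟩
        · exact Or.inr (hlow h ((Dvd.intro k (by ring)).trans h4))
      · omega
      · omega
    · simp only [List.length_append, List.length_cons, List.length_nil]; omega
  obtain ⟨el, em⟩ := hl1 hv
  have hpv := om3' hp.two_le (show 2 ≤ v by omega) hv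
  by_cases huP : u.Prime
  · have hue : u % 2 = 1 := by
      rcases huP.eq_two_or_odd with h | h <;> omega
    obtain ⟨v', hv'⟩ : ∃ v', v = 2 * v' := ⟨v / 2, by omega⟩
    refine count_cover hS (l ++ [p * v, 2 * p * u, p * u * v', 3 * p * u, 5 * p * u, 7 * p * u])
      (m ++ [p * u]) ?_ ?_ ?_
    · intro D hD
      simp only [List.mem_append, List.mem_cons, List.not_mem_nil, or_false] at hD
      rcases hD with h | rfl | rfl | rfl | rfl | rfl | rfl
      · exact hl D h
      · exact hpv
      · exact om3 (by norm_num) hp.two_le huP.two_le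
      · exact om3 hp.two_le huP.two_le (by omega)
      · exact om3 (by norm_num) hp.two_le huP.two_le
      · exact om3 (by norm_num) hp.two_le huP.two_le
      · exact om3 (by norm_num) hp.two_le huP.two_le
    · intro n hn
      have hlow : n.primeFactorsList.length ≤ 2 → p * u ∣ n → n ∈ m ++ [p * u] := by
        intro h1 h2
        rw [om_eq hp.two_le huP.two_le (hS0 n hn) h2 h1]; simp
      rcases hT n hn with h | h | ⟨z, z', h1, h2, h3⟩ | ⟨z, z', h1, h2, h3⟩ | ⟨h, i, h1, h2, h3, h4, h5⟩ |
        ⟨a, c, i, ha, haf, hdv, hc, hi, hin, hpgl⟩ | ⟨h3, i, hi, hin⟩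
      · rcases hI P2 n (hS0 n hn) (fun _ => hP2) h with ⟨D, hD, h⟩ | h
        · exact Or.inl ⟨D, by simp [hD], h⟩
        · exact Or.inr (by simp [h])
      · exact Or.inl ⟨2 * p * u, by simp, h⟩
      · exact Or.inl ⟨p * v, by simp, (Dvd.intro z' (by ring)).trans h2⟩
      · have hz : z ≠ 0 := by rintro rfl; omega
        rcases Nat.lt_or_ge 2 z with hz2 | hz2
        · rcases h3 hz2 hP2 with h | h
          · exact Or.inl ⟨2 * p * u, by simp, (Dvd.intro z' (by ring)).trans h⟩
          · exact Or.inr (hlow h ((Dvd.intro z' (by ring)).trans h2))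
        · have : z = 1 ∨ z = 2 := by omega
          rcases this with rfl | rfl
          · have : z' = 2 * v' := by omega
            exact Or.inl ⟨2 * p * u, by simp, (Dvd.intro v' (by rw [this]; ring)).trans h2⟩
          · have : z' = v' := by omega
            exact Or.inl ⟨p * u * v', by simp, (Dvd.intro 1 (by rw [this]; ring)).trans h2⟩
      · obtain ⟨j, rfl, hj⟩ := d_split (f := 1) hp (by ring) h3 h2
        have huj : u ∣ j := by
          refine Nat.Coprime.dvd_of_dvd_mul_left
            (huP.coprime_iff_not_dvd.2 (prime_ndvd huP (by omega) h1)) ?_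
          exact Dvd.intro (2 * v) (by rw [hj]; ring)
        obtain ⟨k, rfl⟩ := huj
        rcases h5 hP2 with (h | h | h | h) | h
        · exact Or.inl ⟨2 * p * u, by simp, (Dvd.intro k (by ring)).trans h⟩
        · exact Or.inl ⟨3 * p * u, by simp, (Dvd.intro k (by ring)).trans h⟩
        · exact Or.inl ⟨5 * p * u, by simp, (Dvd.intro k (by ring)).trans h⟩
        · exact Or.inl ⟨7 * p * u, by simp, (Dvd.intro k (by ring)).trans h⟩
        · exact Or.inr (hlow h ((Dvd.intro k (by ring)).trans h4))
      · omega
      · omega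
    · rw [el, em]; simp only [List.length_append, List.length_cons, List.length_nil]; omega
  -- neither prime
  have hpu := om3' hp.two_le (show 2 ≤ u by omega) huP
  have aux : ∀ j, j.Prime → (j ∣ u * v) → (∃ k, u = j * k) ∨ ∃ k, v = j * k := by
    intro j hj h
    rcases hj.dvd_mul.1 h with ⟨k, hk⟩ | ⟨k, hk⟩
    · exact Or.inl ⟨k, hk⟩
    · exact Or.inr ⟨k, hk⟩
  have huv : 42 ≤ u * v := Nat.mul_le_mul hu (show 7 ≤ v by omega)
  obtain ⟨D12, hD12, hD12'⟩ := getD (p := p) (k := 6) (w := u * v) (by norm_num) hp.two_le (by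
    intro j hj
    refine ⟨by omega, fun hjp => ?_⟩
    rcases aux j hjp (Dvd.intro_left _ hj) with ⟨k, hk⟩ | ⟨k, hk⟩
    · have : k * v = 6 := by
        apply Nat.eq_of_mul_eq_mul_left hjp.pos
        rw [← mul_assoc, ← hk, ← hj]; ring
      have := Nat.le_of_dvd (by norm_num) (Dvd.intro_left _ this)
      omega
    · have e : u * k = 6 := by
        apply Nat.eq_of_mul_eq_mul_left hjp.pos
        rw [mul_left_comm, ← hk, ← hj]; ring
      have := Nat.le_of_dvd (by norm_num) (Dvd.intro _ e)
      have hu6 : u = 6 := by omega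
      apply hv; rw [hvu, hu6]; norm_num)
  obtain ⟨D24, hD24, hD24'⟩ := getD (p := p) (k := 12) (w := u * v) (by norm_num) hp.two_le (by
    intro j hj
    refine ⟨by omega, fun hjp => ?_⟩
    rcases aux j hjp (Dvd.intro_left _ hj) with ⟨k, hk⟩ | ⟨k, hk⟩
    · have e : v * k = 12 := by
        apply Nat.eq_of_mul_eq_mul_left hjp.pos
        rw [mul_left_comm, ← hk, mul_comm, ← hj]; ring
      have h12 := Nat.le_of_dvd (by norm_num) (Dvd.intro _ e)
      have hk1 : k = 1 := by
        have : k < 2 := by by_contra hk2; nlinarith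
        have : k ≠ 0 := by rintro rfl; omega
        omega
      apply huP; rw [hk, hk1, mul_one]; exact hjp
    · have e : u * k = 12 := by
        apply Nat.eq_of_mul_eq_mul_left hjp.pos
        rw [mul_left_comm, ← hk, ← hj]; ring
      have hk1 : k = 1 ∨ k = 2 := by
        have : k < 3 := by by_contra hk2; nlinarith
        have : k ≠ 0 := by rintro rfl; omega
        omega
      apply hv
      rcases hk1 with rfl | rfl
      · have : u = 12 := by omega
        rw [hvu, this]; norm_num
      · have : u = 6 := by omega
        rw [hvu, this]; norm_num)
  -- reduction
  have hred : ∀ n ∈ S, 2 * v ∣ n ∨ p * u ∣ n ∨ p * v ∣ n ∨ D24 ∣ n ∨ (∃ j, 6 * j = u * v ∧ p * j ∣ n) ∨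
      ∃ j, 30 * j = u * v ∧ p * j ∣ n ∧ ((2 * (p * j) ∣ n ∨ 3 * (p * j) ∣ n ∨ 5 * (p * j) ∣ n ∨
        7 * (p * j) ∣ n) ∨ n.primeFactorsList.length ≤ 2) := by
    intro n hn
    rcases hT n hn with h | h | ⟨z, z', h1, h2, h3⟩ | ⟨z, z', h1, h2, h3⟩ | ⟨h, i, h1, h2, h3, h4, h5⟩ |
        ⟨a, c, i, ha, haf, hdv, hc, hi, hin, hpgl⟩ | ⟨h3, i, hi, hin⟩
    · rcases hI P2 n (hS0 n hn) (fun _ => hP2) h with ⟨D, hD, h⟩ | h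
      · left
        rw [el, List.mem_singleton] at hD
        rwa [hD] at h
      · rw [em] at h; simp at h
    · right; left; exact (Dvd.intro 2 (by ring)).trans h
    · right; right; left; exact (Dvd.intro z' (by ring)).trans h2
    · right; left; exact (Dvd.intro z' (by ring)).trans h2
    · obtain ⟨j, rfl, hj⟩ := d_split (f := 1) hp (by ring) h3 h2
      rw [mul_assoc] at hj
      rcases h1 with rfl | rfl | rfl
      · right; right; right; right; left
        exact ⟨j, by omega, h4⟩
      · right; right; right; left
        rw [hD24' j (by omega)]; exact h4
      · right; right; right; right; right
        exact ⟨j, by omega, h4, h5 hP2⟩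
    · omega
    · omega
  by_cases hex : ∃ j, 30 * j = u * v ∧ j.Prime
  · obtain ⟨j, hj, hjp⟩ := hex
    refine count_cover hS [2 * v, p * u, p * v, D24, 2 * p * j, 3 * p * j, 5 * p * j, 7 * p * j]
      [p * j] ?_ ?_ (by simp)
    · intro D hD
      simp only [List.mem_append, List.mem_cons, List.not_mem_nil, or_false] at hD
      rcases hD with rfl | rfl | rfl | rfl | rfl | rfl | rfl | rfl
      · exact om3' le_rfl (by omega) hv
      · exact hpu
      · exact hpv
      · exact hD24
      · exact om3 (by norm_num) hp.two_le hjp.two_le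
      · exact om3 (by norm_num) hp.two_le hjp.two_le
      · exact om3 (by norm_num) hp.two_le hjp.two_le
      · exact om3 (by norm_num) hp.two_le hjp.two_le
    · intro n hn
      rcases hred n hn with h | h | h | h | ⟨k, hk, h⟩ | ⟨k, hk, h, h'⟩
      · exact Or.inl ⟨_, by simp, h⟩
      · exact Or.inl ⟨p * u, by simp, h⟩
      · exact Or.inl ⟨p * v, by simp, h⟩
      · exact Or.inl ⟨D24, by simp, h⟩
      · have : k = 5 * j := by omega
        exact Or.inl ⟨5 * p * j, by simp, (dvd_of_eq (by rw [this]; ring)).trans h⟩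
      · have : k = j := by omega
        subst this
        simp only [← mul_assoc] at h'
        rcases h' with (h' | h' | h' | h') | h'
        · exact Or.inl ⟨2 * p * k, by simp, h'⟩
        · exact Or.inl ⟨3 * p * k, by simp, h'⟩
        · exact Or.inl ⟨5 * p * k, by simp, h'⟩
        · exact Or.inl ⟨7 * p * k, by simp, h'⟩
        · right
          rw [List.mem_singleton]
          exact om_eq hp.two_le hjp.two_le (hS0 n hn) h h'
  · obtain ⟨D60, hD60, hD60'⟩ := getD (p := p) (k := 30) (w := u * v) (by norm_num) hp.two_le (by
      intro j hj
      exact ⟨by omega, fun hjp => hex ⟨j, hj, hjp⟩⟩)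
    refine count_cover hS [2 * v, p * u, p * v, D24, D12, D60] [] ?_ ?_ (by simp)
    · intro D hD
      simp only [List.mem_append, List.mem_cons, List.not_mem_nil, or_false] at hD
      rcases hD with rfl | rfl | rfl | rfl | rfl | rfl
      · exact om3' le_rfl (by omega) hv
      · exact hpu
      · exact hpv
      · exact hD24
      · exact hD12
      · exact hD60
    · intro n hn
      left
      rcases hred n hn with h | h | h | h | ⟨k, hk, h⟩ | ⟨k, hk, h, h'⟩
      · exact ⟨_, by simp, h⟩
      · exact ⟨p * u, by simp, h⟩
      · exact ⟨p * v, by simp, h⟩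
      · exact ⟨D24, by simp, h⟩
      · exact ⟨D12, by simp, by rw [hD12' k hk]; exact h⟩
      · exact ⟨D60, by simp, by rw [hD60' k hk]; exact h⟩
end CoverF1

lemma pow2_of_prime {p f u : ℕ} (hp3 : 3 ≤ p) (hpo : Odd p) (hf : 0 < f) (hqu : p ^ f = 2 * u + 1)
    (hv : (u + 1).Prime) : ∃ k, f = 2 ^ k := by
  obtain ⟨k, m, hm, rfl⟩ := Nat.exists_eq_two_pow_mul_odd hf.ne'
  refine ⟨k, ?_⟩
  set x := p ^ 2 ^ k with hx
  have hx3 : 3 ≤ x := hp3.trans (Nat.le_self_pow (by positivity) p)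
  rw [pow_mul, ← hx] at hqu
  obtain ⟨w, hw⟩ : x + 1 ∣ x ^ m + 1 := by
    have := Odd.nat_add_dvd_pow_add_pow x 1 hm
    rwa [one_pow] at this
  obtain ⟨y, hy⟩ : ∃ y, x = 2 * y + 1 := (hpo.pow (n := 2 ^ k))
  have e : u + 1 = (y + 1) * w := by
    have : 2 * (u + 1) = 2 * ((y + 1) * w) := by
      calc 2 * (u + 1) = x ^ m + 1 := by omega
        _ = _ := by rw [hw, hy]; ring
    omega
  have hm1 : m = 1 := by
    have hyw : y + 1 = u + 1 ∨ y + 1 = 1 := by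
      have := (Nat.dvd_prime hv).1 (Dvd.intro w e.symm)
      tauto
    rcases hyw with h | h
    · have h1 : x ^ m = x ^ 1 := by rw [hqu, pow_one]; omega
      exact Nat.pow_right_injective (by omega : 2 ≤ x) h1
    · omega
  rw [hm1, mul_one]

section Final
variable {G : Type} [Group G] [Finite G] {F : Type} [Field F] [Fintype F]
  {M : Subgroup G} [M.Normal] {π : M →* PSL2 F} {H : Subgroup (PSL2 F)} {n : ℕ}

lemma Dat.pos {L : Type} [Group L] [Finite L] {π : M →* L} {H : Subgroup L}
    (h : Dat M π H n) : n ≠ 0 := by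
  obtain ⟨V, _, _, _, R, ψ, X, W, rfl, hR, -⟩ := h
  have := hR.finrank_pos
  rw [finrank_top] at this
  omega

theorem Dat.toTT (h : Dat M π H n) (hπ : Function.Surjective π) (hG : TwoPrimeHypothesis G)
    (hH : H ≠ ⊤) {p f u : ℕ} [Fact p.Prime] [CharP F p] (hp : Odd p) (hp3 : 3 ≤ p) (hf : 0 < f)
    (hF : Fintype.card F = p ^ f) (hqu : p ^ f = 2 * u + 1) (hu : 6 ≤ u)
    (h2 : (∃ k, f = 2 ^ k) → IsPGroup 2 (G ⧸ M)) :
    TT p f (p ^ f) u (u + 1) n (∃ k, f = 2 ^ k) := by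
  have hpp : p.Prime := Fact.out
  have A := act_psl (F := F) (p := p) hp
  obtain ⟨-, hin⟩ := h.basic hπ
  have hL := card_PSL2 (F := F) (p := p) (by omega)
  have hq0 : 0 < p ^ f := pow_pos hpp.pos f
  have hhi : Nat.card H * H.index = 2 * p ^ f * u * (u + 1) := by
    have h1 := H.card_mul_index
    rw [hF] at hL
    have e : (p ^ f) ^ 2 - 1 = 4 * (u * (u + 1)) := by
      rw [hqu]
      have : (2 * u + 1) ^ 2 = 4 * (u * (u + 1)) + 1 := by ring
      omega
    rw [e, ← h1] at hL
    have : 2 * (Nat.card H * H.index) = 2 * (2 * p ^ f * u * (u + 1)) := by rw [hL]; ring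
    omega
  have hT := types hp hp3 hf hF A H hH
  have e1 : (p ^ f - 1) / 2 = u := by omega
  have e2 : (p ^ f + 1) / 2 = u + 1 := by omega
  rw [e1, e2] at hT
  have hH0 : 0 < Nat.card H := Nat.card_pos
  rcases hT with ⟨x, Q, c, hx, hc, ⟨Q', hQ⟩, ⟨c', hc'⟩, hP⟩ | ⟨w, hw⟩ | ⟨x, z, hpH, hx, hz, hd, hna⟩ |
    ⟨hpH, hc, hna⟩ | ⟨x, a, c, ha, haf, hdv, hPa, ho, hr, hc, hcard⟩ | ⟨hp3, hc⟩
  · left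
    have hi : H.index = 2 * Q' * c' * (u + 1) := by
      apply Nat.eq_of_mul_eq_mul_left hH0
      rw [hhi, hc, hQ]
      nth_rw 1 [hc']
      ring
    refine ⟨Q', c, c', Dvd.intro_left _ hQ.symm, hc'.symm, hi ▸ hin, fun h1 h2c hP2 => ?_⟩
    rw [← hi]
    refine h.caseI_act hπ hG (h2 hP2) A hpp hp hx (hP ?_) ?_
    · rintro rfl; rw [one_mul] at hQ; exact h1 hQ.symm
    · rw [hc]; exact h2c.mul_left Q
  · right; left
    refine Dvd.dvd.trans ⟨w, ?_⟩ hin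
    apply Nat.eq_of_mul_eq_mul_left hH0
    rw [hhi, hw]; ring
  · have key : ∀ z, Nat.card H = 2 * z → 2 < z → (∃ k, f = 2 ^ k) → 2 * H.index ∣ n ∨
        n.primeFactorsList.length ≤ 2 := by
      intro z hz h2z hP2
      exact h.dihedral_act hπ hG (h2 hP2) A hpp hpH hx (hna (by omega))
    have hz0 : 0 < z := by omega
    rcases hd with ⟨z', hz'⟩ | ⟨z', hz'⟩
    · right; right; left
      have hi : H.index = p ^ f * z' * (u + 1) := by
        apply Nat.eq_of_mul_eq_mul_left hH0
        rw [hhi, hz]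
        nth_rw 1 [hz']
        ring
      refine ⟨z, z', hz'.symm, hi ▸ hin, fun h1 hP2 => ?_⟩
      rw [← hi]
      exact key z hz h1 hP2
    · right; right; right; left
      have hi : H.index = p ^ f * u * z' := by
        apply Nat.eq_of_mul_eq_mul_left hH0
        rw [hhi, hz, hz']
        ring
      refine ⟨z, z', hz'.symm, hi ▸ hin, fun h1 hP2 => ?_⟩
      rw [← hi]
      exact key z hz h1 hP2
  · right; right; right; right; left
    refine ⟨_, _, hc, hhi, hpH, hin, fun hP2 => ?_⟩
    obtain ⟨a, b, hab⟩ := hna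
    refine h.small hπ hG (h2 hP2) ⟨a, a.2, b, b.2, fun he => hab (Subtype.ext he)⟩ (by omega)
  · right; right; right; right; right; left
    refine ⟨a, c, H.index, ha, haf, hdv, hc, by rw [← hcard, hhi], hin, fun ha1 hc1 hp5 hP2 => ?_⟩
    subst ha1
    rw [pow_one] at hPa ho
    exact h.pgl_act hπ hG (h2 hP2) A hpp hp5 hPa ho (hr.trans hc1)
  · right; right; right; right; right; right
    exact ⟨hp3, _, by rw [← hc, hhi], hin⟩

theorem final_of_B (p f : ℕ) (hp : p.Prime) (hodd : Odd p) (hq : 13 ≤ p ^ f)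
    [CharP F p] (hF : Fintype.card F = p ^ f) (hG : TwoPrimeHypothesis G)
    (N : Subgroup G) [N.Normal] (hNM : N ≤ M) (π : M →* PSL2 F) (hπ : Function.Surjective π)
    (hker : ∀ m : M, π m = 1 ↔ (m : G) ∈ N) (hB : ∀ g : G, g ^ (2 * f) ∈ M) :
    {n | ∃ θ : FDRep ℂ N, Simple θ ∧ ¬ IsMInvariant M θ ∧
      n ∈ charDegreesOver G N θ ∧ n ∉ charDegrees (G ⧸ N)}.ncard ≤ 9 := by
  have : Fact p.Prime := ⟨hp⟩
  have hp3 : 3 ≤ p := by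
    have := hp.two_le
    rcases hodd with ⟨k, hk⟩; omega
  have hf : 0 < f := by
    rcases Nat.eq_zero_or_pos f with rfl | h
    · norm_num at hq
    · exact h
  obtain ⟨u, hqu⟩ : ∃ u, p ^ f = 2 * u + 1 := hodd.pow
  have hu : 6 ≤ u := by omega
  have h2 : (∃ k, f = 2 ^ k) → IsPGroup 2 (G ⧸ M) := by
    rintro ⟨k, rfl⟩ g
    obtain ⟨g, rfl⟩ := QuotientGroup.mk_surjective g
    refine ⟨k + 1, ?_⟩
    rw [← QuotientGroup.mk_pow, QuotientGroup.eq_one_iff]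
    have := hB g
    rwa [← pow_succ'] at this
  set S := {n | ∃ θ : FDRep ℂ N, Simple θ ∧ ¬ IsMInvariant M θ ∧
      n ∈ charDegreesOver G N θ ∧ n ∉ charDegrees (G ⧸ N)} with hSdef
  have hD : ∀ n ∈ S, ∃ H : Subgroup (PSL2 F), H ≠ ⊤ ∧ Dat M π H n := by
    rintro n ⟨θ, hθ, hinv, hn, -⟩
    exact entry hNM π hker θ hθ hinv hn
  have hS0 : ∀ n ∈ S, n ≠ 0 := fun n hn => by
    obtain ⟨H, -, h⟩ := hD n hn
    exact h.pos
  have hS : ∀ a ∈ S, ∀ b ∈ S, a ≠ b → (Nat.gcd a b).primeFactorsList.length ≤ 2 := by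
    intro a ha b hb hab
    obtain ⟨H, -, h⟩ := hD a ha
    obtain ⟨H', -, h'⟩ := hD b hb
    exact hG a (h.basic hπ).1 b (h'.basic hπ).1 hab
  have hT : ∀ n ∈ S, TT p f (p ^ f) u (u + 1) n (∃ k, f = 2 ^ k) := by
    intro n hn
    obtain ⟨H, hH, h⟩ := hD n hn
    exact h.toTT hπ hG hH hodd hp3 hf hF hqu hu h2
  by_cases hf3 : 3 ≤ f
  · exact cover_ge3 hp hp3 rfl hqu rfl hu hf3 _ hS hS0 hT
      (fun hv => pow2_of_prime hp3 hodd hf hqu hv)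
  have hf12 : f = 1 ∨ f = 2 := by omega
  rcases hf12 with rfl | rfl
  · rw [pow_one] at hqu hT
    exact cover_1 hp hqu rfl hu _ hS hS0 hT ⟨0, by norm_num⟩
  · have hp5 : 5 ≤ p := by
      by_contra hlt
      interval_cases p <;> omega
    exact cover_2 hp hp5 rfl hqu rfl hu _ hS hS0 hT ⟨1, by norm_num⟩
end Final

section PSLAut
open Matrix
open scoped MatrixGroups
variable {F : Type} [Field F]

/-- upper unipotent -/
def uu (a : F) : SL(2, F) := ⟨!![1, a; 0, 1], by simp [det_fin_two]⟩
/-- lower unipotent -/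
def ll (a : F) : SL(2, F) := ⟨!![1, 0; a, 1], by simp [det_fin_two]⟩
/-- projection -/
abbrev fi : SL(2, F) →* PSL2 F := QuotientGroup.mk' _
/-- upper unipotent in the quotient -/
def UU (a : F) : PSL2 F := fi (uu a)
/-- lower unipotent in the quotient -/
def LL (a : F) : PSL2 F := fi (ll a)

@[simp] lemma uu00 (a : F) : uu a 0 0 = 1 := rfl
@[simp] lemma uu01 (a : F) : uu a 0 1 = a := rfl
@[simp] lemma uu10 (a : F) : uu a 1 0 = 0 := rfl
@[simp] lemma uu11 (a : F) : uu a 1 1 = 1 := rfl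
@[simp] lemma ll00 (a : F) : ll a 0 0 = 1 := rfl
@[simp] lemma ll01 (a : F) : ll a 0 1 = 0 := rfl
@[simp] lemma ll10 (a : F) : ll a 1 0 = a := rfl
@[simp] lemma ll11 (a : F) : ll a 1 1 = 1 := rfl

lemma sl_det2 (s : SL(2, F)) : s 0 0 * s 1 1 - s 0 1 * s 1 0 = 1 := by
  classical exact sl_det s

lemma sl_mul2 (s s' : SL(2, F)) (i j : Fin 2) :
    (s * s') i j = s i 0 * s' 0 j + s i 1 * s' 1 j := by
  classical exact sl_mul_apply s s' i j

lemma sl_ext2 {s t : SL(2, F)} (h0 : s 0 0 = t 0 0) (h1 : s 0 1 = t 0 1) (h2 : s 1 0 = t 1 0)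
    (h3 : s 1 1 = t 1 1) : s = t := by
  ext i j
  fin_cases i <;> fin_cases j
  · exact h0
  · exact h1
  · exact h2
  · exact h3

lemma fi_eq {X Y : SL(2, F)} (h : fi X = fi Y) :
    ∃ e : F, (e = 1 ∨ e = -1) ∧ ∀ i j, Y i j = e * X i j := by
  have h1 : X⁻¹ * Y ∈ Subgroup.center SL(2, F) := QuotientGroup.eq.1 h
  set Z := X⁻¹ * Y with hZ
  have hY : Y = X * Z := by rw [hZ]; group
  rw [sl_center_iff] at h1
  obtain ⟨h01, h10, h00⟩ := h1
  have hd := sl_det2 Z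
  refine ⟨Z 0 0, ?_, ?_⟩
  · have : (Z 0 0 - 1) * (Z 0 0 + 1) = 0 := by
      rw [h01, ← h00] at hd; linear_combination hd
    rcases mul_eq_zero.1 this with h | h
    · left; linear_combination h
    · right; linear_combination h
  · intro i j
    rw [hY, sl_mul2]
    fin_cases j
    · simp [h10]; ring
    · simp [h01, ← h00]; ring

lemma uu_add (a b : F) : uu (a + b) = uu a * uu b := by
  apply sl_ext2 <;> rw [sl_mul2] <;> simp <;> ring

lemma ll_add (a b : F) : ll (a + b) = ll a * ll b := by
  apply sl_ext2 <;> rw [sl_mul2] <;> simp <;> ring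

lemma UU_add (a b : F) : UU (a + b) = UU a * UU b := by rw [UU, uu_add, map_mul]; rfl
lemma LL_add (a b : F) : LL (a + b) = LL a * LL b := by rw [LL, ll_add, map_mul]; rfl


lemma UU_inj (h2 : (2 : F) ≠ 0) {a b : F} (h : UU a = UU b) : a = b := by
  obtain ⟨e, he, h1⟩ := fi_eq h
  have e0 := h1 0 0
  have e1 := h1 0 1
  simp only [uu00, uu01] at e0 e1
  rw [mul_one] at e0
  rw [← e0, one_mul] at e1
  exact e1.symm

lemma LL_inj (h2 : (2 : F) ≠ 0) {a b : F} (h : LL a = LL b) : a = b := by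
  obtain ⟨e, he, h1⟩ := fi_eq h
  have e0 := h1 0 0
  have e1 := h1 1 0
  simp only [ll00, ll10] at e0 e1
  rw [mul_one] at e0
  rw [← e0, one_mul] at e1
  exact e1.symm

lemma LL_eq_UU (h2 : (2 : F) ≠ 0) {a b : F} (h : LL a = UU b) : a = 0 := by
  obtain ⟨e, he, h1⟩ := fi_eq h
  have e0 := h1 0 0
  have e1 := h1 1 0
  simp only [ll00, ll10, uu00, uu10] at e0 e1
  rw [mul_one] at e0
  rw [← e0, one_mul] at e1
  exact e1.symm

lemma rel1 (h2 : (2 : F) ≠ 0) {s : SL(2, F)} {t r : F} (ht : t ≠ 0) (h : fi s * UU t = LL r * fi s) : s 0 0 = 0 := by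
  rw [UU, LL, ← map_mul, ← map_mul] at h
  obtain ⟨e, he, h1⟩ := fi_eq h
  have e0 := h1 0 0
  have e1 := h1 0 1
  simp only [sl_mul2, uu00, uu01, uu10, uu11, ll00, ll01, ll10, ll11] at e0 e1
  rcases he with rfl | rfl
  · have : s 0 0 * t = 0 := by linear_combination -e1
    exact (mul_eq_zero.1 this).resolve_right ht
  · have : 2 * s 0 0 = 0 := by linear_combination e0
    exact (mul_eq_zero.1 this).resolve_left h2


lemma rel2 {s : SL(2, F)} (hs : s 0 0 = 0) (t : F) :
    fi s * UU t = LL (-(s 1 0) ^ 2 * t) * fi s := by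
  rw [UU, LL, ← map_mul, ← map_mul]
  congr 1
  have hd := sl_det2 s
  rw [hs] at hd
  apply sl_ext2 <;> simp only [sl_mul2, uu00, uu01, uu10, uu11, ll00, ll01, ll10, ll11, hs]
  · ring
  · ring
  · ring
  · linear_combination (-(s 1 0) * t) * hd

lemma rel0 {s : SL(2, F)} (hs : s 1 0 = 0) (t : F) :
    fi s * UU t = UU ((s 0 0) ^ 2 * t) * fi s := by
  rw [UU, UU, ← map_mul, ← map_mul]
  congr 1
  have hd := sl_det2 s
  rw [hs] at hd
  apply sl_ext2 <;> simp only [sl_mul2, uu00, uu01, uu10, uu11, ll00, ll01, ll10, ll11, hs]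
  · ring
  · linear_combination (-(s 0 0) * t) * hd
  · ring
  · ring

/-- automorphisms agreeing on unipotents -/
lemma psl_hom_ext {A : Type} [Group A] (φ ψ : PSL2 F →* A) (hU : ∀ a, φ (UU a) = ψ (UU a))
    (hL : ∀ a, φ (LL a) = ψ (LL a)) (x : PSL2 F) : φ x = ψ x := by
  have key : ∀ s : SL(2, F), s 1 0 ≠ 0 → φ (fi s) = ψ (fi s) := by
    intro s hs
    have e : s = uu ((s 0 0 - 1) / s 1 0) * ll (s 1 0) * uu ((s 1 1 - 1) / s 1 0) := by
      have hd := sl_det2 s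
      apply sl_ext2 <;> simp only [sl_mul2, uu00, uu01, uu10, uu11, ll00, ll01, ll10, ll11]
      · field_simp; ring
      · field_simp; linear_combination -hd
      · ring
      · field_simp; ring
    rw [e]
    simp only [map_mul]
    have h1 := hU ((s 0 0 - 1) / s 1 0)
    have h2 := hU ((s 1 1 - 1) / s 1 0)
    have h3 := hL (s 1 0)
    rw [UU] at h1 h2
    rw [LL] at h3
    rw [h1, h2, h3]
  obtain ⟨s, rfl⟩ := QuotientGroup.mk'_surjective _ x
  by_cases hs : s 1 0 = 0
  · have h1 := key (ll 1 * s) (by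
      have hd := sl_det2 s
      rw [hs] at hd
      simp only [sl_mul2, ll10, ll11, hs]
      intro h0
      have : s 0 0 = 0 := by linear_combination h0
      rw [this] at hd; simp at hd)
    rw [map_mul, map_mul, map_mul] at h1
    have h3 := hL 1
    rw [LL] at h3
    rw [h3] at h1
    exact mul_left_cancel h1
  · exact key s hs

/-- main relation -/
lemma aut_rel (h2 : (2 : F) ≠ 0) (σ : PSL2 F ≃* PSL2 F) {α β : F → F}
    (hα : ∀ a, σ (UU a) = UU (α a)) (hβ : ∀ a, σ (LL a) = LL (β a)) :
    (∀ a b, α (a + b) = α a + α b) ∧ (∀ a b, β (a + b) = β a + β b) ∧ (∀ a, a ≠ 0 → α a ≠ 0) ∧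
    (∀ a, a ≠ 0 → β a⁻¹ = (α a)⁻¹) ∧ ∀ a, a ≠ 0 → β ((a ^ 2)⁻¹) = ((α a) ^ 2)⁻¹ * α 1 := by
  have ha : ∀ a b, α (a + b) = α a + α b := fun a b => by
    apply UU_inj h2; rw [← hα, UU_add, map_mul, hα, hα, UU_add]
  have hb : ∀ a b, β (a + b) = β a + β b := fun a b => by
    apply LL_inj h2; rw [← hβ, LL_add, map_mul, hβ, hβ, LL_add]
  have ha0 : α 0 = 0 := by have := ha 0 0; rw [add_zero] at this; exact left_eq_add.1 this
  have hb0 : β 0 = 0 := by have := hb 0 0; rw [add_zero] at this; exact left_eq_add.1 this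
  have hbn : ∀ a, β (-a) = - β a := fun a => by
    have := hb a (-a); rw [add_neg_cancel, hb0] at this; linear_combination -this
  have han : ∀ a, a ≠ 0 → α a ≠ 0 := by
    intro a h h0
    apply h
    apply UU_inj h2
    apply σ.injective
    rw [hα, hα, h0, ha0]
  have main : ∀ a, a ≠ 0 → β (-a⁻¹) = -(α a)⁻¹ ∧ β (-(a⁻¹) ^ 2 * 1) = -((α a)⁻¹) ^ 2 * α 1 := by
    intro a h0
    have hm : ∀ a b : F, (uu a * ll b * uu a) 0 0 = 1 + a * b := by
      intro a b; simp only [sl_mul2, uu00, uu01, uu10, uu11, ll00, ll01, ll10, ll11]; ring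
    have hm' : ∀ a b : F, (uu a * ll b * uu a) 1 0 = b := by
      intro a b; simp only [sl_mul2, uu00, uu01, uu10, uu11, ll00, ll01, ll10, ll11]; ring
    have hs : ∀ a b : F, fi (uu a * ll b * uu a) = UU a * LL b * UU a := by
      intro a b; rw [map_mul, map_mul]; rfl
    have h1 := rel2 (s := uu a * ll (-a⁻¹) * uu a) (by rw [hm]; field_simp; ring) 1
    rw [hm', hs] at h1
    have h3 := congrArg σ h1
    simp only [map_mul, hα, hβ] at h3
    rw [← hs] at h3
    have h4 := rel1 h2 (han 1 one_ne_zero) h3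
    have h5 := rel2 h4 (α 1)
    rw [hm] at h4
    rw [hm'] at h5
    have e1 : β (-a⁻¹) = -(α a)⁻¹ := by
      have := han a h0
      apply mul_left_cancel₀ this
      rw [mul_neg, mul_inv_cancel₀ this]
      linear_combination h4
    refine ⟨e1, ?_⟩
    have h6 := LL_inj h2 (mul_right_cancel (h3.symm.trans h5))
    rw [e1, neg_sq, neg_sq] at h6
    exact h6
  refine ⟨ha, hb, han, fun a h => ?_, fun a h => ?_⟩
  · have := (main a h).1
    rw [hbn] at this
    exact neg_injective this
  · have := (main a h).2
    rw [mul_one, hbn, inv_pow, inv_pow, neg_mul] at this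
    exact neg_injective this

lemma aut_semi (h2 : (2 : F) ≠ 0) (σ : PSL2 F ≃* PSL2 F) {α β : F → F}
    (hα : ∀ a, σ (UU a) = UU (α a)) (hβ : ∀ a, σ (LL a) = LL (β a)) :
    ∃ (c : F) (τ : F →+* F), c ≠ 0 ∧ ∀ a, α a = c * τ a := by
  obtain ⟨ha, hb, han, h3, h4⟩ := aut_rel h2 σ hα hβ
  have hc := han 1 one_ne_zero
  have ha0 : α 0 = 0 := by have := ha 0 0; rw [add_zero] at this; exact left_eq_add.1 this
  have hsq : ∀ a, α (a ^ 2) * α 1 = α a ^ 2 := by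
    intro a
    by_cases h : a = 0
    · rw [h]; simp [ha0]
    · have e1 := h3 (a ^ 2) (pow_ne_zero 2 h)
      rw [h4 a h] at e1
      have := han a h
      have := han _ (pow_ne_zero 2 h)
      field_simp at e1
      linear_combination e1
  have hmul : ∀ a b, α (a * b) * α 1 = α a * α b := by
    intro a b
    have e1 := hsq (a + b)
    have e : (a + b) ^ 2 = a ^ 2 + (a * b + (a * b + b ^ 2)) := by ring
    rw [e, ha, ha, ha, ha] at e1
    have e2 := hsq a
    have e3 := hsq b
    apply mul_left_cancel₀ h2
    linear_combination e1 - e2 - e3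
  refine ⟨α 1, ⟨⟨⟨fun a => α a / α 1, by field_simp⟩, fun a b => ?_⟩, by simp [ha0], fun a b => ?_⟩,
    hc, fun a => ?_⟩
  · have := hmul a b
    show α (a * b) / α 1 = α a / α 1 * (α b / α 1)
    field_simp
    exact this
  · show α (a + b) / α 1 = α a / α 1 + α b / α 1
    rw [ha, add_div]
  · show α a = α 1 * (α a / α 1)
    field_simp

end PSLAut

section PSLAut2
open Matrix
open scoped MatrixGroups
variable {F : Type} [Field F]

lemma rel0' {s : SL(2, F)} (hs : s 0 1 = 0) (t : F) :
    fi s * LL t = LL ((s 1 1) ^ 2 * t) * fi s := by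
  rw [LL, LL, ← map_mul, ← map_mul]
  congr 1
  have hd := sl_det2 s
  rw [hs] at hd
  apply sl_ext2 <;> simp only [sl_mul2, uu00, uu01, uu10, uu11, ll00, ll01, ll10, ll11, hs]
  · ring
  · ring
  · linear_combination (-(s 1 1) * t) * hd
  · ring

lemma UU_zero : (UU 0 : PSL2 F) = 1 := by
  have := UU_add (0 : F) 0
  rw [add_zero] at this
  exact left_eq_mul.1 this

lemma LL_zero : (LL 0 : PSL2 F) = 1 := by
  have := LL_add (0 : F) 0
  rw [add_zero] at this
  exact left_eq_mul.1 this

/-- the upper unipotent subgroup as a homomorphism -/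
def UUhom (F : Type) [Field F] : Multiplicative F →* PSL2 F where
  toFun a := UU a.toAdd
  map_one' := UU_zero
  map_mul' a b := UU_add _ _

variable [Fintype F]

lemma sylow_conj (p f : ℕ) (hp : p.Prime) [CharP F p] (hodd : p ≠ 2) (h2 : (2 : F) ≠ 0)
    (hF : Fintype.card F = p ^ f) (σ : MulAut (PSL2 F)) :
    ∃ g : PSL2 F, ∀ a : F, ∃ b : F, σ (UU a) = g * UU b * g⁻¹ := by
  have hpf : Fact p.Prime := ⟨hp⟩
  set H : Subgroup (PSL2 F) := (UUhom F).range with hH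
  have hinj : Function.Injective (UUhom F) := fun a b h => UU_inj h2 h
  have hcard : Nat.card H = p ^ f := by
    rw [← hF, ← Nat.card_eq_fintype_card]
    exact (Nat.card_congr (MonoidHom.ofInjective hinj).toEquiv).symm
  have hcp := card_PSL2 (F := F) (p := p) hodd
  have hv : (Nat.card (PSL2 F)).factorization p = f := by
    have hf : f ≠ 0 := by
      rintro rfl
      have := Fintype.one_lt_card (α := F)
      rw [hF, pow_zero] at this
      omega
    rw [hF] at hcp
    have hq1 : 1 < p ^ f := Nat.one_lt_pow hf hp.one_lt
    have hpos : (p ^ f) ^ 2 - 1 ≠ 0 := by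
      have : 1 < (p ^ f) ^ 2 := Nat.one_lt_pow two_ne_zero hq1
      omega
    have hnd : ¬ p ∣ (p ^ f) ^ 2 - 1 := by
      intro h
      have h1 : p ∣ (p ^ f) ^ 2 := (dvd_pow_self p hf).trans (dvd_pow_self _ two_ne_zero)
      have h3 := (Nat.dvd_sub_iff_right (by omega) h1).1 h
      exact hp.one_lt.ne' (Nat.dvd_one.1 h3)
    have hnd2 : ¬ p ∣ 2 := fun h => hodd ((Nat.prime_dvd_prime_iff_eq hp Nat.prime_two).1 h)
    have h4 := congrArg (fun n => n.factorization p) hcp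
    rw [Nat.factorization_mul two_ne_zero Nat.card_pos.ne',
      Nat.factorization_mul (by omega) hpos, Finsupp.add_apply, Finsupp.add_apply,
      Nat.factorization_eq_zero_of_not_dvd hnd, Nat.factorization_eq_zero_of_not_dvd hnd2,
      hp.factorization_pow] at h4
    simpa using h4
  have hcard2 : Nat.card (H.map σ.toMonoidHom) = p ^ f := by
    rw [← hcard]
    exact (Nat.card_congr (H.equivMapOfInjective _ σ.injective).toEquiv).symm
  let P := Sylow.ofCard H (by rw [hv, hcard])
  let Q := Sylow.ofCard (H.map σ.toMonoidHom) (by rw [hv, hcard2])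
  obtain ⟨g, hg⟩ := MulAction.exists_smul_eq (PSL2 F) P Q
  refine ⟨g, fun a => ?_⟩
  have h1 : σ (UU a) ∈ (Q : Subgroup (PSL2 F)) :=
    ⟨UU a, ⟨Multiplicative.ofAdd a, rfl⟩, rfl⟩
  rw [← hg, Sylow.coe_subgroup_smul] at h1
  obtain ⟨y, ⟨b, rfl⟩, h3⟩ := h1
  exact ⟨b.toAdd, h3.symm⟩

lemma conj_eq {x g y : PSL2 F} (h : x * g = y * x) : MulAut.conj x g = y := by
  rw [MulAut.conj_apply, h, mul_inv_cancel_right]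

lemma psl_normalize (p f : ℕ) (hp : p.Prime) [CharP F p] (hodd : p ≠ 2) (h2 : (2 : F) ≠ 0)
    (hF : Fintype.card F = p ^ f) (σ : MulAut (PSL2 F)) :
    ∃ (g : PSL2 F) (α β : F → F), (∀ a, (MulAut.conj g * σ) (UU a) = UU (α a)) ∧
      ∀ a, (MulAut.conj g * σ) (LL a) = LL (β a) := by
  obtain ⟨g, hg⟩ := sylow_conj p f hp hodd h2 hF σ
  choose α hα using hg
  set σ1 : MulAut (PSL2 F) := MulAut.conj g⁻¹ * σ with hσ1
  have h1 : ∀ a, σ1 (UU a) = UU (α a) := by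
    intro a
    rw [hσ1, MulAut.mul_apply, hα, MulAut.conj_apply]; group
  have hαi : Function.Injective α := by
    intro a b h
    apply UU_inj h2
    apply σ1.injective
    rw [h1, h1, h]
  have hαs := Finite.injective_iff_surjective.1 hαi
  set w : SL(2, F) := ⟨!![0, 1; -1, 0], by simp [det_fin_two]⟩ with hw
  have hwL : ∀ a, MulAut.conj (fi w) (UU a) = LL (-a) := by
    intro a
    apply conj_eq
    rw [rel2 (s := w) rfl]
    have : w 1 0 = -1 := rfl
    rw [this]
    congr 2
    ring
  obtain ⟨k, hk⟩ := sylow_conj p f hp hodd h2 hF (σ1 * MulAut.conj (fi w))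
  choose γ hγ using hk
  have hL : ∀ a, σ1 (LL a) = k * UU (γ (-a)) * k⁻¹ := by
    intro a
    have := hγ (-a)
    rwa [MulAut.mul_apply, hwL, neg_neg] at this
  obtain ⟨s, rfl⟩ := QuotientGroup.mk'_surjective _ k
  by_cases hs : s 1 0 = 0
  · exfalso
    have h3 := hL 1
    rw [rel0 hs, mul_inv_cancel_right] at h3
    obtain ⟨b, hb⟩ := hαs (s 0 0 ^ 2 * γ (-1))
    rw [← hb, ← h1] at h3
    exact one_ne_zero (LL_eq_UU h2 (σ1.injective h3))
  · set c : F := -(s 0 0) / s 1 0 with hc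
    refine ⟨UU c * g⁻¹, α, fun a => -((uu c * s) 1 0) ^ 2 * γ (-a), fun a => ?_, fun a => ?_⟩
    · rw [map_mul, mul_assoc, ← hσ1, MulAut.mul_apply, h1]
      apply conj_eq
      rw [← UU_add, add_comm, UU_add]
    · rw [map_mul, mul_assoc, ← hσ1, MulAut.mul_apply, hL]
      apply conj_eq
      have h4 := rel2 (s := uu c * s) (by
        rw [sl_mul2, uu00, uu01, hc]; field_simp; ring) (γ (-a))
      rw [map_mul] at h4
      have h5 : fi (uu c) = UU c := rfl
      rw [h5] at h4
      rw [← mul_assoc, ← mul_assoc, h4]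
      group

lemma sig_iter (σ : MulAut (PSL2 F)) {E : F → PSL2 F} {α : F → F} (hα : ∀ a, σ (E a) = E (α a))
    (k : ℕ) (a : F) : (σ ^ k) (E a) = E (α^[k] a) := by
  induction k generalizing a with
  | zero => rfl
  | succ k ih => rw [pow_succ, MulAut.mul_apply, hα, ih, Function.iterate_succ_apply]

lemma ringhom_iter (p f : ℕ) (hp : p.Prime) [CharP F p] (hF : Fintype.card F = p ^ f)
    (τ : F →+* F) (a : F) : τ^[f] a = a := by
  have hpf : Fact p.Prime := ⟨hp⟩
  let _ : Algebra (ZMod p) F := ZMod.algebra F p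
  have hcomm : (τ.comp (algebraMap (ZMod p) F)) = algebraMap (ZMod p) F := Subsingleton.elim _ _
  let t : F →ₐ[ZMod p] F := { τ with commutes' := fun r => RingHom.congr_fun hcomm r }
  let e : F ≃ₐ[ZMod p] F := AlgEquiv.ofBijective t
    (Finite.injective_iff_bijective.1 t.toRingHom.injective)
  have hfr : Module.finrank (ZMod p) F = f := by
    have h := Module.card_eq_pow_finrank (K := ZMod p) (V := F)
    rw [ZMod.card, hF] at h
    exact (Nat.pow_right_injective hp.two_le h).symm
  have h1 : e ^ f = 1 := by
    rw [← hfr, ← IsGalois.card_aut_eq_finrank]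
    exact pow_card_eq_one'
  have h3 : ∀ k x, (e ^ k) x = τ^[k] x := by
    intro k
    induction k with
    | zero => intro x; rfl
    | succ k ih => intro x; rw [pow_succ, AlgEquiv.mul_apply, ih, Function.iterate_succ_apply]; rfl
  rw [← h3, h1]; rfl

lemma semi_iter {α : F → F} {c : F} {τ : F →+* F} (hc : c ≠ 0) (h : ∀ a, α a = c * τ a) (k : ℕ) :
    ∃ d : F, d ≠ 0 ∧ ∀ a, α^[k] a = d * τ^[k] a := by
  induction k with
  | zero => exact ⟨1, one_ne_zero, fun a => by simp⟩
  | succ k ih =>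
    obtain ⟨d, hd, h1⟩ := ih
    refine ⟨c * τ d, mul_ne_zero hc ((map_ne_zero τ).2 hd), fun a => ?_⟩
    rw [Function.iterate_succ_apply', h1, h, map_mul, Function.iterate_succ_apply', mul_assoc]

lemma inner_of_norm (p f : ℕ) (hp : p.Prime) [CharP F p] (h2 : (2 : F) ≠ 0)
    (hF : Fintype.card F = p ^ f) (σ : MulAut (PSL2 F)) {α β : F → F}
    (hα : ∀ a, σ (UU a) = UU (α a)) (hβ : ∀ a, σ (LL a) = LL (β a)) :
    ∃ g, σ ^ (2 * f) = MulAut.conj g := by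
  obtain ⟨c, τ, hc, hτ⟩ := aut_semi h2 σ hα hβ
  obtain ⟨d, hd, h3⟩ := semi_iter hc hτ f
  have hU : ∀ a, (σ ^ (2 * f)) (UU a) = UU (d ^ 2 * a) := by
    intro a
    rw [two_mul, pow_add, MulAut.mul_apply, sig_iter σ hα, sig_iter σ hα, h3, h3,
      ringhom_iter p f hp hF, ringhom_iter p f hp hF]
    congr 1; ring
  obtain ⟨-, hb, -, h5, -⟩ := aut_rel h2 (σ ^ (2 * f)) hU (sig_iter σ hβ (2 * f))
  have hL : ∀ a, (σ ^ (2 * f)) (LL a) = LL ((d⁻¹) ^ 2 * a) := by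
    intro a
    by_cases ha : a = 0
    · rw [ha, mul_zero, LL_zero, map_one]
    · rw [sig_iter σ hβ]
      have := h5 a⁻¹ (inv_ne_zero ha)
      rw [inv_inv] at this
      rw [this, mul_inv, inv_inv, inv_pow]
  let s : SL(2, F) := ⟨!![d, 0; 0, d⁻¹], by simp [det_fin_two, hd]⟩
  refine ⟨fi s, MulEquiv.ext fun x => ?_⟩
  refine psl_hom_ext (σ ^ (2 * f)).toMonoidHom (MulAut.conj (fi s)).toMonoidHom ?_ ?_ x
  · intro a
    exact (hU a).trans (conj_eq (rel0 (s := s) rfl a)).symm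
  · intro a
    exact (hL a).trans (conj_eq (rel0' (s := s) rfl a)).symm

theorem aut_pow_inner (p f : ℕ) (hp : p.Prime) (hodd : p ≠ 2) [CharP F p]
    (hF : Fintype.card F = p ^ f) (σ : MulAut (PSL2 F)) :
    ∃ g, σ ^ (2 * f) = MulAut.conj g := by
  have h2 : (2 : F) ≠ 0 := Ring.two_ne_zero (by rwa [ringChar.eq F p])
  obtain ⟨g, α, β, hα, hβ⟩ := psl_normalize p f hp hodd h2 hF σ
  obtain ⟨h, hh⟩ := inner_of_norm p f hp h2 hF _ hα hβ
  let I : Subgroup (MulAut (PSL2 F)) := (MulAut.conj (G := PSL2 F)).range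
  have hI : I.Normal := ⟨by
    rintro _ ⟨x, rfl⟩ φ
    refine ⟨φ x, MulEquiv.ext fun y => ?_⟩
    simp [MulAut.conj_apply]⟩
  have e : (QuotientGroup.mk' I) σ ^ (2 * f) = 1 := by
    have e1 : QuotientGroup.mk' I (MulAut.conj g * σ) = QuotientGroup.mk' I σ := by
      have e2 : QuotientGroup.mk' I (MulAut.conj g) = 1 :=
        (QuotientGroup.eq_one_iff (N := I) (MulAut.conj g)).2 ⟨g, rfl⟩
      rw [map_mul, e2, one_mul]
    rw [← e1, ← map_pow, hh]
    exact (QuotientGroup.eq_one_iff _).2 ⟨h, rfl⟩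
  rw [← map_pow] at e
  obtain ⟨k, hk⟩ := (QuotientGroup.eq_one_iff _).1 e
  exact ⟨k, hk.symm⟩

end PSLAut2

lemma pow_mem_of_aut {A : Type} [Group A] (L : Subgroup A) [L.Normal] {S : Type} [Group S]
    (e : L ≃* S) (hc : Subgroup.centralizer (L : Set A) = ⊥) (n : ℕ)
    (haut : ∀ σ : MulAut S, ∃ g, σ ^ n = MulAut.conj g) (a : A) : a ^ n ∈ L := by
  let c : MulAut L := MulAut.conjNormal a
  obtain ⟨g, hg⟩ := haut (MulAut.congr e c)
  rw [← map_pow] at hg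
  have h1 : ∀ x : L, a ^ n * x * (a ^ n)⁻¹ = (e.symm g : A) * x * (e.symm g : A)⁻¹ := by
    intro x
    have h3 := congrArg (fun φ : MulAut S => ((e.symm (φ (e x)) : L) : A)) hg
    have h4 : (MulAut.congr e (c ^ n)) (e x) = e ((c ^ n) x) := by
      simp [MulAut.congr]
    rw [h4, MulAut.conj_apply] at h3
    simp only [map_mul, map_inv, MulEquiv.symm_apply_apply] at h3
    rw [← map_pow, MulAut.conjNormal_apply] at h3
    simpa using h3
  have h5 : (e.symm g : A)⁻¹ * a ^ n ∈ Subgroup.centralizer (L : Set A) := by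
    rw [Subgroup.mem_centralizer_iff]
    intro x hx
    have := h1 ⟨x, hx⟩
    simp only at this
    have h6 : a ^ n * x = (e.symm g : A) * x * (e.symm g : A)⁻¹ * a ^ n := by
      rw [← this]; group
    rw [mul_assoc (_⁻¹), h6]; group
  rw [hc, Subgroup.mem_bot] at h5
  have h7 : a ^ n = e.symm g := by
    rw [inv_mul_eq_one] at h5; exact h5.symm
  rw [h7]; exact (e.symm g).2

/-- Let `q = p^f ≥ 13` with `p` an odd prime and `G` a finite group satisfying the two-prime
hypothesis with normal subgroups `N ≤ M` such that `M/N ≅ PSL₂(q)` and the centralizer of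
`M/N` in `G/N` is trivial.  Then the union `B₂`, over all irreducible characters `θ` of `N`
that are not `M`-invariant, of `cd(G|θ) \ cd(G/N)`, has at most `9` elements. -/
theorem B2_bound_psl2_odd
    (p f : ℕ) (hp : p.Prime) (hodd : Odd p) (hq : 13 ≤ p ^ f)
    (F : Type) [Field F] [Fintype F] (hF : Fintype.card F = p ^ f)
    (G : Type) [Group G] [Finite G] (hG : TwoPrimeHypothesis G)
    (N M : Subgroup G) [N.Normal] [M.Normal] (hNM : N ≤ M)
    (hiso : Nonempty ((M.map (QuotientGroup.mk' N)) ≃* PSL2 F))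
    (hcent : Subgroup.centralizer ((M.map (QuotientGroup.mk' N)) : Set (G ⧸ N)) = ⊥) :
    {n | ∃ θ : FDRep ℂ N, Simple θ ∧ ¬ IsMInvariant M θ ∧
      n ∈ charDegreesOver G N θ ∧ n ∉ charDegrees (G ⧸ N)}.ncard ≤ 9 := by
  obtain ⟨e⟩ := hiso
  have hpf : Fact p.Prime := ⟨hp⟩
  have hp2 : p ≠ 2 := by rintro rfl; exact absurd hodd (by decide)
  have hch : CharP F p := by
    obtain ⟨r, hr⟩ := CharP.exists F
    obtain ⟨n, hrp, hn⟩ := FiniteField.card F r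
    have : p = r := by
      have h1 : r ∣ p ^ f := by
        rw [← hF, hn]; exact dvd_pow_self r n.ne_zero
      exact ((Nat.prime_dvd_prime_iff_eq hrp hp).1 (hrp.dvd_of_dvd_pow h1)).symm
    rw [this]; exact hr
  have hLn : (M.map (QuotientGroup.mk' N)).Normal :=
    Subgroup.Normal.map inferInstance _ (QuotientGroup.mk'_surjective N)
  have hmem : ∀ g : G, QuotientGroup.mk' N g ∈ M.map (QuotientGroup.mk' N) → g ∈ M := by
    rintro g ⟨m, hm, h⟩
    have : m⁻¹ * g ∈ N := QuotientGroup.eq.1 h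
    have h3 := M.mul_mem hm (hNM this)
    rwa [mul_inv_cancel_left] at h3
  let ρ : M →* M.map (QuotientGroup.mk' N) := (QuotientGroup.mk' N).subgroupMap M
  refine final_of_B p f hp hodd hq hF hG N hNM (e.toMonoidHom.comp ρ)
    (e.surjective.comp ((QuotientGroup.mk' N).subgroupMap_surjective M)) (fun m => ?_) (fun g => ?_)
  · show e (ρ m) = 1 ↔ _
    rw [map_eq_one_iff e e.injective, ← QuotientGroup.eq_one_iff (N := N) (m : G)]
    exact Subtype.ext_iff
  · apply hmem
    rw [map_pow]
    exact pow_mem_of_aut _ e hcent (2 * f) (aut_pow_inner p f hp hp2 hF) _
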